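/- Fix σ > 0, (i_0, j_0) ∈ (0,1)² with j_0 < i_0, a constant C > 0, and a sequence m = m(n) of positive integers with m(n) → ∞ and m(n)/n → 0. For each n, let X_n be a random Hermitian matrix such that X_n/√(σ² n) is an n×n GUE matrix, and let λ_{i,j} denote the j-th largest eigenvalue of the top-left i×i principal minor of X_n. Let P_n = {(i,j) ∈ ℤ² : |i − ⌈i_0 n⌉| ≤ m, |j − ⌈j_0 n⌉| ≤ m} and let M_n be the covariance matrix of the vector of interlacing gaps (λ_{i,j} − λ_{i−1,j})_{(i,j) ∈ P_n}. Then there exist C' > 0 and n_0 such that for all n > n_0, the operator norm of M_n satisfies ‖M_n‖_op ≤ C' m² / (log m)^C. -/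

import Mathlib

open MeasureTheory ProbabilityTheory

noncomputable section

instance matrixMeasurableSpace {n : ℕ} : MeasurableSpace (Matrix (Fin n) (Fin n) ℂ) :=
  (inferInstance : MeasurableSpace (Fin n → Fin n → ℂ))

/-- The distribution of an `n×n` GUE matrix. -/
def gueMeasure (n : ℕ) : Measure (Matrix (Fin n) (Fin n) ℂ) :=
  Measure.map
    (fun ω : (Fin n → ℝ) × (Fin n × Fin n → ℝ × ℝ) =>
      Matrix.of fun i j =>
        if i = j then (ω.1 i : ℂ)
        else if i < j then ((ω.2 (i, j)).1 : ℂ) + ((ω.2 (i, j)).2 : ℂ) * Complex.I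
        else ((ω.2 (j, i)).1 : ℂ) - ((ω.2 (j, i)).2 : ℂ) * Complex.I)
    ((Measure.pi fun _ : Fin n => gaussianReal 0 1).prod
      (Measure.pi fun _ : Fin n × Fin n =>
        (gaussianReal 0 (1 / 2)).prod (gaussianReal 0 (1 / 2))))

/-- The eigenvalues of a (Hermitian) matrix, in nonincreasing order. -/
def eigsDesc {n : ℕ} (M : Matrix (Fin n) (Fin n) ℂ) : Fin n → ℝ :=
  if h : M.IsHermitian then fun i => h.eigenvalues (Tuple.sort h.eigenvalues i.rev) else 0

/-- `λ_{i,j}(X_n)` for `X_n = √(σ² n) · M`: the `j`-th largest eigenvalue of the top-left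
`i × i` principal minor of `X_n` (for `1 ≤ j ≤ i ≤ n`; junk value `0` otherwise). -/
def minorEig {n : ℕ} (σ : ℝ) (M : Matrix (Fin n) (Fin n) ℂ) (i j : ℕ) : ℝ :=
  if h : 1 ≤ j ∧ j ≤ i ∧ i ≤ n then
    Real.sqrt (σ ^ 2 * n) *
      eigsDesc (Matrix.of fun a b : Fin i =>
        M ⟨a.val, by omega⟩ ⟨b.val, by omega⟩) ⟨j - 1, by omega⟩
  else 0

/-- The patch of indices `P_n`, encoded by `Fin (2m+1) × Fin (2m+1)`:
`(a, b) ↦ (⌈i₀n⌉ − m + a, ⌈j₀n⌉ − m + b)`. -/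
def patchIdx (i0 j0 : ℝ) (n m : ℕ) (p : Fin (2 * m + 1) × Fin (2 * m + 1)) : ℕ × ℕ :=
  ((⌈i0 * n⌉ - m + p.1.val).toNat, (⌈j0 * n⌉ - m + p.2.val).toNat)

/-- The interlacing gap `λ_{i,j} − λ_{i−1,j}` at the patch position `p`. -/
def patchGap {n : ℕ} (σ i0 j0 : ℝ) (m : ℕ) (p : Fin (2 * m + 1) × Fin (2 * m + 1))
    (M : Matrix (Fin n) (Fin n) ℂ) : ℝ :=
  minorEig σ M (patchIdx i0 j0 n m p).1 (patchIdx i0 j0 n m p).2 -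
    minorEig σ M ((patchIdx i0 j0 n m p).1 - 1) (patchIdx i0 j0 n m p).2

/-- The covariance matrix of the vector of interlacing gaps over the patch. -/
def covMatrix (σ i0 j0 : ℝ) (n m : ℕ) :
    Matrix (Fin (2 * m + 1) × Fin (2 * m + 1)) (Fin (2 * m + 1) × Fin (2 * m + 1)) ℝ :=
  Matrix.of fun p q =>
    (∫ M, patchGap σ i0 j0 m p M * patchGap σ i0 j0 m q M ∂gueMeasure n) -
      (∫ M, patchGap σ i0 j0 m p M ∂gueMeasure n) *
        (∫ M, patchGap σ i0 j0 m q M ∂gueMeasure n)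

set_option linter.unusedSectionVars false

/-- The standard Gaussian measure on `κ → ℝ`. -/
def stdGauss (κ : Type*) [Fintype κ] : Measure (κ → ℝ) :=
  Measure.pi fun _ : κ => gaussianReal 0 1

section
variable {κ : Type*} [Fintype κ]

instance : IsProbabilityMeasure (stdGauss κ) := by unfold stdGauss; infer_instance

/-- The Lebesgue density of the standard Gaussian measure on `κ → ℝ`. -/
def stdGaussPDF (x : κ → ℝ) : ℝ := ∏ i, gaussianPDFReal 0 1 (x i)

lemma stdGaussPDF_pos (x : κ → ℝ) : 0 < stdGaussPDF x :=
  Finset.prod_pos fun _ _ => gaussianPDFReal_pos _ _ _ one_ne_zero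

lemma measurable_stdGaussPDF : Measurable (stdGaussPDF (κ := κ)) := by
  unfold stdGaussPDF
  exact Finset.measurable_prod _ fun i _ =>
    (measurable_gaussianPDFReal 0 1).comp (measurable_pi_apply i)

lemma integrable_stdGaussPDF : Integrable (stdGaussPDF (κ := κ)) volume :=
  Integrable.fintype_prod (f := fun _ : κ => gaussianPDFReal 0 1)
    fun _ => integrable_gaussianPDFReal 0 1

lemma stdGauss_eq_withDensity :
    stdGauss κ = volume.withDensity fun x => ENNReal.ofReal (stdGaussPDF x) := by
  unfold stdGauss
  refine (Measure.pi_eq fun s hs => ?_)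
  have hbox : MeasurableSet (Set.pi Set.univ s) := MeasurableSet.univ_pi hs
  rw [withDensity_apply _ hbox,
    ← ofReal_integral_eq_lintegral_ofReal integrable_stdGaussPDF.integrableOn
      (Filter.Eventually.of_forall fun x => (stdGaussPDF_pos x).le)]
  rw [← integral_indicator hbox]
  have h1 : ∀ x : κ → ℝ, (Set.pi Set.univ s).indicator stdGaussPDF x =
      ∏ i, (s i).indicator (gaussianPDFReal 0 1) (x i) := by
    intro x
    by_cases hx : x ∈ Set.pi Set.univ s
    · rw [Set.indicator_of_mem hx]
      refine Finset.prod_congr rfl fun i _ => ?_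
      rw [Set.indicator_of_mem (hx i trivial)]
    · rw [Set.indicator_of_notMem hx]
      simp only [Set.mem_pi, Set.mem_univ, true_implies, not_forall] at hx
      obtain ⟨i, hi⟩ := hx
      exact (Finset.prod_eq_zero (Finset.mem_univ i) (Set.indicator_of_notMem hi _)).symm
  simp_rw [h1]
  rw [integral_fintype_prod_volume_eq_prod (fun i => (s i).indicator (gaussianPDFReal 0 1)),
    ENNReal.ofReal_prod_of_nonneg]
  · refine Finset.prod_congr rfl fun i _ => ?_
    rw [integral_indicator (hs i), gaussianReal_apply_eq_integral _ one_ne_zero]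
  · intro i _
    exact integral_nonneg fun x => Set.indicator_nonneg (fun y _ => gaussianPDFReal_nonneg _ _ _) _

lemma stdGauss_absolutelyContinuous : stdGauss κ ≪ volume := by
  rw [stdGauss_eq_withDensity]; exact withDensity_absolutelyContinuous _ _

lemma absolutelyContinuous_stdGauss : (volume : Measure (κ → ℝ)) ≪ stdGauss κ := by
  rw [stdGauss_eq_withDensity]
  refine withDensity_absolutelyContinuous' (by have := measurable_stdGaussPDF (κ := κ); fun_prop) ?_
  exact Filter.Eventually.of_forall fun x => by simpa using stdGaussPDF_pos x

instance : Measure.IsOpenPosMeasure (stdGauss κ) :=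
  absolutelyContinuous_stdGauss.isOpenPosMeasure

lemma integral_stdGauss (F : (κ → ℝ) → ℝ) :
    ∫ x, F x ∂stdGauss κ = ∫ x, stdGaussPDF x * F x := by
  rw [stdGauss_eq_withDensity, integral_withDensity_eq_integral_toReal_smul]
  · refine integral_congr_ae (Filter.Eventually.of_forall fun x => ?_)
    simp [ENNReal.toReal_ofReal (stdGaussPDF_pos x).le]
  · have := measurable_stdGaussPDF (κ := κ); fun_prop
  · simp

lemma stdGaussPDF_sub (x h : κ → ℝ) :
    stdGaussPDF (x - h) = stdGaussPDF x * Real.exp (∑ i, (h i * x i - h i ^ 2 / 2)) := by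
  unfold stdGaussPDF
  rw [Real.exp_sum, ← Finset.prod_mul_distrib]
  refine Finset.prod_congr rfl fun i _ => ?_
  simp only [gaussianPDFReal, Pi.sub_apply, mul_assoc, ← Real.exp_add]
  congr 3
  simp
  ring

/-- The Cameron–Martin shift formula. -/
lemma integral_stdGauss_add (F : (κ → ℝ) → ℝ) (h : κ → ℝ) :
    ∫ x, F (x + h) ∂stdGauss κ =
      ∫ x, F x * Real.exp (∑ i, (h i * x i - h i ^ 2 / 2)) ∂stdGauss κ := by
  rw [integral_stdGauss, integral_stdGauss,
    ← integral_sub_right_eq_self (μ := (volume : Measure (κ → ℝ)))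
      (fun x => stdGaussPDF x * F (x + h)) h]
  refine integral_congr_ae (Filter.Eventually.of_forall fun x => ?_)
  simp only [sub_add_cancel, stdGaussPDF_sub]
  ring

/-- Functions with at most exponential growth. -/
def ExpBdd (f : (κ → ℝ) → ℝ) : Prop :=
  ∃ C c : ℝ, 0 ≤ C ∧ 0 ≤ c ∧ ∀ x, |f x| ≤ C * Real.exp (c * ∑ i, |x i|)

lemma integrable_exp_abs_gauss (c : ℝ) :
    Integrable (fun x : ℝ => Real.exp (c * |x|)) (gaussianReal 0 1) := by
  refine ((integrable_exp_mul_gaussianReal (μ := 0) (v := 1) c).add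
    (integrable_exp_mul_gaussianReal (μ := 0) (v := 1) (-c))).mono' (by fun_prop) ?_
  refine Filter.Eventually.of_forall fun x => ?_
  simp only [Real.norm_eq_abs, Real.abs_exp, Pi.add_apply]
  rcases abs_cases x with ⟨h, _⟩ | ⟨h, _⟩ <;> rw [h]
  · have := Real.exp_pos (-c * x); linarith
  · have := Real.exp_pos (c * x)
    rw [show c * -x = -c * x by ring]; linarith

lemma integrable_exp_sum_abs (c : ℝ) :
    Integrable (fun x : κ → ℝ => Real.exp (c * ∑ i, |x i|)) (stdGauss κ) := by
  simp_rw [Finset.mul_sum, Real.exp_sum]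
  exact Integrable.fintype_prod (f := fun (_ : κ) (t : ℝ) => Real.exp (c * |t|))
    fun _ => integrable_exp_abs_gauss c

namespace ExpBdd
variable {f g : (κ → ℝ) → ℝ}

lemma integrable (hf : ExpBdd f) (hm : AEStronglyMeasurable f (stdGauss κ)) :
    Integrable f (stdGauss κ) := by
  obtain ⟨C, c, -, -, h⟩ := hf
  exact ((integrable_exp_sum_abs c).const_mul C).mono' hm (Filter.Eventually.of_forall h)

lemma mono (hg : ExpBdd g) (h : ∀ x, |f x| ≤ |g x|) : ExpBdd f := by
  obtain ⟨C, c, hC, hc, h'⟩ := hg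
  exact ⟨C, c, hC, hc, fun x => (h x).trans (h' x)⟩

lemma add (hf : ExpBdd f) (hg : ExpBdd g) : ExpBdd fun x => f x + g x := by
  obtain ⟨C, c, hC, hc, h⟩ := hf
  obtain ⟨C', c', hC', hc', h'⟩ := hg
  refine ⟨C + C', c + c', by positivity, by positivity, fun x => ?_⟩
  have hS : 0 ≤ ∑ i, |x i| := Finset.sum_nonneg fun i _ => abs_nonneg _
  have e1 : Real.exp (c * ∑ i, |x i|) ≤ Real.exp ((c + c') * ∑ i, |x i|) := by
    apply Real.exp_le_exp.2; nlinarith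
  have e2 : Real.exp (c' * ∑ i, |x i|) ≤ Real.exp ((c + c') * ∑ i, |x i|) := by
    apply Real.exp_le_exp.2; nlinarith
  calc |f x + g x| ≤ |f x| + |g x| := abs_add_le _ _
    _ ≤ C * Real.exp (c * ∑ i, |x i|) + C' * Real.exp (c' * ∑ i, |x i|) := add_le_add (h x) (h' x)
    _ ≤ _ := by nlinarith

lemma mul (hf : ExpBdd f) (hg : ExpBdd g) : ExpBdd fun x => f x * g x := by
  obtain ⟨C, c, hC, hc, h⟩ := hf
  obtain ⟨C', c', hC', hc', h'⟩ := hg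
  refine ⟨C * C', c + c', by positivity, by positivity, fun x => ?_⟩
  rw [abs_mul, add_mul, Real.exp_add]
  calc |f x| * |g x| ≤ (C * Real.exp (c * ∑ i, |x i|)) * (C' * Real.exp (c' * ∑ i, |x i|)) :=
        mul_le_mul (h x) (h' x) (abs_nonneg _) (by positivity)
    _ = _ := by ring

lemma const (a : ℝ) : ExpBdd fun _ : κ → ℝ => a :=
  ⟨|a|, 0, abs_nonneg _, le_rfl, fun x => by simp⟩

lemma sum {ι : Type*} (s : Finset ι) {F : ι → (κ → ℝ) → ℝ} (h : ∀ i ∈ s, ExpBdd (F i)) :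
    ExpBdd fun x => ∑ i ∈ s, F i x := by
  classical
  induction s using Finset.induction_on with
  | empty => simpa using const 0
  | insert a s ha ih =>
    simp_rw [Finset.sum_insert ha]
    exact (h a (by simp)).add (ih fun i hi => h i (by simp [hi]))

lemma pow (hf : ExpBdd f) (n : ℕ) : ExpBdd fun x => f x ^ n := by
  induction n with
  | zero => simpa using const 1
  | succ n ih => simpa [pow_succ] using ih.mul hf

lemma exp_sum_abs {c : ℝ} (hc : 0 ≤ c) : ExpBdd fun x : κ → ℝ => Real.exp (c * ∑ i, |x i|) :=
  ⟨1, c, zero_le_one, hc, fun x => by simp⟩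

lemma sum_abs : ExpBdd fun x : κ → ℝ => ∑ i, |x i| := by
  refine ⟨1, 1, zero_le_one, zero_le_one, fun x => ?_⟩
  rw [abs_of_nonneg (Finset.sum_nonneg fun i _ => abs_nonneg _), one_mul, one_mul]
  have := Real.add_one_le_exp (∑ i, |x i|)
  linarith

lemma coord (i : κ) : ExpBdd fun x : κ → ℝ => x i :=
  sum_abs.mono fun x => by
    rw [abs_of_nonneg (a := ∑ i, |x i|) (Finset.sum_nonneg fun i _ => abs_nonneg _)]
    exact Finset.single_le_sum (f := fun i => |x i|) (fun i _ => abs_nonneg _) (Finset.mem_univ i)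

lemma norm_pi : ExpBdd fun x : κ → ℝ => ‖x‖ :=
  sum_abs.mono fun x => by
    have hS : 0 ≤ ∑ i, |x i| := Finset.sum_nonneg fun i _ => abs_nonneg _
    rw [abs_of_nonneg (norm_nonneg _), abs_of_nonneg hS, pi_norm_le_iff_of_nonneg hS]
    intro i
    exact Finset.single_le_sum (f := fun i => |x i|) (fun i _ => abs_nonneg _) (Finset.mem_univ i)

lemma of_lipschitz {K : NNReal} (h : LipschitzWith K f) : ExpBdd f := by
  refine ((const |f 0|).add ((const K).mul norm_pi)).mono fun x => ?_
  have h1 := h.dist_le_mul x 0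
  rw [Real.dist_eq, dist_zero_right] at h1
  have h2 : |f x| ≤ |f 0| + |f x - f 0| := by
    have := abs_add_le (f 0) (f x - f 0); simpa using this
  refine h2.trans ((add_le_add_right h1 _).trans (le_abs_self _))

lemma poly (p : MvPolynomial κ ℝ) : ExpBdd fun x => MvPolynomial.eval x p := by
  induction p using MvPolynomial.induction_on with
  | C a => simpa using const a
  | add p q hp hq => simpa using hp.add hq
  | mul_X p i hp => simpa using hp.mul (coord i)

end ExpBdd

lemma continuous_polyEval (p : MvPolynomial κ ℝ) :
    Continuous fun x : κ → ℝ => MvPolynomial.eval x p := MvPolynomial.continuous_eval p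

lemma integrable_poly (p : MvPolynomial κ ℝ) :
    Integrable (fun x => MvPolynomial.eval x p) (stdGauss κ) :=
  (ExpBdd.poly p).integrable (continuous_polyEval p).aestronglyMeasurable

end

section
open MvPolynomial
variable {κ : Type*} [Fintype κ]

lemma hasFDerivAt_polyEval [DecidableEq κ] (p : MvPolynomial κ ℝ) (x : κ → ℝ) :
    HasFDerivAt (fun y : κ → ℝ => eval y p)
      (∑ i, eval x (pderiv i p) • (ContinuousLinearMap.proj i : (κ → ℝ) →L[ℝ] ℝ)) x := by
  induction p using MvPolynomial.induction_on with
  | C a => simpa using hasFDerivAt_const a x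
  | add p q hp hq =>
    refine (hp.add hq).congr_fderiv ?_ |>.congr_of_eventuallyEq (Filter.Eventually.of_forall fun y => by simp)
    simp [add_smul, Finset.sum_add_distrib]
  | mul_X p j hp =>
    have h := hp.mul (hasFDerivAt_apply (𝕜 := ℝ) j x)
    simp only [map_mul, eval_X, Derivation.leibniz, pderiv_X, smul_eq_mul, map_add]
    refine h.congr_fderiv ?_
    simp only [add_smul, Finset.sum_add_distrib]
    congr 1
    · rw [Finset.sum_eq_single j]
      · simp
      · intro i _ hij; simp [Pi.single_eq_of_ne hij.symm]
      · simp
    · simp [Finset.smul_sum, mul_smul]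

/-- The gradient of a polynomial function. -/
def polyGrad (u : MvPolynomial κ ℝ) (x : κ → ℝ) : κ → ℝ := fun i => eval x (pderiv i u)

/-- The Ornstein–Uhlenbeck operator `u ↦ ∑ᵢ (xᵢ ∂ᵢ u - ∂ᵢ² u)` on polynomials. -/
def ouGen (u : MvPolynomial κ ℝ) : MvPolynomial κ ℝ :=
  ∑ i, (X i * pderiv i u - pderiv i (pderiv i u))

lemma fderiv_polyEval (p : MvPolynomial κ ℝ) (x e : κ → ℝ) :
    fderiv ℝ (fun y : κ → ℝ => eval y p) x e = ∑ i, polyGrad p x i * e i := by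
  classical
  rw [(hasFDerivAt_polyEval p x).fderiv]
  simp [polyGrad]

lemma hasDerivAt_polyEval_line (p : MvPolynomial κ ℝ) (x e : κ → ℝ) (t : ℝ) :
    HasDerivAt (fun s : ℝ => eval (x + s • e) p) (∑ i, polyGrad p (x + t • e) i * e i) t := by
  classical
  have h := (hasFDerivAt_polyEval p (x + t • e)).comp_hasDerivAt t
    (((hasDerivAt_id t).smul_const e).const_add x)
  simpa [polyGrad, Function.comp_def] using h

lemma continuous_polyGrad (u : MvPolynomial κ ℝ) : Continuous (polyGrad u) :=
  continuous_pi fun i => continuous_polyEval _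

lemma ae_differentiableAt_stdGauss {φ : (κ → ℝ) → ℝ} {K : NNReal} (h : LipschitzWith K φ) :
    ∀ᵐ x ∂stdGauss κ, DifferentiableAt ℝ φ x :=
  stdGauss_absolutelyContinuous.ae_le h.ae_differentiableAt

lemma abs_fderiv_le_of_lipschitz {φ : (κ → ℝ) → ℝ} {K : NNReal} (h : LipschitzWith K φ)
    (x e : κ → ℝ) : |fderiv ℝ φ x e| ≤ K * ‖e‖ :=
  (ContinuousLinearMap.le_opNorm _ _).trans
    (mul_le_mul_of_nonneg_right (norm_fderiv_le_of_lipschitz ℝ h) (norm_nonneg _))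

lemma hasDerivAt_integral_shift {φ : (κ → ℝ) → ℝ} {K : NNReal} (hφ : LipschitzWith K φ)
    (e : κ → ℝ) {q : (κ → ℝ) → ℝ} (hq : Integrable q (stdGauss κ))
    (hφq : Integrable (fun x => φ x * q x) (stdGauss κ)) :
    HasDerivAt (fun t : ℝ => ∫ x, φ (x + t • e) * q x ∂stdGauss κ)
      (∫ x, fderiv ℝ φ x e * q x ∂stdGauss κ) 0 := by
  refine (hasDerivAt_integral_of_dominated_loc_of_lip (s := Set.univ)
    (bound := fun x => K * ‖e‖ * |q x|) Filter.univ_mem ?_ ?_ ?_ ?_ ?_ ?_).2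
  · refine Filter.Eventually.of_forall fun t => AEStronglyMeasurable.mul ?_ hq.aestronglyMeasurable
    exact (hφ.continuous.comp (by fun_prop)).aestronglyMeasurable
  · simpa using hφq
  · exact (measurable_fderiv_apply_const ℝ φ e).aestronglyMeasurable.mul hq.aestronglyMeasurable
  · refine Filter.Eventually.of_forall fun x => ?_
    refine LipschitzWith.lipschitzOnWith (LipschitzWith.of_dist_le_mul fun s t => ?_)
    rw [Real.dist_eq, ← sub_mul, abs_mul, Real.coe_nnabs, dist_eq_norm,
      abs_of_nonneg (a := (K : ℝ) * ‖e‖ * |q x|) (by positivity)]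
    have h1 := hφ.dist_le_mul (x + s • e) (x + t • e)
    rw [Real.dist_eq, dist_add_left, dist_eq_norm, ← sub_smul, norm_smul] at h1
    calc _ ≤ K * (‖s - t‖ * ‖e‖) * |q x| := mul_le_mul_of_nonneg_right h1 (abs_nonneg _)
      _ = _ := by ring
  · exact hq.abs.const_mul _
  · filter_upwards [ae_differentiableAt_stdGauss hφ] with x hx
    have h2 : HasDerivAt (fun t : ℝ => φ (x + t • e)) (fderiv ℝ φ x e) 0 := by
      have hx' : HasFDerivAt φ (fderiv ℝ φ x) (x + (0:ℝ) • e) := by simpa using hx.hasFDerivAt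
      have := hx'.comp_hasDerivAt (0:ℝ) (((hasDerivAt_id (0:ℝ)).smul_const e).const_add x)
      simpa [Function.comp_def] using this
    exact h2.mul_const _

lemma sum_single_shift [DecidableEq κ] (i : κ) (t : ℝ) (x : κ → ℝ) :
    ∑ j, ((t • (Pi.single i 1 : κ → ℝ)) j * x j - (t • (Pi.single i 1 : κ → ℝ)) j ^ 2 / 2) =
      t * x i - t ^ 2 / 2 := by
  rw [Finset.sum_eq_single i]
  · simp
  · intro j _ hj; simp [Pi.single_eq_of_ne hj]
  · simp

lemma hasDerivAt_integral_density {φ : (κ → ℝ) → ℝ} (hφ : ExpBdd φ) (hm : Continuous φ)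
    [DecidableEq κ] (i : κ) (q : MvPolynomial κ ℝ) :
    HasDerivAt (fun t : ℝ => ∫ x, φ x * eval (x + (-t) • (Pi.single i 1 : κ → ℝ)) q *
        Real.exp (t * x i - t ^ 2 / 2) ∂stdGauss κ)
      (∫ x, φ x * eval x (X i * q - pderiv i q) ∂stdGauss κ) 0 := by
  set e : κ → ℝ := Pi.single i 1 with he
  set r := X i * q - pderiv i q with hr
  obtain ⟨A, a, hA, ha, hAa⟩ := hφ
  obtain ⟨B, b, hB, hb, hBb⟩ := ExpBdd.poly r
  have key := (hasDerivAt_integral_of_dominated_loc_of_deriv_le (μ := stdGauss κ) (𝕜 := ℝ)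
    (F := fun t x => φ x * eval (x + (-t) • e) q * Real.exp (t * x i - t ^ 2 / 2))
    (F' := fun t x => φ x * eval (x + (-t) • e) r * Real.exp (t * x i - t ^ 2 / 2))
    (x₀ := (0:ℝ)) (s := Metric.ball 0 1)
    (bound := fun x => A * B * Real.exp b * Real.exp ((a + b + 1) * ∑ j, |x j|))
    (Metric.ball_mem_nhds _ one_pos) ?_ ?_ ?_ ?_ ?_ ?_).2
  · simpa using key
  · refine Filter.Eventually.of_forall fun t => Continuous.aestronglyMeasurable ?_
    exact (hm.mul ((continuous_polyEval q).comp (by fun_prop))).mul (by fun_prop)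
  · simp only [neg_zero, zero_smul, add_zero, zero_mul, ne_eq, OfNat.ofNat_ne_zero,
      not_false_eq_true, zero_pow, zero_div, sub_zero, Real.exp_zero, mul_one]
    exact (ExpBdd.mul ⟨A, a, hA, ha, hAa⟩ (ExpBdd.poly q)).integrable
      (hm.mul (continuous_polyEval q)).aestronglyMeasurable
  · refine Continuous.aestronglyMeasurable ?_
    exact (hm.mul ((continuous_polyEval r).comp (by fun_prop))).mul (by fun_prop)
  · refine Filter.Eventually.of_forall fun x t ht => ?_
    have ht1 : |t| ≤ 1 := by simpa using (Metric.mem_ball.1 ht).le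
    have hS : 0 ≤ ∑ j, |x j| := Finset.sum_nonneg fun _ _ => abs_nonneg _
    have h1 : ∑ j, |(x + (-t) • e) j| ≤ ∑ j, |x j| + 1 := by
      calc _ ≤ ∑ j, (|x j| + |t| * |e j|) := by
            refine Finset.sum_le_sum fun j _ => ?_
            simp only [Pi.add_apply, Pi.smul_apply, smul_eq_mul]
            refine (abs_add_le _ _).trans ?_
            rw [abs_mul, abs_neg]
        _ = ∑ j, |x j| + |t| := by
            rw [Finset.sum_add_distrib, ← Finset.mul_sum,
              Finset.sum_eq_single (f := fun j => |e j|) i]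
            · simp [he]
            · intro j _ hj; simp [he, Pi.single_eq_of_ne hj]
            · simp
        _ ≤ _ := by linarith
    have h2 : t * x i - t ^ 2 / 2 ≤ ∑ j, |x j| := by
      have h3 : |x i| ≤ ∑ j, |x j| := Finset.single_le_sum (f := fun j => |x j|)
        (fun _ _ => abs_nonneg _) (Finset.mem_univ i)
      have h4 : t * x i ≤ |t| * |x i| := by rw [← abs_mul]; exact le_abs_self _
      nlinarith [abs_nonneg (x i), sq_nonneg t]
    rw [Real.norm_eq_abs, abs_mul, abs_mul, Real.abs_exp]
    calc |φ x| * |eval (x + -t • e) r| * Real.exp (t * x i - t ^ 2 / 2)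
        ≤ (A * Real.exp (a * ∑ j, |x j|)) * (B * Real.exp (b * (∑ j, |x j| + 1))) *
          Real.exp (∑ j, |x j|) := by
          refine mul_le_mul (mul_le_mul (hAa x) ((hBb _).trans ?_) (abs_nonneg _) (by positivity))
            (Real.exp_le_exp.2 h2) (by positivity) (by positivity)
          exact mul_le_mul_of_nonneg_left
            (Real.exp_le_exp.2 (mul_le_mul_of_nonneg_left h1 hb)) hB
      _ = _ := by
          rw [show (a + b + 1) * ∑ j, |x j| = a * ∑ j, |x j| + b * ∑ j, |x j| + ∑ j, |x j| by ring,
            mul_add, Real.exp_add, Real.exp_add, Real.exp_add, mul_one]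
          ring
  · exact (integrable_exp_sum_abs _).const_mul _
  · refine Filter.Eventually.of_forall fun x t _ => ?_
    have h1 : HasDerivAt (fun s : ℝ => eval (x + (-s) • e) q)
        (-eval (x + (-t) • e) (pderiv i q)) t := by
      have := (hasDerivAt_polyEval_line q x e (-t)).scomp t (hasDerivAt_neg t)
      refine this.congr_deriv ?_
      rw [Finset.sum_eq_single i]
      · simp [he, polyGrad]
      · intro j _ hj; simp [he, Pi.single_eq_of_ne hj]
      · simp
    have h2 : HasDerivAt (fun s : ℝ => Real.exp (s * x i - s ^ 2 / 2))
        (Real.exp (t * x i - t ^ 2 / 2) * (x i - t)) t := by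
      have : HasDerivAt (fun s : ℝ => s * x i - s ^ 2 / 2) (x i - t) t := by
        have := ((hasDerivAt_id t).mul_const (x i)).sub (((hasDerivAt_id t).pow 2).div_const 2)
        refine this.congr_deriv ?_
        simp
      exact this.exp
    refine (((h1.const_mul (φ x)).mul h2)).congr_deriv ?_
    simp only [hr, map_sub, map_mul, eval_X, Pi.add_apply, Pi.smul_apply, he, Pi.single_eq_same,
      smul_eq_mul]
    ring

lemma integral_mul_ibp {φ : (κ → ℝ) → ℝ} {K : NNReal} (hφ : LipschitzWith K φ) [DecidableEq κ]
    (i : κ) (q : MvPolynomial κ ℝ) :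
    ∫ x, φ x * eval x (X i * q - pderiv i q) ∂stdGauss κ =
      ∫ x, fderiv ℝ φ x (Pi.single i 1) * eval x q ∂stdGauss κ := by
  have hb := ExpBdd.of_lipschitz hφ
  have h1 := hasDerivAt_integral_density hb hφ.continuous i q
  have h2 := hasDerivAt_integral_shift hφ (Pi.single i 1) (integrable_poly q)
    ((hb.mul (ExpBdd.poly q)).integrable
      (hφ.continuous.mul (continuous_polyEval q)).aestronglyMeasurable)
  refine h1.unique (h2.congr_of_eventuallyEq (Filter.Eventually.of_forall fun t => ?_))
  dsimp only
  have := integral_stdGauss_add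
    (fun x => φ x * eval (x + (-t) • (Pi.single i 1 : κ → ℝ)) q) (t • Pi.single i 1)
  simp only [sum_single_shift] at this
  rw [← this]
  simp [add_assoc]

lemma integral_poly_ibp_zero [DecidableEq κ] (i : κ) (q : MvPolynomial κ ℝ) :
    ∫ x, eval x (X i * q - pderiv i q) ∂stdGauss κ = 0 := by
  have := integral_mul_ibp (φ := fun _ => (1:ℝ)) (K := 0) (LipschitzWith.const 1) i q
  simpa using this

lemma integral_poly_mul_ibp (i : κ) (p q : MvPolynomial κ ℝ) :
    ∫ x, eval x p * eval x (X i * q - pderiv i q) ∂stdGauss κ =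
      ∫ x, eval x (pderiv i p) * eval x q ∂stdGauss κ := by
  classical
  have h := integral_poly_ibp_zero i (p * q)
  rw [← sub_eq_zero, ← integral_sub, ← h]
  · refine integral_congr_ae (Filter.Eventually.of_forall fun x => ?_)
    simp only [Derivation.leibniz, smul_eq_mul, map_sub, map_mul, map_add, eval_X]
    ring
  · simpa only [← map_mul] using integrable_poly (p * (X i * q - pderiv i q))
  · simpa only [← map_mul] using integrable_poly (pderiv i p * q)

/-- Integration by parts for Lipschitz functions. -/
lemma integral_mul_ouGen {φ : (κ → ℝ) → ℝ} {K : NNReal} (hφ : LipschitzWith K φ)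
    (u : MvPolynomial κ ℝ) :
    ∫ x, φ x * eval x (ouGen u) ∂stdGauss κ =
      ∫ x, fderiv ℝ φ x (polyGrad u x) ∂stdGauss κ := by
  classical
  have h1 : ∀ x, φ x * eval x (ouGen u) =
      ∑ i, φ x * eval x (X i * pderiv i u - pderiv i (pderiv i u)) := by
    intro x; rw [ouGen, map_sum, Finset.mul_sum]
  have h2 : ∀ x, fderiv ℝ φ x (polyGrad u x) =
      ∑ i, fderiv ℝ φ x (Pi.single i 1) * eval x (pderiv i u) := by
    intro x
    conv_lhs => rw [pi_eq_sum_univ' (polyGrad u x)]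
    simp [polyGrad, mul_comm]
  simp_rw [h1, h2]
  rw [integral_finsetSum, integral_finsetSum]
  · exact Finset.sum_congr rfl fun i _ => integral_mul_ibp hφ i _
  · intro i _
    refine ((integrable_poly (pderiv i u)).norm.const_mul (K * ‖(Pi.single i 1 : κ → ℝ)‖)).mono' ?_ ?_
    · exact ((measurable_fderiv_apply_const ℝ φ _).mul
        (continuous_polyEval _).measurable).aestronglyMeasurable
    · refine Filter.Eventually.of_forall fun x => ?_
      rw [norm_mul]
      exact mul_le_mul_of_nonneg_right (abs_fderiv_le_of_lipschitz hφ _ _) (norm_nonneg _)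
  · intro i _
    exact ((ExpBdd.of_lipschitz hφ).mul (ExpBdd.poly _)).integrable
      (hφ.continuous.mul (continuous_polyEval _)).aestronglyMeasurable

lemma integral_poly_mul_ouGen (p u : MvPolynomial κ ℝ) :
    ∫ x, eval x p * eval x (ouGen u) ∂stdGauss κ =
      ∫ x, ∑ i, eval x (pderiv i p) * eval x (pderiv i u) ∂stdGauss κ := by
  rw [integral_finsetSum]
  · simp_rw [← integral_poly_mul_ibp]
    rw [← integral_finsetSum]
    · simp_rw [ouGen, map_sum, Finset.mul_sum]
    · intro i _; simpa only [← map_mul] using integrable_poly _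
  · intro i _; simpa only [← map_mul] using integrable_poly _

lemma integral_ouGen (u : MvPolynomial κ ℝ) : ∫ x, eval x (ouGen u) ∂stdGauss κ = 0 := by
  simpa using integral_poly_mul_ouGen 1 u

lemma pderiv_comm' (i j : κ) (u : MvPolynomial κ ℝ) :
    pderiv i (pderiv j u) = pderiv j (pderiv i u) := by
  classical
  have : ⁅(pderiv i : Derivation ℝ (MvPolynomial κ ℝ) (MvPolynomial κ ℝ)),
      (pderiv j : Derivation ℝ (MvPolynomial κ ℝ) (MvPolynomial κ ℝ))⁆ = 0 := by
    apply MvPolynomial.derivation_ext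
    intro k
    simp only [Derivation.commutator_apply, pderiv_X, Derivation.coe_zero, Pi.zero_apply]
    by_cases h1 : j = k <;> by_cases h2 : i = k <;> simp [Pi.single_apply, h1, h2, eq_comm]
  have h2 := congrArg (fun D => D u) this
  simp only [Derivation.commutator_apply, Derivation.coe_zero, Pi.zero_apply] at h2
  exact sub_eq_zero.1 h2

lemma pderiv_ouGen (i : κ) (u : MvPolynomial κ ℝ) :
    pderiv i (ouGen u) = ouGen (pderiv i u) + pderiv i u := by
  classical
  have : ∀ j, pderiv i (X j * pderiv j u - pderiv j (pderiv j u)) =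
      (X j * pderiv j (pderiv i u) - pderiv j (pderiv j (pderiv i u))) +
        (if i = j then pderiv j u else 0) := by
    intro j
    rw [map_sub, Derivation.leibniz, pderiv_comm' i j (pderiv j u), pderiv_comm' i j u, pderiv_X]
    by_cases h : i = j
    · subst h; simp; ring
    · simp [h, Pi.single_apply, eq_comm]
  simp_rw [ouGen, map_sum, this]
  rw [Finset.sum_add_distrib]
  simp

/-- Bochner's identity for the Gaussian measure. -/
lemma integral_ouGen_sq (u : MvPolynomial κ ℝ) :
    ∫ x, eval x (ouGen u) ^ 2 ∂stdGauss κ =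
      (∫ x, ∑ i, polyGrad u x i ^ 2 ∂stdGauss κ) +
        ∫ x, ∑ i, ∑ j, eval x (pderiv j (pderiv i u)) ^ 2 ∂stdGauss κ := by
  have h_int : ∀ p : MvPolynomial κ ℝ, Integrable (fun x => eval x p ^ 2) (stdGauss κ) :=
    fun p => by simpa only [← map_pow] using integrable_poly (p ^ 2)
  have hint2 : ∀ p q : MvPolynomial κ ℝ, Integrable (fun x => eval x p * eval x q) (stdGauss κ) :=
    fun p q => by simpa only [← map_mul] using integrable_poly (p * q)
  simp_rw [sq (eval _ (ouGen u))]
  rw [integral_poly_mul_ouGen]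
  simp_rw [pderiv_ouGen, map_add, add_mul, Finset.sum_add_distrib]
  rw [integral_add, add_comm]
  · congr 1
    · simp [polyGrad, sq]
    · rw [integral_finsetSum, integral_finsetSum]
      · refine Finset.sum_congr rfl fun i _ => ?_
        simp_rw [mul_comm (eval _ (ouGen _))]
        rw [integral_poly_mul_ouGen]
        simp [sq]
      · intro i _; exact integrable_finsetSum _ fun j _ => h_int _
      · intro i _; exact hint2 _ _
  · exact integrable_finsetSum _ fun i _ => hint2 _ _
  · exact integrable_finsetSum _ fun i _ => hint2 _ _

end

section
open MvPolynomial
variable {κ : Type*} [Fintype κ]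

lemma memLp_poly (p : MvPolynomial κ ℝ) : MemLp (fun x => eval x p) 2 (stdGauss κ) := by
  rw [memLp_two_iff_integrable_sq (continuous_polyEval p).aestronglyMeasurable]
  simpa only [← map_pow] using integrable_poly (p ^ 2)

lemma integral_mul_cexp_eq_zero {h : (κ → ℝ) → ℝ} (hh : MemLp h 2 (stdGauss κ))
    (horth : ∀ p : MvPolynomial κ ℝ, ∫ x, h x * eval x p ∂stdGauss κ = 0) (t : κ → ℝ) :
    ∫ x, (h x : ℂ) * Complex.exp ((∑ i, t i * x i : ℝ) * Complex.I) ∂stdGauss κ = 0 := by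
  set L : MvPolynomial κ ℝ := ∑ i, C (t i) * X i with hL
  have hLe : ∀ x, eval x L = ∑ i, t i * x i := by intro x; simp [hL]
  simp_rw [← hLe]
  have hmc : Continuous fun x : κ → ℝ => eval x L := continuous_polyEval L
  have hs := hasSum_integral_of_dominated_convergence (μ := stdGauss κ)
    (F := fun (n : ℕ) x => (h x : ℂ) * (((eval x L : ℝ) * Complex.I) ^ n / (n.factorial : ℂ)))
    (f := fun x => (h x : ℂ) * Complex.exp ((eval x L : ℝ) * Complex.I))
    (fun n x => |h x| * (|eval x L| ^ n / n.factorial)) ?_ ?_ ?_ ?_ ?_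
  · have h0 : ∀ n : ℕ, ∫ x, (h x : ℂ) * (((eval x L : ℝ) * Complex.I) ^ n / (n.factorial : ℂ))
        ∂stdGauss κ = 0 := by
      intro n
      have : ∀ x, (h x : ℂ) * (((eval x L : ℝ) * Complex.I) ^ n / (n.factorial : ℂ)) =
          (Complex.I ^ n / (n.factorial : ℂ)) * ((h x * eval x (L ^ n) : ℝ) : ℂ) := by
        intro x; push_cast [map_pow]; ring
      simp_rw [this]
      rw [integral_const_mul, integral_complex_ofReal, horth]
      simp
    simp_rw [h0] at hs
    exact hs.unique hasSum_zero
  · intro n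
    refine AEStronglyMeasurable.mul ?_ ?_
    · exact Complex.continuous_ofReal.comp_aestronglyMeasurable hh.aestronglyMeasurable
    · exact Continuous.aestronglyMeasurable (by fun_prop)
  · intro n
    refine Filter.Eventually.of_forall fun x => ?_
    simp
  · refine Filter.Eventually.of_forall fun x => ?_
    exact (Real.summable_pow_div_factorial _).mul_left _
  · have : ∀ x, ∑' n : ℕ, |h x| * (|eval x L| ^ n / n.factorial) = |h x| * Real.exp |eval x L| := by
      intro x
      rw [tsum_mul_left, Real.exp_eq_exp_ℝ, NormedSpace.exp_eq_tsum_div]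
    simp_rw [this]
    have hexp : MemLp (fun x => Real.exp |eval x L|) 2 (stdGauss κ) := by
      rw [memLp_two_iff_integrable_sq (Continuous.aestronglyMeasurable (by fun_prop))]
      have hc : 0 ≤ ∑ i, |t i| := Finset.sum_nonneg fun _ _ => abs_nonneg _
      refine ((ExpBdd.exp_sum_abs (κ := κ) (c := ∑ i, |t i|) hc).pow 2).mono (f := fun x => Real.exp |eval x L| ^ 2)
        (fun x => ?_) |>.integrable (Continuous.aestronglyMeasurable (by fun_prop))
      rw [abs_pow, abs_pow, Real.abs_exp, Real.abs_exp]
      refine pow_le_pow_left₀ (Real.exp_pos _).le (Real.exp_le_exp.2 ?_) 2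
      rw [hLe, Finset.sum_mul]
      refine (Finset.abs_sum_le_sum_abs _ _).trans (Finset.sum_le_sum fun i _ => ?_)
      rw [abs_mul]
      exact mul_le_mul_of_nonneg_left (Finset.single_le_sum (f := fun i => |x i|)
        (fun _ _ => abs_nonneg _) (Finset.mem_univ i)) (abs_nonneg _)
    exact (hh.abs.integrable_mul hexp)
  · refine Filter.Eventually.of_forall fun x => ?_
    refine HasSum.mul_left _ ?_
    rw [Complex.exp_eq_exp_ℂ]
    exact NormedSpace.expSeries_div_hasSum_exp _

/-- A square-integrable function orthogonal to all polynomials vanishes. -/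
lemma ae_eq_zero_of_orthogonal_poly {h : (κ → ℝ) → ℝ} (hh : MemLp h 2 (stdGauss κ))
    (horth : ∀ p : MvPolynomial κ ℝ, ∫ x, h x * eval x p ∂stdGauss κ = 0) :
    h =ᵐ[stdGauss κ] 0 := by
  have h_int : Integrable h (stdGauss κ) := hh.integrable (by norm_num)
  have key : ∀ L : StrongDual ℝ (κ → ℝ),
      ∫ x, (h x : ℂ) * Complex.exp (L x * Complex.I) ∂stdGauss κ = 0 := by
    classical
    intro L
    have := integral_mul_cexp_eq_zero hh horth (fun i => L (Pi.single i 1))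
    have h2 : ∀ x, L x = ∑ i, L (Pi.single i 1) * x i := by
      intro x
      conv_lhs => rw [pi_eq_sum_univ' x]
      simp [mul_comm]
    refine (integral_congr_ae (Filter.Eventually.of_forall fun x => ?_)).trans this
    change _ * Complex.exp (((L x : ℝ) : ℂ) * Complex.I) = _
    rw [h2 x]
  set P : Measure (κ → ℝ) := (stdGauss κ).withDensity fun x => ENNReal.ofReal (h x) with hP
  set Q : Measure (κ → ℝ) := (stdGauss κ).withDensity fun x => ENNReal.ofReal (-h x) with hQ
  have hm1 : AEMeasurable (fun x => ENNReal.ofReal (h x)) (stdGauss κ) :=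
    h_int.aemeasurable.ennreal_ofReal
  have hm2 : AEMeasurable (fun x => ENNReal.ofReal (-h x)) (stdGauss κ) :=
    h_int.aemeasurable.neg.ennreal_ofReal
  have : IsFiniteMeasure P := isFiniteMeasure_withDensity_ofReal h_int.2
  have : IsFiniteMeasure Q := isFiniteMeasure_withDensity_ofReal h_int.neg.2
  have hPQ : P = Q := by
    refine Measure.ext_of_charFunDual ?_
    ext L
    rw [charFunDual_apply, charFunDual_apply, hP, hQ,
      integral_withDensity_eq_integral_toReal_smul₀ hm1 (by simp),
      integral_withDensity_eq_integral_toReal_smul₀ hm2 (by simp), ← sub_eq_zero, ← integral_sub,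
      ← key L]
    · refine integral_congr_ae (Filter.Eventually.of_forall fun x => ?_)
      simp only [ENNReal.toReal_ofReal', Complex.real_smul, ← sub_mul]
      congr 1
      rw [← Complex.ofReal_sub]
      congr 1
      rcases le_total 0 (h x) with h0 | h0
      · rw [max_eq_left h0, max_eq_right (by linarith)]; simp
      · rw [max_eq_right h0, max_eq_left (by linarith)]; simp
    all_goals
      refine Integrable.mono' h_int.abs ?_ (Filter.Eventually.of_forall fun x => ?_)
      · refine AEStronglyMeasurable.smul ?_ (Continuous.aestronglyMeasurable (by fun_prop))
        first
          | exact Complex.continuous_ofReal.comp_aestronglyMeasurable hm1.ennreal_toReal.aestronglyMeasurable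
          | exact Complex.continuous_ofReal.comp_aestronglyMeasurable hm2.ennreal_toReal.aestronglyMeasurable
      · rw [norm_smul, Complex.norm_exp_ofReal_mul_I, mul_one, ENNReal.toReal_ofReal',
          Real.norm_eq_abs, abs_of_nonneg (le_max_right _ _)]
        exact max_le (by first | exact le_abs_self _ | exact neg_le_abs _) (abs_nonneg _)
  rw [hP, hQ, withDensity_eq_iff hm1 hm2] at hPQ
  · filter_upwards [hPQ] with x hx
    simp only [Pi.zero_apply]
    rcases le_total 0 (h x) with h0 | h0
    · rw [ENNReal.ofReal_of_nonpos (p := -h x) (by linarith), ENNReal.ofReal_eq_zero] at hx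
      linarith
    · rw [ENNReal.ofReal_of_nonpos h0, eq_comm, ENNReal.ofReal_eq_zero] at hx
      linarith
  · exact (h_int.lintegral_lt_top).ne

/-- Polynomials are dense in `L²` of the Gaussian measure. -/
lemma exists_poly_integral_sub_sq_lt {φ : (κ → ℝ) → ℝ} (hφ : MemLp φ 2 (stdGauss κ)) {ε : ℝ}
    (hε : 0 < ε) : ∃ p : MvPolynomial κ ℝ, ∫ x, (φ x - eval x p) ^ 2 ∂stdGauss κ < ε := by
  let T : MvPolynomial κ ℝ →ₗ[ℝ] Lp ℝ 2 (stdGauss κ) :=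
    { toFun := fun p => (memLp_poly p).toLp _
      map_add' := fun p q => by
        rw [← MemLp.toLp_add]
        exact MemLp.toLp_congr _ _ (Filter.Eventually.of_forall fun x => by simp)
      map_smul' := fun c p => by
        rw [RingHom.id_apply, ← MemLp.toLp_const_smul]
        exact MemLp.toLp_congr _ _ (Filter.Eventually.of_forall fun x => by simp) }
  have hT : (LinearMap.range T).topologicalClosure = ⊤ := by
    rw [Submodule.topologicalClosure_eq_top_iff, Submodule.eq_bot_iff]
    intro g hg
    have h0 : (g : (κ → ℝ) → ℝ) =ᵐ[stdGauss κ] 0 := by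
      refine ae_eq_zero_of_orthogonal_poly (Lp.memLp g) fun p => ?_
      have h1 := Submodule.inner_right_of_mem_orthogonal (LinearMap.mem_range_self T p) hg
      rw [L2.inner_def] at h1
      rw [← h1]
      refine integral_congr_ae ?_
      filter_upwards [(memLp_poly p).coeFn_toLp] with x hx
      change _ = inner ℝ (((memLp_poly p).toLp _ : Lp ℝ 2 (stdGauss κ)) x) (g x)
      rw [hx]
      simp
    exact (Lp.eq_zero_iff_ae_eq_zero).2 h0
  have h1 : hφ.toLp φ ∈ closure (LinearMap.range T : Set (Lp ℝ 2 (stdGauss κ))) := by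
    rw [← Submodule.topologicalClosure_coe, hT]; trivial
  obtain ⟨_, ⟨p, rfl⟩, hp⟩ := Metric.mem_closure_iff.1 h1 (Real.sqrt ε) (Real.sqrt_pos.2 hε)
  refine ⟨p, ?_⟩
  rw [dist_eq_norm] at hp
  have h2 : ∫ x, (φ x - eval x p) ^ 2 ∂stdGauss κ = ‖hφ.toLp φ - T p‖ ^ 2 := by
    rw [← real_inner_self_eq_norm_sq, L2.inner_def]
    refine integral_congr_ae ?_
    have hTp : T p = (memLp_poly p).toLp _ := rfl
    rw [hTp, ← MemLp.toLp_sub]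
    filter_upwards [MemLp.coeFn_toLp (hφ.sub (memLp_poly p))] with x hx
    rw [hx]
    simp [sq]
  rw [h2]
  calc _ < Real.sqrt ε ^ 2 := by gcongr
    _ = ε := Real.sq_sqrt hε.le

end

section
open MvPolynomial
variable {κ κ' : Type*} [Fintype κ] [Fintype κ']

lemma charFunDual_stdGauss [DecidableEq κ] (L : StrongDual ℝ (κ → ℝ)) :
    charFunDual (stdGauss κ) L = Complex.exp (-(∑ i, L (Pi.single i 1) ^ 2 : ℝ) / 2) := by
  have h := charFun_pi (μ := fun _ : κ => gaussianReal 0 1)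
    (WithLp.toLp 2 fun i => L (Pi.single i 1))
  have h2 : charFunDual (stdGauss κ) L =
      charFun ((Measure.pi fun _ : κ => gaussianReal 0 1).map (WithLp.toLp 2))
        (WithLp.toLp 2 fun i => L (Pi.single i 1)) := by
    rw [charFun_apply, charFunDual_apply, integral_map (by fun_prop) (by fun_prop)]
    refine integral_congr_ae (Filter.Eventually.of_forall fun x => ?_)
    simp only
    congr 2
    rw [EuclideanSpace.inner_eq_star_dotProduct]
    conv_lhs => rw [pi_eq_sum_univ' x]
    simp [dotProduct, mul_comm]
  rw [h2, h]
  simp_rw [charFun_gaussianReal]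
  rw [← Complex.exp_sum]
  congr 1
  simp [Finset.sum_div, neg_div]

/-- Linear maps with orthonormal rows preserve the standard Gaussian measure. -/
lemma stdGauss_map_linear [DecidableEq κ] [DecidableEq κ'] (T : (κ → ℝ) →ₗ[ℝ] (κ' → ℝ))
    (hT : ∀ t : κ' → ℝ, ∑ i, (∑ j, t j * T (Pi.single i 1) j) ^ 2 = ∑ j, t j ^ 2) :
    (stdGauss κ).map T = stdGauss κ' := by
  have hc : Continuous T := T.continuous_of_finiteDimensional
  have : IsProbabilityMeasure ((stdGauss κ).map T) :=
    Measure.isProbabilityMeasure_map hc.aemeasurable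
  refine Measure.ext_of_charFunDual ?_
  ext L
  have : (stdGauss κ).map T = (stdGauss κ).map (LinearMap.toContinuousLinearMap T) := rfl
  rw [this, charFunDual_map, charFunDual_stdGauss, charFunDual_stdGauss]
  congr 4
  rw [← hT fun j => L (Pi.single j 1)]
  refine Finset.sum_congr rfl fun i _ => ?_
  congr 1
  simp only [ContinuousLinearMap.coe_comp, Function.comp_apply,
    LinearMap.coe_toContinuousLinearMap']
  rw [pi_eq_sum_univ' (T (Pi.single i 1))]
  simp [mul_comm, Finset.sum_apply, Pi.single_apply]

lemma stdGauss_map_mulVec [DecidableEq κ] (k : Matrix κ κ ℝ) (hk : k * k.transpose = 1) :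
    (stdGauss κ).map k.mulVec = stdGauss κ := by
  refine stdGauss_map_linear k.mulVecLin fun t => ?_
  have h1 : ∀ i, ∑ j, t j * k.mulVecLin (Pi.single i 1) j = k.transpose.mulVec t i := by
    intro i
    simp [Matrix.mulVec, dotProduct, Pi.single_apply, mul_comm]
  simp_rw [h1]
  have : ∀ v : κ → ℝ, ∑ i, v i ^ 2 = v ⬝ᵥ v := fun v => by simp [dotProduct, sq]
  rw [this, this, Matrix.dotProduct_mulVec, Matrix.vecMul_transpose, Matrix.mulVec_mulVec, hk,
    Matrix.one_mulVec]

lemma measurePreserving_mulVec [DecidableEq κ] (k : Matrix κ κ ℝ) (hk : k * k.transpose = 1) :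
    MeasurePreserving k.mulVec (stdGauss κ) (stdGauss κ) :=
  ⟨(k.mulVecLin.continuous_of_finiteDimensional).measurable, stdGauss_map_mulVec k hk⟩

lemma integral_comp_mulVec [DecidableEq κ] {k : Matrix κ κ ℝ} (hk : k * k.transpose = 1)
    {G : (κ → ℝ) → ℝ} (hG : AEStronglyMeasurable G (stdGauss κ)) :
    ∫ x, G (k.mulVec x) ∂stdGauss κ = ∫ x, G x ∂stdGauss κ := by
  have h := measurePreserving_mulVec k hk
  conv_rhs => rw [← h.map_eq]
  rw [integral_map h.measurable.aemeasurable (by rwa [h.map_eq])]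

/-- A linear change of variables in a polynomial. -/
def polyComp (k : Matrix κ κ ℝ) : MvPolynomial κ ℝ →ₐ[ℝ] MvPolynomial κ ℝ :=
  bind₁ fun i => ∑ j, C (k i j) * X j

lemma eval_polyComp (k : Matrix κ κ ℝ) (u : MvPolynomial κ ℝ) (x : κ → ℝ) :
    eval x (polyComp k u) = eval (k.mulVec x) u := by
  rw [polyComp, ← coe_aeval_eq_eval, ← coe_aeval_eq_eval]
  simp only [RingHom.coe_coe, aeval_bind₁]
  congr 2
  ext i
  simp [Matrix.mulVec, dotProduct]

lemma pderiv_polyComp (k : Matrix κ κ ℝ) (u : MvPolynomial κ ℝ) (j : κ) :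
    pderiv j (polyComp k u) = ∑ i, C (k i j) * polyComp k (pderiv i u) := by
  classical
  induction u using MvPolynomial.induction_on with
  | C a => simp [polyComp]
  | add p q hp hq => simp [hp, hq, mul_add, Finset.sum_add_distrib]
  | mul_X p l hp =>
    rw [map_mul, Derivation.leibniz, hp]
    simp only [Derivation.leibniz, map_add, smul_eq_mul, map_mul, mul_add, Finset.sum_add_distrib,
      pderiv_X]
    have h1 : polyComp k (X l) = ∑ j, C (k l j) * X j := by simp [polyComp]
    congr 1
    · rw [h1]
      simp [pderiv_X, Pi.single_apply, mul_ite, apply_ite (polyComp k), Derivation.leibniz,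
        mul_comm]
    · rw [Finset.mul_sum]
      exact Finset.sum_congr rfl fun i _ => by ring

lemma ouGen_polyComp [DecidableEq κ] (k : Matrix κ κ ℝ) (hk : k * k.transpose = 1)
    (u : MvPolynomial κ ℝ) : ouGen (polyComp k u) = polyComp k (ouGen u) := by
  have hk' : ∀ i l, ∑ j, k i j * k l j = if i = l then 1 else 0 := by
    intro i l
    have := congrFun (congrFun hk i) l
    simpa [Matrix.mul_apply, Matrix.one_apply] using this
  have hX : ∀ i, polyComp k (X i) = ∑ j, C (k i j) * X j := fun i => by simp [polyComp]
  simp only [ouGen, Finset.sum_sub_distrib, map_sub, map_sum, map_mul, hX]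
  congr 1
  · simp_rw [pderiv_polyComp, Finset.mul_sum, Finset.sum_mul]
    rw [Finset.sum_comm]
    refine Finset.sum_congr rfl fun i _ => Finset.sum_congr rfl fun j _ => by ring
  · simp_rw [pderiv_polyComp, map_sum, Derivation.leibniz, pderiv_C, smul_zero, add_zero,
      smul_eq_mul, pderiv_polyComp, Finset.mul_sum]
    rw [Finset.sum_comm]
    refine Finset.sum_congr rfl fun i _ => ?_
    rw [Finset.sum_comm]
    simp_rw [← mul_assoc, ← C_mul, ← Finset.sum_mul, ← map_sum, hk']
    simp

lemma totalDegree_polyComp_le (k : Matrix κ κ ℝ) (u : MvPolynomial κ ℝ) :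
    (polyComp k u).totalDegree ≤ u.totalDegree := by
  have : polyComp k u = ∑ s ∈ u.support, C (coeff s u) * ∏ i, (∑ j, C (k i j) * X j) ^ s i := by
    conv_lhs => rw [u.as_sum]
    rw [map_sum]
    refine Finset.sum_congr rfl fun s _ => ?_
    rw [polyComp, bind₁_monomial, Finset.prod_subset (Finset.subset_univ _)]
    intro i _ hi
    rw [Finsupp.notMem_support_iff] at hi
    simp [hi]
  rw [this]
  refine totalDegree_finsetSum_le fun s hs => ?_
  refine (totalDegree_mul _ _).trans ?_
  rw [totalDegree_C, zero_add]
  refine (totalDegree_finset_prod _ _).trans ?_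
  refine le_trans ?_ (le_totalDegree hs)
  rw [Finsupp.sum_fintype _ _ (by simp)]
  refine Finset.sum_le_sum fun i _ => ?_
  refine (totalDegree_pow _ _).trans ?_
  refine (Nat.mul_le_mul_left _ (totalDegree_finsetSum_le (d := 1) fun j _ => ?_)).trans
    (mul_one _).le
  refine (totalDegree_mul _ _).trans ?_
  simp

lemma totalDegree_ouGen_le (u : MvPolynomial κ ℝ) : (ouGen u).totalDegree ≤ u.totalDegree := by
  classical
  have hp : ∀ (i : κ) (v : MvPolynomial κ ℝ), (pderiv i v).totalDegree ≤ v.totalDegree := by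
    intro i v
    conv_lhs => rw [v.as_sum]
    rw [map_sum]
    refine totalDegree_finsetSum_le fun s hs => ?_
    rw [pderiv_monomial]
    refine (totalDegree_monomial_le _ _).trans (le_trans ?_ (le_totalDegree hs))
    rw [Finsupp.sum_fintype _ _ (by simp)]
    rw [Finsupp.sum_fintype _ _ (by simp)]
    exact Finset.sum_le_sum fun j _ => by simp
  refine totalDegree_finsetSum_le fun i _ => ?_
  refine (totalDegree_sub _ _).trans (max_le ?_ ((hp _ _).trans (hp _ _)))
  conv_lhs => rw [u.as_sum]
  rw [map_sum, Finset.mul_sum]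
  refine totalDegree_finsetSum_le fun s hs => ?_
  rw [X_mul_pderiv_monomial]
  refine (totalDegree_smul_le _ _).trans ?_
  exact (totalDegree_monomial_le _ _).trans (le_totalDegree hs)

lemma poly_eq_zero_of_integral_sq {r : MvPolynomial κ ℝ}
    (h : ∫ x, eval x r ^ 2 ∂stdGauss κ = 0) : r = 0 := by
  have h_int : Integrable (fun x => eval x r ^ 2) (stdGauss κ) := by
    simpa only [← map_pow] using integrable_poly (r ^ 2)
  rw [integral_eq_zero_iff_of_nonneg (fun x => sq_nonneg _) h_int] at h
  have h2 : (fun x : κ → ℝ => eval x r ^ 2) = 0 :=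
    Continuous.ae_eq_iff_eq (stdGauss κ) ((continuous_polyEval r).pow 2) continuous_zero |>.1 h
  refine MvPolynomial.funext fun x => ?_
  simpa using congrFun h2 x

/-- The Cauchy--Schwarz inequality for sums of products of square-integrable functions. -/
lemma integral_sum_mul_sq_le {Ω ι : Type*} [MeasurableSpace Ω] {μ : Measure Ω} {f g : ι → Ω → ℝ}
    (s : Finset ι) (hf : ∀ i ∈ s, MemLp (f i) 2 μ) (hg : ∀ i ∈ s, MemLp (g i) 2 μ) :
    (∫ x, ∑ i ∈ s, f i x * g i x ∂μ) ^ 2 ≤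
      (∫ x, ∑ i ∈ s, f i x ^ 2 ∂μ) * ∫ x, ∑ i ∈ s, g i x ^ 2 ∂μ := by
  have hff : Integrable (fun x => ∑ i ∈ s, f i x ^ 2) μ :=
    integrable_finsetSum _ fun i hi => (hf i hi).integrable_sq
  have hgg : Integrable (fun x => ∑ i ∈ s, g i x ^ 2) μ :=
    integrable_finsetSum _ fun i hi => (hg i hi).integrable_sq
  have hfg : Integrable (fun x => ∑ i ∈ s, f i x * g i x) μ :=
    integrable_finsetSum _ fun i hi => (hf i hi).integrable_mul (hg i hi)
  have key : ∀ t : ℝ, 0 ≤ (∫ x, ∑ i ∈ s, f i x ^ 2 ∂μ) * (t * t) +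
      (2 * ∫ x, ∑ i ∈ s, f i x * g i x ∂μ) * t + ∫ x, ∑ i ∈ s, g i x ^ 2 ∂μ := by
    intro t
    have : ∫ x, ∑ i ∈ s, (t * f i x + g i x) ^ 2 ∂μ = (∫ x, ∑ i ∈ s, f i x ^ 2 ∂μ) * (t * t) +
        (2 * ∫ x, ∑ i ∈ s, f i x * g i x ∂μ) * t + ∫ x, ∑ i ∈ s, g i x ^ 2 ∂μ := by
      have h : ∀ x, ∑ i ∈ s, (t * f i x + g i x) ^ 2 = (t * t) * ∑ i ∈ s, f i x ^ 2 +
          (2 * t) * ∑ i ∈ s, f i x * g i x + ∑ i ∈ s, g i x ^ 2 := fun x => by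
        rw [Finset.mul_sum, Finset.mul_sum, ← Finset.sum_add_distrib, ← Finset.sum_add_distrib]
        exact Finset.sum_congr rfl fun i _ => by ring
      simp_rw [h]
      rw [integral_add ((hff.const_mul _).fun_add (hfg.const_mul _)) hgg,
        integral_add (hff.const_mul _) (hfg.const_mul _), integral_const_mul, integral_const_mul]
      ring
    rw [← this]
    exact integral_nonneg fun x => Finset.sum_nonneg fun i _ => sq_nonneg _
  have := discrim_le_zero key
  rw [discrim] at this
  nlinarith

lemma integral_mul_sq_le {Ω : Type*} [MeasurableSpace Ω] {μ : Measure Ω} {f g : Ω → ℝ}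
    (hf : MemLp f 2 μ) (hg : MemLp g 2 μ) :
    (∫ x, f x * g x ∂μ) ^ 2 ≤ (∫ x, f x ^ 2 ∂μ) * ∫ x, g x ^ 2 ∂μ := by
  simpa using integral_sum_mul_sq_le (f := fun _ : Unit => f) (g := fun _ => g) Finset.univ
    (fun _ _ => hf) fun _ _ => hg

variable [DecidableEq κ]

/-- A duality criterion bounding the second moment of an invariant centred function. -/
theorem integral_sq_le_of_ouGen {φ : (κ → ℝ) → ℝ} (hφ : MemLp φ 2 (stdGauss κ))
    (hmean : ∫ x, φ x ∂stdGauss κ = 0) (K : Set (Matrix κ κ ℝ))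
    (hK : ∀ k ∈ K, k * k.transpose = 1) (hinv : ∀ k ∈ K, ∀ x, φ (k.mulVec x) = φ x)
    {A : ℝ} (hA : 0 ≤ A)
    (H : ∀ u : MvPolynomial κ ℝ, (∀ k ∈ K, polyComp k u = u) →
      (∫ x, φ x * eval x (ouGen u) ∂stdGauss κ) ^ 2 ≤
        A * ∫ x, eval x (ouGen u) ^ 2 ∂stdGauss κ) :
    ∫ x, φ x ^ 2 ∂stdGauss κ ≤ A := by
  refine le_of_forall_pos_le_add fun ε hε => ?_
  obtain ⟨p₀, hp₀⟩ := exists_poly_integral_sub_sq_lt hφ hε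
  set n := p₀.totalDegree
  have hi2 : ∀ p q : MvPolynomial κ ℝ, Integrable (fun x => eval x p * eval x q) (stdGauss κ) :=
    fun p q => (memLp_poly p).integrable_mul (memLp_poly q)
  have hiφ : ∀ p : MvPolynomial κ ℝ, Integrable (fun x => φ x * eval x p) (stdGauss κ) :=
    fun p => hφ.integrable_mul (memLp_poly p)
  let V := restrictTotalDegree κ ℝ n
  let B : V →ₗ[ℝ] Module.Dual ℝ V := LinearMap.mk₂ ℝ
    (fun p q => ∫ x, eval x (p : MvPolynomial κ ℝ) * eval x (q : MvPolynomial κ ℝ) ∂stdGauss κ)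
    (fun p p' q => by
      simp only [Submodule.coe_add, map_add, add_mul]
      exact integral_add (hi2 _ _) (hi2 _ _))
    (fun c p q => by
      simp only [Submodule.coe_smul, smul_eval, mul_assoc, integral_const_mul, smul_eq_mul])
    (fun p q q' => by
      simp only [Submodule.coe_add, map_add, mul_add]
      exact integral_add (hi2 _ _) (hi2 _ _))
    (fun c p q => by
      simp only [Submodule.coe_smul, smul_eval, mul_left_comm _ c, integral_const_mul,
        smul_eq_mul])
  have hBinj : Function.Injective B := by
    rw [← LinearMap.ker_eq_bot, LinearMap.ker_eq_bot']
    intro p hp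
    have := LinearMap.congr_fun hp p
    simp only [B, LinearMap.mk₂_apply, LinearMap.zero_apply, ← sq] at this
    exact Subtype.ext (poly_eq_zero_of_integral_sq this)
  have hBsurj : Function.Surjective B :=
    (LinearMap.injective_iff_surjective_of_finrank_eq_finrank
      (Subspace.dual_finrank_eq (K := ℝ) (V := V)).symm).1 hBinj
  obtain ⟨p, hp⟩ := hBsurj
    { toFun := fun q => ∫ x, φ x * eval x (q : MvPolynomial κ ℝ) ∂stdGauss κ
      map_add' := fun q q' => by
        simp only [Submodule.coe_add, map_add, mul_add]
        exact integral_add (hiφ _) (hiφ _)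
      map_smul' := fun c q => by
        simp only [Submodule.coe_smul, smul_eval, mul_left_comm _ c, integral_const_mul,
          smul_eq_mul, RingHom.id_apply] }
  have hpq : ∀ q : MvPolynomial κ ℝ, q.totalDegree ≤ n →
      ∫ x, eval x (p : MvPolynomial κ ℝ) * eval x q ∂stdGauss κ =
        ∫ x, φ x * eval x q ∂stdGauss κ := by
    intro q hq
    exact LinearMap.congr_fun hp ⟨q, (mem_restrictTotalDegree _ _ _).2 hq⟩
  obtain ⟨p, hpV⟩ := p
  simp only at hpq
  have hpn : p.totalDegree ≤ n := (mem_restrictTotalDegree _ _ _).1 hpV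
  have hpK : ∀ k ∈ K, polyComp k p = p := by
    intro k hk
    have hk1 := hK k hk
    have hk2 : k.transpose * k = 1 := mul_eq_one_comm.1 hk1
    have hkc := (totalDegree_polyComp_le k p).trans hpn
    have hcomp : ∀ q : MvPolynomial κ ℝ, q.totalDegree ≤ n →
        ∫ x, eval x (polyComp k p) * eval x q ∂stdGauss κ =
          ∫ x, φ x * eval x q ∂stdGauss κ := by
      intro q hq
      have e1 : ∀ x, q.eval x = eval (k.mulVec x) (polyComp k.transpose q) := by
        intro x
        rw [eval_polyComp, Matrix.mulVec_mulVec, hk2, Matrix.one_mulVec]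
      simp_rw [eval_polyComp]
      simp_rw [e1]
      rw [integral_comp_mulVec hk1 (G := fun y => eval y p * eval y (polyComp k.transpose q))
        (hi2 _ _).aestronglyMeasurable,
        hpq _ ((totalDegree_polyComp_le _ _).trans hq),
        ← integral_comp_mulVec hk1 (hiφ _).aestronglyMeasurable]
      simp_rw [hinv k hk]
    have h0 : p - polyComp k p = 0 := by
      refine poly_eq_zero_of_integral_sq ?_
      have hd : (p - polyComp k p).totalDegree ≤ n :=
        (totalDegree_sub _ _).trans (max_le hpn hkc)
      have e : ∀ x, eval x (p - polyComp k p) ^ 2 = eval x p * eval x (p - polyComp k p) -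
          eval x (polyComp k p) * eval x (p - polyComp k p) := by
        intro x; rw [map_sub]; ring
      simp_rw [e]
      rw [integral_sub (hi2 _ _) (hi2 _ _), hpq _ hd, hcomp _ hd, sub_self]
    exact (sub_eq_zero.1 h0).symm
  have hp0 : ∫ x, eval x p ∂stdGauss κ = 0 := by
    have := hpq 1 (by simp)
    simpa [hmean] using this
  -- solve `ouGen u = p` among invariant polynomials
  obtain ⟨u, huK, hu⟩ : ∃ u : MvPolynomial κ ℝ, (∀ k ∈ K, polyComp k u = u) ∧ ouGen u = p := by
    let W : Submodule ℝ (MvPolynomial κ ℝ) :=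
      { carrier := {u | u.totalDegree ≤ n ∧ ∀ k ∈ K, polyComp k u = u}
        add_mem' := fun {a b} ha hb => ⟨(totalDegree_add _ _).trans (max_le ha.1 hb.1),
          fun k hk => by rw [map_add, ha.2 k hk, hb.2 k hk]⟩
        zero_mem' := ⟨by simp, fun k _ => by simp⟩
        smul_mem' := fun c a ha => ⟨(totalDegree_smul_le _ _).trans ha.1,
          fun k hk => by rw [map_smul, ha.2 k hk]⟩ }
    have hWV : W ≤ V := fun u hu => (mem_restrictTotalDegree _ _ _).2 hu.1
    have : Module.Finite ℝ W := Submodule.finiteDimensional_of_le hWV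
    let T : W →ₗ[ℝ] W :=
      { toFun := fun u => ⟨ouGen u + C (∫ x, eval x (u : MvPolynomial κ ℝ) ∂stdGauss κ),
          (totalDegree_add _ _).trans (max_le ((totalDegree_ouGen_le _).trans u.2.1) (by simp)),
          fun k hk => by
            rw [map_add, ← ouGen_polyComp k (hK k hk), u.2.2 k hk]
            simp [polyComp]⟩
        map_add' := fun u v => by
          ext1
          simp only [Submodule.coe_add, map_add, ouGen]
          rw [integral_add (integrable_poly _) (integrable_poly _), map_add]
          simp only [mul_add, Finset.sum_sub_distrib, Finset.sum_add_distrib]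
          ring
        map_smul' := fun c u => by
          ext1
          simp only [Submodule.coe_smul, smul_eval, integral_const_mul, ouGen, RingHom.id_apply,
            Derivation.map_smul, map_mul, smul_add, Finset.smul_sum, smul_sub, mul_smul_comm,
            C_mul', smul_eq_mul] }
    have hTinj : Function.Injective T := by
      rw [← LinearMap.ker_eq_bot, LinearMap.ker_eq_bot']
      rintro ⟨u, hu⟩ hTu
      have h1 : ouGen u + C (∫ x, eval x u ∂stdGauss κ) = 0 := congrArg Subtype.val hTu
      have h2 : ∫ x, eval x u ∂stdGauss κ = 0 := by
        have h3 : ∀ x, eval x (ouGen u) + ∫ x, eval x u ∂stdGauss κ = 0 := by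
          intro x
          have := congrArg (eval x) h1
          simpa using this
        have h4 : ∫ x, (eval x (ouGen u) + ∫ x, eval x u ∂stdGauss κ) ∂stdGauss κ = 0 := by
          simp_rw [h3]; simp
        rw [integral_add (integrable_poly _) (integrable_const _), integral_ouGen] at h4
        simpa using h4
      have h3 : ouGen u = 0 := by simpa [h2] using h1
      have h4 := integral_poly_mul_ouGen u u
      rw [h3] at h4
      simp only [map_zero, mul_zero, integral_zero] at h4
      rw [integral_finsetSum _ fun i _ => hi2 _ _, eq_comm, Finset.sum_eq_zero_iff_of_nonneg
        fun i _ => integral_nonneg fun x => mul_self_nonneg _] at h4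
      have h5 : ∀ i, pderiv i u = 0 := fun i =>
        poly_eq_zero_of_integral_sq (by simpa only [sq] using h4 i (Finset.mem_univ i))
      have h6 : ∀ x, eval x u = eval 0 u := by
        intro x
        refine is_const_of_fderiv_eq_zero (𝕜 := ℝ) (f := fun y : κ → ℝ => eval y u)
          (fun y => (hasFDerivAt_polyEval u y).differentiableAt) (fun y => ?_) x 0
        ext e
        rw [fderiv_polyEval]
        simp [polyGrad, h5]
      have h7 : eval 0 u = 0 := by
        simp_rw [h6] at h2
        simpa using h2
      ext1
      exact MvPolynomial.funext fun x => by rw [h6 x, h7]; simp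
    obtain ⟨u, hu⟩ := LinearMap.injective_iff_surjective.1 hTinj ⟨p, hpn, hpK⟩
    have hu1 : ouGen (u : MvPolynomial κ ℝ) + C (∫ x, eval x (u : MvPolynomial κ ℝ) ∂stdGauss κ)
        = p := congrArg Subtype.val hu
    refine ⟨u, u.2.2, ?_⟩
    have h4 : ∫ x, eval x (u : MvPolynomial κ ℝ) ∂stdGauss κ = 0 := by
      have h5 := hp0
      rw [← hu1] at h5
      simp only [map_add, eval_C] at h5
      rw [integral_add (integrable_poly _) (integrable_const _), integral_ouGen] at h5
      simpa using h5
    simpa [h4] using hu1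
  have h1 := H u huK
  rw [hu, ← hpq p hpn] at h1
  have h2 : ∫ x, eval x p ^ 2 ∂stdGauss κ ≤ A := by
    simp_rw [← sq] at h1
    set a := ∫ x, eval x p ^ 2 ∂stdGauss κ
    have ha : 0 ≤ a := integral_nonneg fun x => sq_nonneg _
    rcases ha.eq_or_lt with h | h
    · rwa [← h]
    · nlinarith
  have h3 : ∫ x, φ x ^ 2 ∂stdGauss κ = ∫ x, eval x p ^ 2 ∂stdGauss κ +
      ∫ x, (φ x - eval x p) ^ 2 ∂stdGauss κ := by
    have e : ∀ x, (φ x - eval x p) ^ 2 = φ x ^ 2 - 2 * (φ x * eval x p) + eval x p * eval x p :=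
      fun x => by ring
    simp_rw [e]
    rw [integral_add (hφ.integrable_sq.sub' ((hiφ p).const_mul 2)) (hi2 p p),
      integral_sub hφ.integrable_sq ((hiφ p).const_mul 2), integral_const_mul, ← hpq p hpn]
    simp_rw [sq]
    ring
  have h4 : ∫ x, (φ x - eval x p) ^ 2 ∂stdGauss κ ≤ ∫ x, (φ x - eval x p₀) ^ 2 ∂stdGauss κ := by
    have e : ∀ x, (φ x - eval x p₀) ^ 2 = (φ x - eval x p) ^ 2 +
        2 * (φ x * eval x (p - p₀) - eval x p * eval x (p - p₀)) + eval x (p - p₀) ^ 2 :=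
      fun x => by rw [map_sub]; ring
    have hd : (p - p₀).totalDegree ≤ n := (totalDegree_sub _ _).trans (max_le hpn le_rfl)
    have hsq : Integrable (fun x => (φ x - eval x p) ^ 2) (stdGauss κ) :=
      (hφ.sub (memLp_poly p)).integrable_sq
    simp_rw [e]
    rw [integral_add (hsq.fun_add (((hiφ _).sub' (hi2 _ _)).const_mul 2)) (memLp_poly _).integrable_sq,
      integral_add hsq (((hiφ _).sub' (hi2 _ _)).const_mul 2), integral_const_mul,
      integral_sub (hiφ _) (hi2 _ _), hpq _ hd, sub_self, mul_zero, add_zero]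
    exact le_add_of_nonneg_right (integral_nonneg fun x => sq_nonneg _)
  linarith

/-- The Gaussian Poincaré inequality. -/
theorem gauss_poincare {φ : (κ → ℝ) → ℝ} {L : NNReal} (hφ : LipschitzWith L φ) :
    ∫ x, (φ x - ∫ y, φ y ∂stdGauss κ) ^ 2 ∂stdGauss κ ≤
      ∫ x, ∑ i, (fderiv ℝ φ x (Pi.single i 1)) ^ 2 ∂stdGauss κ := by
  set c := ∫ y, φ y ∂stdGauss κ
  set ψ : (κ → ℝ) → ℝ := fun x => φ x - c with hψ
  have hL : LipschitzWith L ψ := by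
    refine LipschitzWith.of_dist_le_mul fun x y => ?_
    rw [hψ, dist_sub_right]
    exact hφ.dist_le_mul x y
  have hfd : ∀ x, fderiv ℝ ψ x = fderiv ℝ φ x := fun x => fderiv_sub_const _
  have hmem : MemLp ψ 2 (stdGauss κ) := by
    rw [memLp_two_iff_integrable_sq hL.continuous.aestronglyMeasurable]
    exact ((ExpBdd.of_lipschitz hL).pow 2).integrable (by
      have := hL.continuous; exact Continuous.aestronglyMeasurable (by fun_prop))
  have hcoord : ∀ i : κ, MemLp (fun x => fderiv ℝ φ x (Pi.single i 1)) 2 (stdGauss κ) := by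
    intro i
    refine MemLp.of_bound (measurable_fderiv_apply_const ℝ φ _).aestronglyMeasurable
      (L * ‖(Pi.single i 1 : κ → ℝ)‖) (Filter.Eventually.of_forall fun x => ?_)
    exact abs_fderiv_le_of_lipschitz hφ _ _
  refine integral_sq_le_of_ouGen hmem ?_ ∅ (by simp) (by simp)
    (integral_nonneg fun x => Finset.sum_nonneg fun i _ => sq_nonneg _) fun u _ => ?_
  · rw [hψ, integral_sub ((ExpBdd.of_lipschitz hφ).integrable
      hφ.continuous.aestronglyMeasurable) (integrable_const _)]
    simp [c]
  · rw [integral_mul_ouGen hL]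
    simp_rw [hfd]
    have e : ∀ x, fderiv ℝ φ x (polyGrad u x) =
        ∑ i, fderiv ℝ φ x (Pi.single i 1) * polyGrad u x i := by
      intro x
      conv_lhs => rw [pi_eq_sum_univ' (polyGrad u x)]
      simp [mul_comm]
    simp_rw [e]
    have hg : ∀ i : κ, MemLp (fun x => polyGrad u x i) 2 (stdGauss κ) := fun i => memLp_poly _
    have h1 : ∫ x, ∑ i, polyGrad u x i ^ 2 ∂stdGauss κ ≤
        ∫ x, eval x (ouGen u) ^ 2 ∂stdGauss κ := by
      rw [integral_ouGen_sq]
      exact le_add_of_nonneg_right (integral_nonneg fun x =>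
        Finset.sum_nonneg fun i _ => Finset.sum_nonneg fun j _ => sq_nonneg _)
    refine le_trans ?_ (mul_le_mul_of_nonneg_left h1
      (integral_nonneg fun x => Finset.sum_nonneg fun i _ => sq_nonneg _))
    exact integral_sum_mul_sq_le Finset.univ (fun i _ => hcoord i) fun i _ => hg i
end

section
open Matrix
variable {N : ℕ}

/-- The Hermitian matrix with given real coordinates in an orthonormal basis. -/
def herm (x : Fin N × Fin N → ℝ) : Matrix (Fin N) (Fin N) ℂ :=
  Matrix.of fun i j =>
    if i = j then (x (i, i) : ℂ)
    else if i < j then ((x (i, j) : ℂ) + x (j, i) * Complex.I) / (Real.sqrt 2 : ℝ)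
    else ((x (j, i) : ℂ) - x (i, j) * Complex.I) / (Real.sqrt 2 : ℝ)

/-- The real coordinates of a Hermitian matrix. -/
def coordH (A : Matrix (Fin N) (Fin N) ℂ) : Fin N × Fin N → ℝ := fun p =>
  if p.1 = p.2 then (A p.1 p.1).re
  else if p.1 < p.2 then Real.sqrt 2 * (A p.1 p.2).re else Real.sqrt 2 * (A p.2 p.1).im

lemma herm_isHermitian (x : Fin N × Fin N → ℝ) : (herm x).IsHermitian := by
  ext i j
  simp only [conjTranspose_apply, herm, of_apply]
  rcases lt_trichotomy i j with h | h | h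
  · simp [h.ne, h.ne', h, h.not_gt, sub_eq_add_neg]
  · subst h; simp
  · simp [h.ne, h.ne', h, h.not_gt, sub_eq_add_neg]

lemma herm_add (x y : Fin N × Fin N → ℝ) : herm (x + y) = herm x + herm y := by
  ext i j
  simp only [herm, of_apply, Matrix.add_apply, Pi.add_apply]
  split_ifs <;> push_cast <;> ring

lemma herm_smul (c : ℝ) (x : Fin N × Fin N → ℝ) : herm (c • x) = (c : ℂ) • herm x := by
  ext i j
  simp only [herm, of_apply, Matrix.smul_apply, Pi.smul_apply, smul_eq_mul]
  split_ifs <;> push_cast <;> ring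

lemma coordH_add (A B : Matrix (Fin N) (Fin N) ℂ) : coordH (A + B) = coordH A + coordH B := by
  ext p
  simp only [coordH, Matrix.add_apply, Pi.add_apply, Complex.add_re, Complex.add_im]
  split_ifs <;> ring

lemma coordH_smul (c : ℝ) (A : Matrix (Fin N) (Fin N) ℂ) :
    coordH ((c : ℂ) • A) = c • coordH A := by
  ext p
  simp only [coordH, Matrix.smul_apply, Pi.smul_apply, smul_eq_mul, Complex.re_ofReal_mul,
    Complex.im_ofReal_mul]
  split_ifs <;> ring

lemma sqrt_two_ne : (Real.sqrt 2 : ℝ) ≠ 0 := by positivity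

lemma coordH_herm (x : Fin N × Fin N → ℝ) : coordH (herm x) = x := by
  have h2 : (Real.sqrt 2 : ℝ) ≠ 0 := sqrt_two_ne
  ext ⟨i, j⟩
  rcases lt_trichotomy i j with h | h | h
  · simp only [coordH, herm, of_apply, h.ne, if_false, h, if_true, Complex.div_ofReal_re]
    simp; field_simp
  · subst h; simp [coordH, herm]
  · simp only [coordH, herm, of_apply, h.ne', h.ne, h.not_gt, if_false, h, if_true,
      Complex.div_ofReal_im]
    simp; field_simp

lemma herm_coordH {A : Matrix (Fin N) (Fin N) ℂ} (hA : A.IsHermitian) : herm (coordH A) = A := by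
  have h2 : (Real.sqrt 2 : ℝ) ≠ 0 := sqrt_two_ne
  have hd : ∀ i j, star (A j i) = A i j := fun i j => hA.apply i j
  ext i j
  rcases lt_trichotomy i j with h | h | h
  · simp only [coordH, herm, of_apply, h.ne, h.ne', h.not_gt, if_false, h, if_true]
    apply Complex.ext
    · rw [Complex.div_ofReal_re]; simp [h2]
    · rw [Complex.div_ofReal_im]; simp [h2]
  · subst h
    have := hd i i
    rw [Complex.star_def, Complex.conj_eq_iff_re] at this
    simpa [coordH, herm] using this
  · simp only [coordH, herm, of_apply, h.ne, h.ne', h.not_gt, if_false, h, if_true]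
    rw [← hd i j]
    apply Complex.ext
    · rw [Complex.div_ofReal_re]; simp [h2]
    · rw [Complex.div_ofReal_im]; simp; field_simp

/-- Real coordinates are orthonormal for the trace inner product. -/
lemma sum_mul_coordH (x : Fin N × Fin N → ℝ) {B : Matrix (Fin N) (Fin N) ℂ}
    (hB : B.IsHermitian) : ∑ p, x p * coordH B p = (herm x * B).trace.re := by
  obtain ⟨y, rfl⟩ : ∃ y, B = herm y := ⟨_, (herm_coordH hB).symm⟩
  rw [coordH_herm]
  have h1 : (herm x * herm y).trace.re = ∑ p : Fin N × Fin N, (herm x p.1 p.2 * herm y p.2 p.1).re := by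
    simp [Matrix.trace, Matrix.mul_apply, Fintype.sum_prod_type]
  rw [h1]
  have hs : ∀ f : Fin N × Fin N → ℝ, ∑ p, f p = (∑ p, (f p + f p.swap)) / 2 := by
    intro f
    rw [Finset.sum_add_distrib]
    have : ∑ p : Fin N × Fin N, f p.swap = ∑ p, f p := (Equiv.prodComm (Fin N) (Fin N)).sum_comp f
    rw [this]; ring
  rw [hs, hs (fun p => (herm x p.1 p.2 * herm y p.2 p.1).re)]
  congr 1
  refine Finset.sum_congr rfl fun p _ => ?_
  obtain ⟨i, j⟩ := p
  have h3 : Real.sqrt 2 ^ 2 = 2 := Real.sq_sqrt (by norm_num)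
  have key : ∀ i j : Fin N, i < j → x (i, j) * y (i, j) + x (j, i) * y (j, i) =
      (herm x i j * herm y j i).re + (herm x j i * herm y i j).re := by
    intro i j h
    simp only [herm, of_apply, h.ne, h.ne', h.not_gt, if_false, h, if_true, div_eq_mul_inv,
      ← Complex.ofReal_inv]
    simp [Complex.mul_re, Complex.mul_im]
    linear_combination (-(x (i, j) * y (i, j) + x (j, i) * y (j, i)) / 2) * h3
  simp only [Prod.swap_prod_mk]
  rcases lt_trichotomy i j with h | h | h
  · exact key i j h
  · subst h; simp [herm]
  · rw [add_comm, key j i h, add_comm]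

/-- The coordinates of the rank one matrix `w wᴴ`. -/
def rk (w : Fin N → ℂ) : Fin N × Fin N → ℝ := coordH (vecMulVec w (star w))

lemma isHermitian_vecMulVec (w : Fin N → ℂ) : (vecMulVec w (star w)).IsHermitian := by
  ext i j; simp [vecMulVec_apply, mul_comm]

/-- The quadratic form of a Hermitian matrix. -/
def qf (x : Fin N × Fin N → ℝ) (w : Fin N → ℂ) : ℝ := (star w ⬝ᵥ herm x *ᵥ w).re

lemma qf_eq_sum (x : Fin N × Fin N → ℝ) (w : Fin N → ℂ) : qf x w = ∑ p, x p * rk w p := by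
  rw [rk, sum_mul_coordH x (isHermitian_vecMulVec w), qf, Matrix.mul_vecMulVec,
    Matrix.trace_vecMulVec, dotProduct_comm]

lemma qf_add (x y : Fin N × Fin N → ℝ) (w : Fin N → ℂ) : qf (x + y) w = qf x w + qf y w := by
  simp [qf_eq_sum, add_mul, Finset.sum_add_distrib]

lemma qf_smul (c : ℝ) (x : Fin N × Fin N → ℝ) (w : Fin N → ℂ) : qf (c • x) w = c * qf x w := by
  simp [qf_eq_sum, Finset.mul_sum, mul_assoc]

lemma qf_rk (v w : Fin N → ℂ) : qf (rk v) w = Complex.normSq (star v ⬝ᵥ w) := by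
  rw [qf, rk, herm_coordH (isHermitian_vecMulVec v), Matrix.vecMulVec_mulVec]
  have h : star w ⬝ᵥ v = star (star v ⬝ᵥ w) := by
    rw [Matrix.star_dotProduct]
  rw [dotProduct_smul, h, op_smul_eq_mul]
  simp [Complex.normSq_apply]

end

section
open Matrix
variable {N : ℕ}

/-- Conjugation by `U` in real coordinates. -/
def unitConj (U : Matrix (Fin N) (Fin N) ℂ) : Matrix (Fin N × Fin N) (Fin N × Fin N) ℝ :=
  LinearMap.toMatrix'
    { toFun := fun x => coordH (U * herm x * Uᴴ)
      map_add' := fun x y => by rw [herm_add, mul_add, add_mul, coordH_add]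
      map_smul' := fun c x => by
        rw [herm_smul, Matrix.mul_smul, Matrix.smul_mul, coordH_smul, RingHom.id_apply] }

lemma unitConj_mulVec (U : Matrix (Fin N) (Fin N) ℂ) (x : Fin N × Fin N → ℝ) :
    (unitConj U).mulVec x = coordH (U * herm x * Uᴴ) := by
  rw [unitConj, LinearMap.toMatrix'_mulVec]; rfl

lemma herm_unitConj (U : Matrix (Fin N) (Fin N) ℂ) (x : Fin N × Fin N → ℝ) :
    herm ((unitConj U).mulVec x) = U * herm x * Uᴴ := by
  rw [unitConj_mulVec, herm_coordH]
  exact isHermitian_mul_mul_conjTranspose U (herm_isHermitian x)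

lemma sum_mul_eq_trace (x y : Fin N × Fin N → ℝ) : ∑ p, x p * y p = (herm x * herm y).trace.re := by
  rw [← sum_mul_coordH x (herm_isHermitian y), coordH_herm]

lemma unitConj_orth {U : Matrix (Fin N) (Fin N) ℂ} (hU : Uᴴ * U = 1) :
    unitConj U * (unitConj U).transpose = 1 := by
  rw [mul_eq_one_comm]
  refine Matrix.ext_of_mulVec_single fun j => ?_
  refine dotProduct_eq _ _ fun y => ?_
  rw [← Matrix.mulVec_mulVec, dotProduct_comm, Matrix.dotProduct_mulVec, Matrix.vecMul_transpose,
    Matrix.one_mulVec]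
  simp only [dotProduct]
  rw [sum_mul_eq_trace, sum_mul_eq_trace, herm_unitConj, herm_unitConj]
  have : U * herm y * Uᴴ * (U * herm (Pi.single j 1) * Uᴴ) =
      U * (herm y * herm (Pi.single j 1)) * Uᴴ := by
    calc _ = U * herm y * (Uᴴ * U) * herm (Pi.single j 1) * Uᴴ := by simp only [Matrix.mul_assoc]
      _ = _ := by rw [hU]; simp only [Matrix.mul_assoc, Matrix.one_mul]
  rw [this, Matrix.trace_mul_comm, ← Matrix.mul_assoc, hU, Matrix.one_mul, Matrix.trace_mul_comm]

/-- The set of unitary conjugations. -/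
def unitSet (N : ℕ) : Set (Matrix (Fin N × Fin N) (Fin N × Fin N) ℝ) :=
  {k | ∃ U : Matrix (Fin N) (Fin N) ℂ, Uᴴ * U = 1 ∧ k = unitConj U}

/-- The squared Euclidean norm of a complex vector. -/
def nsq (w : Fin N → ℂ) : ℝ := ∑ a, Complex.normSq (w a)

lemma nsq_eq (w : Fin N → ℂ) : star w ⬝ᵥ w = (nsq w : ℂ) := by
  simp [nsq, dotProduct, Complex.normSq_eq_conj_mul_self]

lemma nsq_nonneg (w : Fin N → ℂ) : 0 ≤ nsq w := Finset.sum_nonneg fun _ _ => Complex.normSq_nonneg _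

lemma nsq_pos {w : Fin N → ℂ} (hw : w ≠ 0) : 0 < nsq w := by
  obtain ⟨a, ha⟩ := Function.ne_iff.1 hw
  exact Finset.sum_pos' (fun _ _ => Complex.normSq_nonneg _)
    ⟨a, Finset.mem_univ _, Complex.normSq_pos.2 ha⟩

lemma nsq_mulVec {U : Matrix (Fin N) (Fin N) ℂ} (hU : Uᴴ * U = 1) (w : Fin N → ℂ) :
    nsq (U *ᵥ w) = nsq w := by
  have : ((nsq (U *ᵥ w) : ℝ) : ℂ) = nsq w := by
    rw [← nsq_eq, ← nsq_eq, Matrix.star_mulVec, Matrix.dotProduct_mulVec, Matrix.vecMul_vecMul, hU,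
      Matrix.vecMul_one]
  exact_mod_cast this

lemma sum_rk_sq (w : Fin N → ℂ) : ∑ p, rk w p ^ 2 = nsq w ^ 2 := by
  have h := qf_rk w w
  rw [nsq_eq, qf_eq_sum] at h
  simp_rw [sq, h]
  simp

lemma abs_qf_le (x : Fin N × Fin N → ℝ) (w : Fin N → ℂ) : |qf x w| ≤ (∑ p, |x p|) * nsq w := by
  rw [qf_eq_sum, Finset.sum_mul]
  refine (Finset.abs_sum_le_sum_abs _ _).trans (Finset.sum_le_sum fun p _ => ?_)
  rw [abs_mul]
  refine mul_le_mul_of_nonneg_left ?_ (abs_nonneg _)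
  refine abs_le_of_sq_le_sq ?_ (nsq_nonneg w)
  rw [← sum_rk_sq]
  exact Finset.single_le_sum (f := fun p => rk w p ^ 2) (fun _ _ => sq_nonneg _) (Finset.mem_univ p)

/-- A sorted orthonormal eigensystem of a matrix. -/
structure IsEigSys (A : Matrix (Fin N) (Fin N) ℂ) (l : Fin N → ℝ)
    (U : Matrix (Fin N) (Fin N) ℂ) : Prop where
  unit : Uᴴ * U = 1
  anti : Antitone l
  mul_eq : A * U = U * diagonal fun j => (l j : ℂ)

lemma exists_isEigSys {A : Matrix (Fin N) (Fin N) ℂ} (hA : A.IsHermitian) :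
    ∃ U, IsEigSys A (eigsDesc A) U := by
  set s : Fin N ≃ Fin N := Fin.revPerm.trans (Tuple.sort hA.eigenvalues) with hs
  have hl : eigsDesc A = fun i => hA.eigenvalues (s i) := by
    rw [eigsDesc, dif_pos hA]; rfl
  set V : Matrix (Fin N) (Fin N) ℂ := (hA.eigenvectorUnitary : Matrix (Fin N) (Fin N) ℂ)
  have hV : Vᴴ * V = 1 := Unitary.coe_star_mul_self hA.eigenvectorUnitary
  refine ⟨V.submatrix id s, ?_, ?_, ?_⟩
  · rw [conjTranspose_submatrix]
    rw [Matrix.submatrix_mul_equiv Vᴴ V s (Equiv.refl _) s |> fun h => (by simpa using h :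
      Vᴴ.submatrix s id * V.submatrix id s = (Vᴴ * V).submatrix s s), hV]
    exact Matrix.submatrix_one_equiv s
  · rw [hl]
    intro i j hij
    exact (Tuple.monotone_sort hA.eigenvalues) (Fin.rev_le_rev.2 hij)
  · have hAV : A * V = V * diagonal fun j => (hA.eigenvalues j : ℂ) := by
      ext i j
      have h : (A * V) i j = hA.eigenvalues j • V i j :=
        congrFun (hA.mulVec_eigenvectorBasis j) i
      rw [Matrix.mul_diagonal, h, mul_comm (V i j), Complex.real_smul]
    ext i j
    have h := congrFun (congrFun hAV i) (s j)
    rw [Matrix.mul_diagonal] at h ⊢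
    rw [hl]
    simpa [Matrix.mul_apply] using h

namespace IsEigSys
variable {A : Matrix (Fin N) (Fin N) ℂ} {l : Fin N → ℝ} {U : Matrix (Fin N) (Fin N) ℂ}

lemma unit' (h : IsEigSys A l U) : U * Uᴴ = 1 := mul_eq_one_comm.1 h.unit

lemma eq_mul (h : IsEigSys A l U) : A = U * (diagonal fun j => (l j : ℂ)) * Uᴴ := by
  rw [← h.mul_eq, Matrix.mul_assoc, h.unit', Matrix.mul_one]

lemma nsq_eq_sum (h : IsEigSys A l U) (w : Fin N → ℂ) :
    ∑ j, Complex.normSq (star (U.col j) ⬝ᵥ w) = nsq w := by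
  rw [← nsq_mulVec (U := Uᴴ) (by rw [conjTranspose_conjTranspose, h.unit']) w]
  rfl

lemma qf_eq {x : Fin N × Fin N → ℝ} (h : IsEigSys (herm x) l U) (w : Fin N → ℂ) :
    qf x w = ∑ j, l j * Complex.normSq (star (U.col j) ⬝ᵥ w) := by
  rw [qf, h.eq_mul, ← Matrix.mulVec_mulVec, ← Matrix.mulVec_mulVec,
    Matrix.dotProduct_mulVec]
  have h1 : star w ᵥ* U = star (Uᴴ *ᵥ w) := by
    rw [Matrix.star_mulVec, conjTranspose_conjTranspose]
  have h2 : ∀ j, (Uᴴ *ᵥ w) j = star (U.col j) ⬝ᵥ w := fun j => rfl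
  rw [h1]
  simp only [dotProduct, Matrix.mulVec_diagonal, Pi.star_apply, h2]
  simp only [Complex.re_sum]
  refine Finset.sum_congr rfl fun j _ => ?_
  rw [mul_left_comm, Complex.star_def, ← Complex.normSq_eq_conj_mul_self, ← Complex.ofReal_mul,
    Complex.ofReal_re]

lemma orth (h : IsEigSys A l U) (i j : Fin N) :
    star (U.col i) ⬝ᵥ U.col j = if i = j then 1 else 0 := by
  have := congrFun (congrFun h.unit i) j
  rwa [Matrix.one_apply] at this

lemma nsq_col (h : IsEigSys A l U) (j : Fin N) : nsq (U.col j) = 1 := by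
  have := nsq_eq (U.col j)
  rw [h.orth, if_pos rfl] at this
  exact_mod_cast this.symm

lemma qf_col {x : Fin N × Fin N → ℝ} (h : IsEigSys (herm x) l U) (j : Fin N) :
    qf x (U.col j) = l j := by
  rw [h.qf_eq, Finset.sum_eq_single j]
  · simp [h.orth]
  · intro i _ hij; simp [h.orth, hij]
  · simp

lemma le_qf {x : Fin N × Fin N → ℝ} (h : IsEigSys (herm x) l U) {w : Fin N → ℂ} {j : Fin N}
    (hw : ∀ i, j < i → star (U.col i) ⬝ᵥ w = 0) : l j * nsq w ≤ qf x w := by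
  rw [h.qf_eq, ← h.nsq_eq_sum, Finset.mul_sum]
  refine Finset.sum_le_sum fun i _ => ?_
  rcases lt_or_ge j i with hi | hi
  · simp [hw i hi]
  · exact mul_le_mul_of_nonneg_right (h.anti hi) (Complex.normSq_nonneg _)

lemma qf_le {x : Fin N × Fin N → ℝ} (h : IsEigSys (herm x) l U) {w : Fin N → ℂ} {j : Fin N}
    (hw : ∀ i, i < j → star (U.col i) ⬝ᵥ w = 0) : qf x w ≤ l j * nsq w := by
  rw [h.qf_eq, ← h.nsq_eq_sum, Finset.mul_sum]
  refine Finset.sum_le_sum fun i _ => ?_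
  rcases lt_or_ge i j with hi | hi
  · simp [hw i hi]
  · exact mul_le_mul_of_nonneg_right (h.anti hi) (Complex.normSq_nonneg _)

end IsEigSys

lemma sum_normSq_row {W : Matrix (Fin N) (Fin N) ℂ} (hW : W * Wᴴ = 1) (i : Fin N) :
    ∑ j, Complex.normSq (W i j) = 1 := by
  have := congrFun (congrFun hW i) i
  rw [Matrix.mul_apply, Matrix.one_apply_eq] at this
  simp only [conjTranspose_apply, Complex.star_def, Complex.mul_conj] at this
  exact_mod_cast this

/-- Ky Fan's maximum principle. -/
lemma IsEigSys.sum_qf_le {x : Fin N × Fin N → ℝ} {l : Fin N → ℝ} {U V : Matrix (Fin N) (Fin N) ℂ}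
    (h : IsEigSys (herm x) l U) (hV : Vᴴ * V = 1) (k : ℕ) :
    ∑ j with j.val < k, qf x (V.col j) ≤ ∑ j with j.val < k, l j := by
  have hV' : V * Vᴴ = 1 := mul_eq_one_comm.1 hV
  set W := Uᴴ * V with hW
  have hWW : W * Wᴴ = 1 := by
    rw [hW, conjTranspose_mul, conjTranspose_conjTranspose, Matrix.mul_assoc, ← Matrix.mul_assoc V,
      hV', Matrix.one_mul, h.unit]
  have hWW' : Wᴴ * W = 1 := mul_eq_one_comm.1 hWW
  have e : ∀ i j, star (U.col i) ⬝ᵥ V.col j = W i j := fun i j => rfl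
  simp_rw [h.qf_eq, e]
  rcases Nat.eq_zero_or_pos k with hk | hk
  · subst hk; simp
  rcases Nat.eq_zero_or_pos N with hN | hN
  · subst hN; simp
  set c : Fin N := ⟨min k N - 1, by omega⟩ with hc
  have hcol : ∀ j, ∑ i, Complex.normSq (W i j) = 1 := by
    intro j
    have := sum_normSq_row (W := Wᴴ) (by rw [conjTranspose_conjTranspose, hWW']) j
    simpa [conjTranspose_apply, Complex.normSq_conj] using this
  rw [Finset.sum_comm]
  have h1 : ∀ i, ∑ j with j.val < k, l i * Complex.normSq (W i j) ≤
      (if i.val < k then l i - l c else 0) + l c * ∑ j with j.val < k, Complex.normSq (W i j) := by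
    intro i
    rw [← Finset.mul_sum]
    set s := ∑ j with j.val < k, Complex.normSq (W i j)
    have hs0 : 0 ≤ s := Finset.sum_nonneg fun _ _ => Complex.normSq_nonneg _
    have hs1 : s ≤ 1 := by
      rw [← sum_normSq_row hWW i]
      exact Finset.sum_le_sum_of_subset_of_nonneg (Finset.filter_subset _ _)
        fun _ _ _ => Complex.normSq_nonneg _
    split_ifs with hik
    · have : l c ≤ l i := h.anti (by rw [Fin.le_def, hc]; simp only; omega)
      nlinarith
    · have : l i ≤ l c := h.anti (by rw [Fin.le_def, hc]; simp only; omega)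
      nlinarith
  refine (Finset.sum_le_sum fun i _ => h1 i).trans (le_of_eq ?_)
  rw [Finset.sum_add_distrib, ← Finset.mul_sum, Finset.sum_comm, ← Finset.sum_filter]
  simp_rw [hcol]
  rw [Finset.sum_sub_distrib]
  simp [mul_comm]

lemma sum_filter_lt_succ (f : Fin N → ℝ) (j : Fin N) :
    ∑ i with i.val < j.val + 1, f i = (∑ i with i.val < j.val, f i) + f j := by
  have : (Finset.univ.filter fun i : Fin N => i.val < j.val + 1) =
      insert j (Finset.univ.filter fun i : Fin N => i.val < j.val) := by
    ext i; simp [Fin.ext_iff]; omega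
  rw [this, Finset.sum_insert (by simp), add_comm]

lemma IsEigSys.unique {x : Fin N × Fin N → ℝ} {l l' : Fin N → ℝ} {U V : Matrix (Fin N) (Fin N) ℂ}
    (h : IsEigSys (herm x) l U) (h' : IsEigSys (herm x) l' V) : l = l' := by
  have key : ∀ k, ∑ j with j.val < k, l j = ∑ j with j.val < k, l' j := by
    intro k
    apply le_antisymm
    · have := h'.sum_qf_le h.unit k
      simpa only [h.qf_col] using this
    · have := h.sum_qf_le h'.unit k
      simpa only [h'.qf_col] using this
  ext j
  have h1 := key (j.val + 1)
  rw [sum_filter_lt_succ, sum_filter_lt_succ, key] at h1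
  linarith

end

section
open Matrix
variable {N : ℕ}

/-- The eigenvalues of the Hermitian matrix with coordinates `x`, in nonincreasing order. -/
def ev (x : Fin N × Fin N → ℝ) : Fin N → ℝ := eigsDesc (herm x)

lemma exists_sys (x : Fin N × Fin N → ℝ) : ∃ U, IsEigSys (herm x) (ev x) U :=
  exists_isEigSys (herm_isHermitian x)

lemma IsEigSys.eq_ev {x : Fin N × Fin N → ℝ} {l : Fin N → ℝ} {U : Matrix (Fin N) (Fin N) ℂ}
    (h : IsEigSys (herm x) l U) : l = ev x := h.unique (exists_sys x).choose_spec

lemma ev_anti (x : Fin N × Fin N → ℝ) : Antitone (ev x) := (exists_sys x).choose_spec.anti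

lemma sum_ev_add_le {x y : Fin N × Fin N → ℝ} {U : Matrix (Fin N) (Fin N) ℂ}
    (h : IsEigSys (herm x) (ev x) U) (k : ℕ) :
    (∑ j with j.val < k, ev x j) + ∑ j with j.val < k, qf y (U.col j) ≤
      ∑ j with j.val < k, ev (x + y) j := by
  have h1 := (exists_sys (x + y)).choose_spec.sum_qf_le h.unit k
  simpa only [qf_add, Finset.sum_add_distrib, h.qf_col] using h1

lemma sum_ev_lipschitz (k : ℕ) (x y : Fin N × Fin N → ℝ) :
    |(∑ j with j.val < k, ev x j) - ∑ j with j.val < k, ev y j| ≤ N ^ 3 * ‖x - y‖ := by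
  have key : ∀ x y : Fin N × Fin N → ℝ,
      (∑ j with j.val < k, ev x j) - ∑ j with j.val < k, ev y j ≤ N ^ 3 * ‖x - y‖ := by
    intro x y
    obtain ⟨U, hU⟩ := exists_sys x
    have h1 := sum_ev_add_le (y := y - x) hU k
    rw [add_sub_cancel] at h1
    have h2 : -∑ j with j.val < k, qf (y - x) (U.col j) ≤ N ^ 3 * ‖x - y‖ := by
      rw [← Finset.sum_neg_distrib]
      calc ∑ j with j.val < k, -qf (y - x) (U.col j)
          ≤ ∑ j with j.val < k, N ^ 2 * ‖x - y‖ := by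
            refine Finset.sum_le_sum fun j _ => (neg_le_abs _).trans ((abs_qf_le _ _).trans ?_)
            rw [hU.nsq_col, mul_one, norm_sub_rev]
            calc ∑ p, |(y - x) p| ≤ ∑ p : Fin N × Fin N, ‖y - x‖ :=
                  Finset.sum_le_sum fun p _ => norm_le_pi_norm (y - x) p
              _ = _ := by simp [sq]
        _ ≤ ∑ j : Fin N, N ^ 2 * ‖x - y‖ :=
            Finset.sum_le_sum_of_subset_of_nonneg (Finset.filter_subset _ _)
              fun _ _ _ => by positivity
        _ = _ := by simp; ring
    linarith
  rw [abs_le]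
  have := key y x
  rw [norm_sub_rev] at this
  exact ⟨by linarith, key x y⟩

/-- A Lipschitz constant for the eigenvalues. -/
def evK (N : ℕ) : NNReal := 2 * N ^ 3

lemma ev_lipschitz (j : Fin N) : LipschitzWith (evK N) fun x => ev x j := by
  refine LipschitzWith.of_dist_le_mul fun x y => ?_
  rw [Real.dist_eq, dist_eq_norm]
  have h1 := sum_ev_lipschitz (j.val + 1) x y
  have h2 := sum_ev_lipschitz j.val x y
  rw [sum_filter_lt_succ, sum_filter_lt_succ] at h1
  simp only [evK, NNReal.coe_mul, NNReal.coe_pow, NNReal.coe_natCast, NNReal.coe_ofNat]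
  rw [abs_le] at *
  constructor <;> linarith

lemma continuous_ev (j : Fin N) : Continuous fun x : Fin N × Fin N → ℝ => ev x j :=
  (ev_lipschitz j).continuous

/-- Differentiability of all eigenvalues. -/
def Good (x : Fin N × Fin N → ℝ) : Prop := ∀ j, DifferentiableAt ℝ (fun x => ev x j) x

lemma ae_good : ∀ᵐ x ∂stdGauss (Fin N × Fin N), Good x :=
  ae_all_iff.2 fun j => ae_differentiableAt_stdGauss (ev_lipschitz j)

lemma fderiv_ev {x : Fin N × Fin N → ℝ} (hx : Good x) {U : Matrix (Fin N) (Fin N) ℂ}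
    (h : IsEigSys (herm x) (ev x) U) (j : Fin N) (d : Fin N × Fin N → ℝ) :
    fderiv ℝ (fun x => ev x j) x d = qf d (U.col j) := by
  have key : ∀ k : ℕ, ∑ j with j.val < k, fderiv ℝ (fun x => ev x j) x d =
      ∑ j with j.val < k, qf d (U.col j) := by
    intro k
    have hl : HasDerivAt (fun t : ℝ => x + t • d) d 0 := by
      simpa using ((hasDerivAt_id (0 : ℝ)).smul_const d).const_add x
    have h1 : ∀ j : Fin N, HasDerivAt (fun t : ℝ => ev (x + t • d) j)
        (fderiv ℝ (fun x => ev x j) x d) 0 := by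
      intro j
      have h0 : HasFDerivAt (fun x => ev x j) (fderiv ℝ (fun x => ev x j) x)
          (x + (0 : ℝ) • d) := by
        rw [zero_smul, add_zero]; exact (hx j).hasFDerivAt
      exact h0.comp_hasDerivAt 0 hl
    have h2 : HasDerivAt (fun t : ℝ => (∑ j with j.val < k, ev (x + t • d) j) -
        t * ∑ j with j.val < k, qf d (U.col j))
        ((∑ j with j.val < k, fderiv ℝ (fun x => ev x j) x d) -
          1 * ∑ j with j.val < k, qf d (U.col j)) 0 :=
      (HasDerivAt.fun_sum fun j _ => h1 j).sub ((hasDerivAt_id (0 : ℝ)).mul_const _)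
    have h3 : IsLocalMin (fun t : ℝ => (∑ j with j.val < k, ev (x + t • d) j) -
        t * ∑ j with j.val < k, qf d (U.col j)) 0 := by
      refine Filter.Eventually.of_forall fun t => ?_
      have := sum_ev_add_le (y := t • d) h k
      simp only [qf_smul, ← Finset.mul_sum] at this
      simp only [zero_smul, add_zero, zero_mul, sub_zero]
      linarith
    have := h3.hasDerivAt_eq_zero h2
    linarith
  have h1 := key (j.val + 1)
  rw [sum_filter_lt_succ, sum_filter_lt_succ, key] at h1
  linarith

lemma Good.injective {x : Fin N × Fin N → ℝ} (hx : Good x) : Function.Injective (ev x) := by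
  intro i j hij
  by_contra hne
  obtain ⟨U, h⟩ := exists_sys x
  have h' : IsEigSys (herm x) (ev x) (U.submatrix id (Equiv.swap i j)) := by
    have hs : ∀ k, ev x (Equiv.swap i j k) = ev x k := by
      intro k
      rcases eq_or_ne k i with rfl | hi
      · simp [hij]
      rcases eq_or_ne k j with rfl | hj
      · simp [hij]
      rw [Equiv.swap_apply_of_ne_of_ne hi hj]
    refine ⟨?_, h.anti, ?_⟩
    · ext a b
      have := congrFun (congrFun h.unit (Equiv.swap i j a)) (Equiv.swap i j b)
      rw [Matrix.one_apply] at this ⊢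
      simp only [(Equiv.swap i j).injective.eq_iff] at this
      rw [← this]; rfl
    · ext a b
      have := congrFun (congrFun h.mul_eq a) (Equiv.swap i j b)
      rw [Matrix.mul_diagonal, hs] at this
      rw [Matrix.mul_diagonal]
      exact this
  have e := (fderiv_ev hx h i (rk (U.col i))).symm.trans (fderiv_ev hx h' i (rk (U.col i)))
  have hc : (U.submatrix id (Equiv.swap i j)).col i = U.col j := by
    ext a; simp [Matrix.col]
  rw [hc, qf_rk, qf_rk, h.orth, h.orth, if_pos rfl, if_neg hne] at e
  simp at e

lemma ev_unitConj {U : Matrix (Fin N) (Fin N) ℂ} (hU : Uᴴ * U = 1) (x : Fin N × Fin N → ℝ) :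
    ev ((unitConj U).mulVec x) = ev x := by
  obtain ⟨V, h⟩ := exists_sys x
  refine (IsEigSys.eq_ev (U := U * V) ⟨?_, h.anti, ?_⟩).symm
  · rw [conjTranspose_mul, Matrix.mul_assoc, ← Matrix.mul_assoc _ U, hU, Matrix.one_mul, h.unit]
  · rw [herm_unitConj, Matrix.mul_assoc U V, ← h.mul_eq]
    calc _ = U * herm x * (Uᴴ * U) * V := by simp only [Matrix.mul_assoc]
      _ = _ := by rw [hU]; simp only [Matrix.mul_assoc, Matrix.one_mul]

lemma ev_neg (x : Fin N × Fin N → ℝ) (j : Fin N) : ev (-x) j = -ev x j.rev := by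
  obtain ⟨V, h⟩ := exists_sys x
  have : IsEigSys (herm (-x)) (fun j => -ev x j.rev) (V.submatrix id Fin.rev) := by
    refine ⟨?_, fun i j hij => neg_le_neg (h.anti (Fin.rev_le_rev.2 hij)), ?_⟩
    · ext a b
      have := congrFun (congrFun h.unit a.rev) b.rev
      rw [Matrix.one_apply] at this ⊢
      simp only [Fin.rev_injective.eq_iff] at this
      rw [← this]; rfl
    · ext a b
      have := congrFun (congrFun h.mul_eq a) b.rev
      rw [Matrix.mul_diagonal] at this
      rw [Matrix.mul_diagonal, show (-x : Fin N × Fin N → ℝ) = (-1 : ℝ) • x by simp, herm_smul]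
      simp only [Matrix.mul_apply, Matrix.submatrix_apply, id] at this ⊢
      simp [this, Matrix.smul_apply]
  exact (congrFun this.eq_ev j).symm

lemma sum_ev_sq (x : Fin N × Fin N → ℝ) : ∑ j, ev x j ^ 2 = ∑ p, x p ^ 2 := by
  obtain ⟨V, h⟩ := exists_sys x
  have h1 := sum_mul_eq_trace x x
  have h2 : herm x * herm x = V * diagonal (fun j => (ev x j : ℂ) * ev x j) * Vᴴ := by
    conv_lhs => rw [h.eq_mul]
    calc _ = V * (diagonal fun j => (ev x j : ℂ)) * (Vᴴ * V) * (diagonal fun j => (ev x j : ℂ)) * Vᴴ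
          := by simp only [Matrix.mul_assoc]
      _ = _ := by rw [h.unit, Matrix.mul_one, Matrix.mul_assoc V, Matrix.diagonal_mul_diagonal]
  rw [h2, Matrix.trace_mul_comm, ← Matrix.mul_assoc, h.unit, Matrix.one_mul,
    Matrix.trace_diagonal] at h1
  simp_rw [sq, h1]
  simp

end

section
open Matrix
variable {N : ℕ}

lemma exists_ne_zero_of_card_lt {ι : Type*} [Fintype ι] (f : (Fin N → ℂ) →ₗ[ℂ] (ι → ℂ))
    (h : Fintype.card ι < N) : ∃ w, w ≠ 0 ∧ f w = 0 := by
  have : LinearMap.ker f ≠ ⊥ := LinearMap.ker_ne_bot_of_finrank_lt (by simpa using h)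
  obtain ⟨w, hw, hw0⟩ := (Submodule.ne_bot_iff _).1 this
  exact ⟨w, hw0, hw⟩

/-- The coordinates of the top-left minor. -/
def mnr (x : Fin (N + 1) × Fin (N + 1) → ℝ) : Fin N × Fin N → ℝ :=
  fun p => x (p.1.castSucc, p.2.castSucc)

lemma herm_mnr (x : Fin (N + 1) × Fin (N + 1) → ℝ) :
    herm (mnr x) = (herm x).submatrix Fin.castSucc Fin.castSucc := by
  ext a b; simp [herm, mnr]

/-- Extension of a vector by zero in the last coordinate. -/
def vext : (Fin N → ℂ) →ₗ[ℂ] (Fin (N + 1) → ℂ) where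
  toFun w := Fin.snoc w 0
  map_add' v w := by
    ext a; refine Fin.lastCases ?_ (fun i => ?_) a <;> simp
  map_smul' c w := by
    ext a; refine Fin.lastCases ?_ (fun i => ?_) a <;> simp

@[simp] lemma vext_castSucc (w : Fin N → ℂ) (i : Fin N) : vext w i.castSucc = w i := by
  simp [vext]

@[simp] lemma vext_last (w : Fin N → ℂ) : vext w (Fin.last N) = 0 := by
  simp [vext]

lemma nsq_vext (w : Fin N → ℂ) : nsq (vext w) = nsq w := by
  simp [nsq, Fin.sum_univ_castSucc]

lemma qf_vext (x : Fin (N + 1) × Fin (N + 1) → ℝ) (w : Fin N → ℂ) :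
    qf x (vext w) = qf (mnr x) w := by
  simp [qf, dotProduct, Matrix.mulVec, Fin.sum_univ_castSucc, herm_mnr]

/-- The coordinates against the columns of `U` as a linear map. -/
def colForm (U : Matrix (Fin N) (Fin N) ℂ) : (Fin N → ℂ) →ₗ[ℂ] (Fin N → ℂ) := Matrix.toLin' Uᴴ

lemma colForm_apply (U : Matrix (Fin N) (Fin N) ℂ) (w : Fin N → ℂ) (i : Fin N) :
    colForm U w i = star (U.col i) ⬝ᵥ w := rfl

lemma ev_mnr_le (x : Fin (N + 1) × Fin (N + 1) → ℝ) (j : Fin N) :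
    ev (mnr x) j ≤ ev x j.castSucc := by
  obtain ⟨U, hU⟩ := exists_sys x
  obtain ⟨V, hV⟩ := exists_sys (mnr x)
  let f : (Fin N → ℂ) →ₗ[ℂ] ({i : Fin N // i ≠ j} → ℂ) := LinearMap.pi fun i =>
    if j < i.1 then LinearMap.proj i.1 ∘ₗ colForm V
    else LinearMap.proj i.1.castSucc ∘ₗ colForm U ∘ₗ vext
  obtain ⟨w, hw0, hw⟩ := exists_ne_zero_of_card_lt f (by
    have := j.pos
    simp [Fintype.card_subtype_compl]; omega)
  have h1 : ev (mnr x) j * nsq w ≤ qf (mnr x) w := by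
    refine hV.le_qf fun i hi => ?_
    have := congrFun hw ⟨i, hi.ne'⟩
    simpa [f, hi, colForm_apply] using this
  have h2 : qf x (vext w) ≤ ev x j.castSucc * nsq (vext w) := by
    refine hU.qf_le fun i hi => ?_
    obtain ⟨i, rfl⟩ : ∃ i' : Fin N, i = i'.castSucc :=
      ⟨⟨i.val, by have := j.isLt; rw [Fin.lt_def] at hi; simp at hi; omega⟩, rfl⟩
    have hi' : i < j := hi
    have := congrFun hw ⟨i, hi'.ne⟩
    simpa [f, hi'.not_gt, colForm_apply] using this
  rw [qf_vext, nsq_vext] at h2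
  exact le_of_mul_le_mul_right (h1.trans h2) (nsq_pos hw0)

lemma ev_succ_le (x : Fin (N + 1) × Fin (N + 1) → ℝ) (j : Fin N) :
    ev x j.succ ≤ ev (mnr x) j := by
  obtain ⟨U, hU⟩ := exists_sys x
  obtain ⟨V, hV⟩ := exists_sys (mnr x)
  let f : (Fin N → ℂ) →ₗ[ℂ] ({i : Fin N // i ≠ j} → ℂ) := LinearMap.pi fun i =>
    if j < i.1 then LinearMap.proj i.1.succ ∘ₗ colForm U ∘ₗ vext
    else LinearMap.proj i.1 ∘ₗ colForm V
  obtain ⟨w, hw0, hw⟩ := exists_ne_zero_of_card_lt f (by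
    have := j.pos
    simp [Fintype.card_subtype_compl]; omega)
  have h1 : qf (mnr x) w ≤ ev (mnr x) j * nsq w := by
    refine hV.qf_le fun i hi => ?_
    have := congrFun hw ⟨i, hi.ne⟩
    simpa [f, hi.not_gt, colForm_apply] using this
  have h2 : ev x j.succ * nsq (vext w) ≤ qf x (vext w) := by
    refine hU.le_qf fun i hi => ?_
    obtain ⟨i, rfl⟩ : ∃ i' : Fin N, i = i'.succ :=
      Fin.exists_succ_eq.2 (Fin.ne_zero_of_lt hi) |>.imp fun _ h => h.symm
    have hi' : j < i := Fin.succ_lt_succ_iff.1 hi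
    have := congrFun hw ⟨i, hi'.ne'⟩
    simpa [f, hi', colForm_apply] using this
  rw [qf_vext, nsq_vext] at h2
  exact le_of_mul_le_mul_right (h2.trans h1) (nsq_pos hw0)

/-- The last diagonal direction. -/
def eLast (N : ℕ) : Fin (N + 1) × Fin (N + 1) → ℝ := Pi.single (Fin.last N, Fin.last N) 1

lemma mnr_add_smul_eLast (x : Fin (N + 1) × Fin (N + 1) → ℝ) (s : ℝ) :
    mnr (x + s • eLast N) = mnr x := by
  ext p
  simp [mnr, eLast, Pi.single_apply, Prod.ext_iff, (Fin.castSucc_lt_last _).ne]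

lemma qf_eLast (w : Fin (N + 1) → ℂ) : qf (eLast N) w = Complex.normSq (w (Fin.last N)) := by
  rw [qf_eq_sum, eLast, Finset.sum_eq_single (Fin.last N, Fin.last N)]
  · simp [rk, coordH, vecMulVec_apply, Complex.mul_conj, Complex.normSq_apply]
  · intro b _ hb; simp [hb]
  · simp

lemma abs_rk_le (w : Fin N → ℂ) (a b : Fin N) :
    |rk w (a, b)| ≤ 2 * (‖w a‖ * ‖w b‖) := by
  have hs : Real.sqrt 2 ≤ 2 := by
    rw [Real.sqrt_le_left (by norm_num)]; norm_num
  have hn : ∀ a b, ‖w a * star (w b)‖ = ‖w a‖ * ‖w b‖ := fun a b => by rw [norm_mul, norm_star]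
  have h0 : 0 ≤ ‖w a‖ * ‖w b‖ := by positivity
  simp only [rk, coordH, vecMulVec_apply, Pi.star_apply]
  split_ifs with h1 h2
  · subst h1
    have := Complex.abs_re_le_norm (w a * star (w a))
    rw [hn] at this
    linarith
  · have := Complex.abs_re_le_norm (w a * star (w b))
    rw [hn] at this
    rw [abs_mul, abs_of_nonneg (Real.sqrt_nonneg _)]
    exact mul_le_mul hs this (abs_nonneg _) (by norm_num)
  · have := Complex.abs_im_le_norm (w b * star (w a))
    rw [hn, mul_comm ‖w b‖] at this
    rw [abs_mul, abs_of_nonneg (Real.sqrt_nonneg _)]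
    exact mul_le_mul hs this (abs_nonneg _) (by norm_num)

lemma nsq_snoc (w : Fin (N + 1) → ℂ) :
    nsq w = nsq (fun i : Fin N => w i.castSucc) + Complex.normSq (w (Fin.last N)) := by
  simp [nsq, Fin.sum_univ_castSucc]

lemma norm_le_of_nsq {w : Fin N → ℂ} (hw : nsq w = 1) (a : Fin N) : ‖w a‖ ≤ 1 := by
  have h1 : Complex.normSq (w a) ≤ 1 := by
    rw [← hw]
    exact Finset.single_le_sum (f := fun a => Complex.normSq (w a))
      (fun _ _ => Complex.normSq_nonneg _) (Finset.mem_univ a)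
  rw [Complex.normSq_eq_norm_sq] at h1
  nlinarith [norm_nonneg (w a)]

lemma qf_le_trunc (x : Fin (N + 1) × Fin (N + 1) → ℝ) {w : Fin (N + 1) → ℂ} (hw : nsq w = 1) :
    qf x w ≤ qf (mnr x) (fun i => w i.castSucc) + 2 * (∑ p, |x p|) * ‖w (Fin.last N)‖ := by
  have h1 : qf (mnr x) (fun i => w i.castSucc) =
      ∑ p : Fin (N + 1) × Fin (N + 1), if p.1 = Fin.last N ∨ p.2 = Fin.last N then 0 else
        x p * rk w p := by
    rw [qf_eq_sum, Fintype.sum_prod_type, Fintype.sum_prod_type]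
    simp [Fin.sum_univ_castSucc, (Fin.castSucc_lt_last _).ne, mnr, rk, coordH, vecMulVec_apply]
  rw [h1, qf_eq_sum, ← sub_le_iff_le_add', ← Finset.sum_sub_distrib, Finset.mul_sum,
    Finset.sum_mul]
  refine Finset.sum_le_sum fun p _ => ?_
  obtain ⟨a, b⟩ := p
  split_ifs with h
  · rw [sub_zero]
    refine (le_abs_self _).trans ?_
    rw [abs_mul, mul_comm 2, mul_assoc]
    refine mul_le_mul_of_nonneg_left ((abs_rk_le w a b).trans ?_) (abs_nonneg _)
    refine mul_le_mul_of_nonneg_left ?_ (by norm_num)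
    rcases h with h | h <;> simp only at h <;> subst h
    · exact mul_le_of_le_one_right (norm_nonneg _) (norm_le_of_nsq hw _)
    · exact mul_le_of_le_one_left (norm_nonneg _) (norm_le_of_nsq hw _)
  · simp; positivity

lemma exists_nsq_eq_one {ι : Type*} [Fintype ι] (f : (Fin N → ℂ) →ₗ[ℂ] (ι → ℂ))
    (h : Fintype.card ι < N) : ∃ w, nsq w = 1 ∧ f w = 0 := by
  obtain ⟨w, hw0, hw⟩ := exists_ne_zero_of_card_lt f h
  refine ⟨((Real.sqrt (nsq w))⁻¹ : ℂ) • w, ?_, by rw [map_smul, hw, smul_zero]⟩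
  have := nsq_pos hw0
  generalize hr : nsq w = r at *
  simp only [nsq, Pi.smul_apply, smul_eq_mul, Complex.normSq_mul, ← Finset.mul_sum]
  change _ * nsq w = 1
  rw [hr]
  rw [← Complex.ofReal_inv, Complex.normSq_ofReal, ← mul_inv, Real.mul_self_sqrt this.le,
    inv_mul_cancel₀ this.ne']

/-- Pushing the last diagonal entry to `-∞` produces the eigenvalues of the minor. -/
lemma ev_sub_smul_eLast_le (x : Fin (N + 1) × Fin (N + 1) → ℝ) (j : Fin N) {s : ℝ}
    (hs : |ev (mnr x) j| < s) :
    ev (x + (-s) • eLast N) j.castSucc ≤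
      ev (mnr x) j + (∑ p, |x p|) ^ 2 / (s - |ev (mnr x) j|) := by
  obtain ⟨U, hU⟩ := exists_sys (x + (-s) • eLast N)
  obtain ⟨V, hV⟩ := exists_sys (mnr x)
  let tr : (Fin (N + 1) → ℂ) →ₗ[ℂ] (Fin N → ℂ) := LinearMap.funLeft ℂ ℂ Fin.castSucc
  let f : (Fin (N + 1) → ℂ) →ₗ[ℂ] (Fin N → ℂ) := LinearMap.pi fun i =>
    if i < j then LinearMap.proj i ∘ₗ colForm V ∘ₗ tr
    else LinearMap.proj i.succ ∘ₗ colForm U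
  obtain ⟨w, hw1, hw⟩ := exists_nsq_eq_one f (by simp)
  have h1 : qf (mnr x) (tr w) ≤ ev (mnr x) j * nsq (tr w) := by
    refine hV.qf_le fun i hi => ?_
    have := congrFun hw i
    simpa [f, hi, colForm_apply] using this
  have h2 : ev (x + (-s) • eLast N) j.castSucc * nsq w ≤ qf (x + (-s) • eLast N) w := by
    refine hU.le_qf fun i hi => ?_
    obtain ⟨i, rfl⟩ : ∃ i' : Fin N, i = i'.succ :=
      Fin.exists_succ_eq.2 (Fin.ne_zero_of_lt hi) |>.imp fun _ h => h.symm
    have hi' : j ≤ i := Fin.castSucc_lt_succ_iff.1 hi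
    have := congrFun hw i
    simpa [f, hi'.not_gt, colForm_apply] using this
  have h3 := qf_le_trunc x hw1
  have h4 : nsq (tr w) = 1 - ‖w (Fin.last N)‖ ^ 2 := by
    have := nsq_snoc w
    rw [hw1, Complex.normSq_eq_norm_sq] at this
    have e : nsq (tr w) = nsq (fun i : Fin N => w i.castSucc) := rfl
    rw [e]; linarith
  rw [hw1, mul_one, qf_add, qf_smul, qf_eLast, Complex.normSq_eq_norm_sq] at h2
  change qf x w ≤ qf (mnr x) (tr w) + _ at h3
  rw [h4] at h1
  set t := ‖w (Fin.last N)‖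
  set S := ∑ p, |x p|
  set μ := ev (mnr x) j
  have hd : 0 < s - |μ| := by linarith
  have h5 : 2 * S * t - (s - |μ|) * t ^ 2 ≤ S ^ 2 / (s - |μ|) := by
    rw [le_div_iff₀ hd]
    nlinarith [sq_nonneg (S - (s - |μ|) * t)]
  have h6 : -μ * t ^ 2 ≤ |μ| * t ^ 2 := mul_le_mul_of_nonneg_right (neg_le_abs μ) (sq_nonneg t)
  nlinarith

lemma tendsto_ev_sub_smul_eLast (x : Fin (N + 1) × Fin (N + 1) → ℝ) (j : Fin N) :
    Filter.Tendsto (fun s : ℝ => ev (x + (-s) • eLast N) j.castSucc) Filter.atTop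
      (nhds (ev (mnr x) j)) := by
  have h : Filter.Tendsto (fun s : ℝ => ev (mnr x) j + (∑ p, |x p|) ^ 2 / (s - |ev (mnr x) j|))
      Filter.atTop (nhds (ev (mnr x) j + 0)) :=
    Filter.Tendsto.const_add _ (Filter.Tendsto.const_div_atTop
      (Filter.tendsto_atTop_add_const_right _ (-|ev (mnr x) j|) Filter.tendsto_id) _)
  rw [add_zero] at h
  refine tendsto_of_tendsto_of_tendsto_of_le_of_le' tendsto_const_nhds h ?_ ?_
  · refine Filter.Eventually.of_forall fun s => ?_
    have := ev_mnr_le (x + (-s) • eLast N) j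
    rwa [mnr_add_smul_eLast] at this
  · filter_upwards [Filter.eventually_gt_atTop |ev (mnr x) j|] with s hs
    exact ev_sub_smul_eLast_le x j hs

end

section
open Matrix
variable {N : ℕ}

/-- A rotation in the plane of two coordinates. -/
def planeRot (j k : Fin N) (ω : ℂ) (c s : ℝ) : Matrix (Fin N) (Fin N) ℂ :=
  1 + ((c : ℂ) - 1) • (Matrix.single j j (1 : ℂ) + Matrix.single k k (1 : ℂ)) +
    (s : ℂ) • (ω • Matrix.single k j (1 : ℂ) - star ω • Matrix.single j k (1 : ℂ))

lemma planeRot_unit {j k : Fin N} (hjk : j ≠ k) {ω : ℂ} (hω : ω * star ω = 1) {c s : ℝ}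
    (h : c ^ 2 + s ^ 2 = 1) : (planeRot j k ω c s)ᴴ * planeRot j k ω c s = 1 := by
  have h' : (c : ℂ) ^ 2 + (s : ℂ) ^ 2 = 1 := by exact_mod_cast h
  simp only [planeRot, conjTranspose_add, conjTranspose_sub, conjTranspose_smul, conjTranspose_one,
    conjTranspose_single, star_one, star_star, Complex.star_def, map_sub, map_one,
    Complex.conj_ofReal, Complex.conj_conj]
  rw [Complex.star_def] at hω
  simp only [add_mul, mul_add, sub_mul, mul_sub, Matrix.smul_mul, Matrix.mul_smul, Matrix.one_mul,
    Matrix.mul_one, smul_add, smul_sub, Matrix.single_mul_single_same,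
    Matrix.single_mul_single_of_ne _ _ _ _ hjk, Matrix.single_mul_single_of_ne _ _ _ _ hjk.symm, mul_one, smul_zero, add_zero,
    zero_add, sub_zero]
  generalize starRingEnd ℂ ω = v at *
  match_scalars <;> first | ring1 | linear_combination h' + (s:ℂ)^2 * hω

lemma planeRot_mul {j k : Fin N} (hjk : j ≠ k) {ω : ℂ} (hω : ω * star ω = 1) {c s : ℝ}
    (h : c ^ 2 + s ^ 2 = 1) (l : Fin N → ℝ) :
    planeRot j k ω c s * (diagonal fun i => (l i : ℂ)) =
      ((diagonal fun i => (l i : ℂ)) +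
        (((l j - l k) / 2 * (c ^ 2 - s ^ 2 - 1) : ℝ) : ℂ) •
          (Matrix.single j j (1 : ℂ) - Matrix.single k k (1 : ℂ)) +
        (((l j - l k) / 2 * (2 * s * c) : ℝ) : ℂ) •
          (star ω • Matrix.single j k (1 : ℂ) + ω • Matrix.single k j (1 : ℂ))) *
      planeRot j k ω c s := by
  have h' : (c : ℂ) ^ 2 + (s : ℂ) ^ 2 = 1 := by exact_mod_cast h
  have d1 : ∀ a b : Fin N, Matrix.single a b (1 : ℂ) * (diagonal fun i => (l i : ℂ)) =
      (l b : ℂ) • Matrix.single a b (1 : ℂ) := by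
    intro a b; ext i i'; simp [Matrix.mul_diagonal, Matrix.single_apply]; 
    split_ifs with h
    · rw [h.2]
    · rfl
  have d2 : ∀ a b : Fin N, (diagonal fun i => (l i : ℂ)) * Matrix.single a b (1 : ℂ)  =
      (l a : ℂ) • Matrix.single a b (1 : ℂ) := by
    intro a b; ext i i'; simp [Matrix.diagonal_mul, Matrix.single_apply]; 
    split_ifs with h
    · rw [h.1]
    · rfl
  simp only [planeRot]
  rw [Complex.star_def] at *
  simp only [add_mul, mul_add, sub_mul, mul_sub, Matrix.smul_mul, Matrix.mul_smul, Matrix.one_mul,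
    Matrix.mul_one, smul_add, smul_sub, Matrix.single_mul_single_same, d1, d2,
    Matrix.single_mul_single_of_ne _ _ _ _ hjk, Matrix.single_mul_single_of_ne _ _ _ _ hjk.symm, mul_one, smul_zero, add_zero,
    zero_add, sub_zero]
  push_cast
  generalize starRingEnd ℂ ω = v at *
  match_scalars
  all_goals try ring1
  · linear_combination (-(c * ((l j : ℂ) - l k) / 2)) * h' - c * ((l j : ℂ) - l k) * s ^ 2 * hω
  · linear_combination ((c * ((l j : ℂ) - l k) / 2)) * h' + c * ((l j : ℂ) - l k) * s ^ 2 * hω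
  · linear_combination (-(s * ω * ((l j : ℂ) - l k) / 2)) * h'
  · linear_combination (-(s * v * ((l j : ℂ) - l k) / 2)) * h'

/-- The coordinates of a diagonal matrix. -/
def dg (l : Fin N → ℝ) : Fin N × Fin N → ℝ := fun p => if p.1 = p.2 then l p.1 else 0

lemma herm_dg (l : Fin N → ℝ) : herm (dg l) = diagonal fun i => (l i : ℂ) := by
  ext a b
  simp only [herm, dg, Matrix.of_apply, diagonal_apply]
  split_ifs with h1 h2 h3 h4 <;> simp_all

lemma herm_sub (x y : Fin N × Fin N → ℝ) : herm (x - y) = herm x - herm y := by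
  have := herm_add (x - y) y
  rw [sub_add_cancel] at this
  rw [this, add_sub_cancel_right]

lemma herm_single_diag (j : Fin N) : herm (Pi.single (j, j) 1) = Matrix.single j j (1 : ℂ) := by
  ext a b
  simp only [herm, Matrix.of_apply, Matrix.single_apply, Pi.single_apply, Prod.mk.injEq]
  by_cases h : a = b
  · subst h
    simp only [and_self, if_true, eq_comm (a := a)]
    split_ifs <;> simp
  · have : ¬ (j = a ∧ j = b) := fun h' => h (h'.1.symm.trans h'.2)
    have h1 : ¬ (a = j ∧ b = j) := fun h' => h (h'.1.trans h'.2.symm)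
    have h2 : ¬ (b = j ∧ a = j) := fun h' => h (h'.2.trans h'.1.symm)
    simp [h, this, h1, h2]

lemma exists_phase {j k : Fin N} (hjk : j ≠ k) : ∃ ω : ℂ, ω * star ω = 1 ∧
    herm (Real.sqrt 2 • Pi.single (j, k) 1) =
      star ω • Matrix.single j k (1 : ℂ) + ω • Matrix.single k j (1 : ℂ) := by
  have h2 : ((Real.sqrt 2 : ℝ) : ℂ) ≠ 0 := by exact_mod_cast sqrt_two_ne
  rcases lt_or_gt_of_ne hjk with h | h
  · refine ⟨1, by simp, ?_⟩
    rw [herm_smul]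
    ext a b
    simp only [herm, Matrix.of_apply, Matrix.single_apply, Pi.single_apply, Prod.mk.injEq,
      Matrix.smul_apply, Matrix.add_apply, smul_eq_mul, star_one, one_mul]
    by_cases hab : a = b
    · subst hab
      have e1 : ¬ (a = j ∧ a = k) := fun h' => hjk (h'.1.symm.trans h'.2)
      have e2 : ¬ (j = a ∧ k = a) := fun h' => hjk (h'.1.trans h'.2.symm)
      have e3 : ¬ (k = a ∧ j = a) := fun h' => hjk (h'.2.trans h'.1.symm)
      simp [e1, e2, e3]
    · rcases lt_or_gt_of_ne hab with hl | hl
      · have e1 : ¬ (b = j ∧ a = k) := fun h' => by omega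
        have e2 : ¬ (k = a ∧ j = b) := fun h' => by omega
        by_cases e : a = j ∧ b = k
        · obtain ⟨rfl, rfl⟩ := e
          simp [hab, hl, e1, e2]
        · have e' : ¬ (j = a ∧ k = b) := fun h' => e ⟨h'.1.symm, h'.2.symm⟩
          simp [hab, hl, e1, e2, e, e']
      · have hl' : ¬ a < b := hl.not_gt
        have e1 : ¬ (a = j ∧ b = k) := fun h' => by omega
        have e2 : ¬ (j = a ∧ k = b) := fun h' => by omega
        by_cases e : b = j ∧ a = k
        · obtain ⟨rfl, rfl⟩ := e
          simp [hab, hl', e1, e2]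
        · have e' : ¬ (k = a ∧ j = b) := fun h' => e ⟨h'.2.symm, h'.1.symm⟩
          simp [hab, hl', e1, e2, e, e']
  · refine ⟨Complex.I, by simp, ?_⟩
    rw [herm_smul]
    ext a b
    simp only [herm, Matrix.of_apply, Matrix.single_apply, Pi.single_apply, Prod.mk.injEq,
      Matrix.smul_apply, Matrix.add_apply, smul_eq_mul, Complex.star_def, Complex.conj_I]
    by_cases hab : a = b
    · subst hab
      have e1 : ¬ (a = j ∧ a = k) := fun h' => hjk (h'.1.symm.trans h'.2)
      have e2 : ¬ (j = a ∧ k = a) := fun h' => hjk (h'.1.trans h'.2.symm)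
      have e3 : ¬ (k = a ∧ j = a) := fun h' => hjk (h'.2.trans h'.1.symm)
      simp [e1, e2, e3]
    · rcases lt_or_gt_of_ne hab with hl | hl
      · have e1 : ¬ (a = j ∧ b = k) := fun h' => by omega
        have e2 : ¬ (j = a ∧ k = b) := fun h' => by omega
        by_cases e : b = j ∧ a = k
        · obtain ⟨rfl, rfl⟩ := e
          simp [hab, hl, e1, e2]
          field_simp
        · have e' : ¬ (k = a ∧ j = b) := fun h' => e ⟨h'.2.symm, h'.1.symm⟩
          simp [hab, hl, e1, e2, e, e']
      · have hl' : ¬ a < b := hl.not_gt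
        have e1 : ¬ (b = j ∧ a = k) := fun h' => by omega
        have e2 : ¬ (k = a ∧ j = b) := fun h' => by omega
        by_cases e : a = j ∧ b = k
        · obtain ⟨rfl, rfl⟩ := e
          simp [hab, hl', e1, e2]
          field_simp
        · have e' : ¬ (j = a ∧ k = b) := fun h' => e ⟨h'.1.symm, h'.2.symm⟩
          simp [hab, hl', e1, e2, e, e']

open MvPolynomial in
lemma eval_rotated {u : MvPolynomial (Fin N × Fin N) ℝ} (hu : ∀ k ∈ unitSet N, polyComp k u = u)
    {j k : Fin N} (hjk : j ≠ k) (l : Fin N → ℝ) (τ : ℝ) :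
    eval (dg l + ((l j - l k) / 2 * (Real.cos τ - 1)) • (Pi.single (j, j) 1 - Pi.single (k, k) 1) +
      ((l j - l k) / 2 * Real.sin τ) • (Real.sqrt 2 • Pi.single (j, k) 1)) u = eval (dg l) u := by
  obtain ⟨ω, hω, he⟩ := exists_phase hjk
  set c := Real.cos (τ / 2)
  set s := Real.sin (τ / 2)
  have hcs : c ^ 2 + s ^ 2 = 1 := Real.cos_sq_add_sin_sq _
  have hc : Real.cos τ = c ^ 2 - s ^ 2 := by
    rw [← Real.cos_two_mul', mul_div_cancel₀ _ two_ne_zero]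
  have hs : Real.sin τ = 2 * s * c := by
    rw [← Real.sin_two_mul, mul_div_cancel₀ _ two_ne_zero]
  have hU := planeRot_unit hjk hω hcs
  have hm := planeRot_mul hjk hω hcs l
  conv_rhs => rw [← hu _ ⟨_, hU, rfl⟩, eval_polyComp]
  congr 1
  rw [unitConj_mulVec, herm_dg, hm, Matrix.mul_assoc, mul_eq_one_comm.1 hU, Matrix.mul_one,
    ← coordH_herm (dg l + _ + _)]
  congr 1
  rw [herm_add, herm_add, herm_smul, herm_smul, he, herm_dg, herm_sub, herm_single_diag,
    herm_single_diag, hc, hs]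


open MvPolynomial in
lemma hess_at_dg {u : MvPolynomial (Fin N × Fin N) ℝ} (hu : ∀ k ∈ unitSet N, polyComp k u = u)
    {j k : Fin N} (hjk : j ≠ k) {l : Fin N → ℝ} (hl : l j ≠ l k) :
    eval (dg l) (pderiv (j, k) u) = 0 ∧
    eval (dg l) (pderiv (j, k) (pderiv (j, k) u)) =
      (eval (dg l) (pderiv (j, j) u) - eval (dg l) (pderiv (k, k) u)) / (l j - l k) := by
  set a := (l j - l k) / 2 with ha
  have ha0 : a ≠ 0 := by rw [ha]; exact div_ne_zero (sub_ne_zero.2 hl) two_ne_zero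
  set γ : ℝ → (Fin N × Fin N → ℝ) := fun τ =>
    dg l + (a * (Real.cos τ - 1)) • (Pi.single (j, j) 1 - Pi.single (k, k) 1) +
      (a * Real.sin τ) • (Real.sqrt 2 • Pi.single (j, k) 1) with hγ
  have hγ0 : γ 0 = dg l := by simp [hγ]
  have hd : ∀ τ, HasDerivAt γ ((-(a * Real.sin τ)) • (Pi.single (j, j) 1 - Pi.single (k, k) 1) +
      (a * Real.cos τ) • (Real.sqrt 2 • Pi.single (j, k) 1)) τ := by
    intro τ
    have h1 := ((((Real.hasDerivAt_cos τ).sub_const 1).const_mul a).smul_const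
      (Pi.single (j, j) 1 - Pi.single (k, k) 1 : Fin N × Fin N → ℝ)).const_add (dg l)
    have h2 := ((Real.hasDerivAt_sin τ).const_mul a).smul_const
      (Real.sqrt 2 • Pi.single (j, k) 1 : Fin N × Fin N → ℝ)
    have h3 := h1.add h2
    simp only [mul_neg] at h3
    exact h3
  have hp : ∀ (v : MvPolynomial (Fin N × Fin N) ℝ) τ, HasDerivAt (fun τ => eval (γ τ) v)
      (-(a * Real.sin τ) * (eval (γ τ) (pderiv (j, j) v) - eval (γ τ) (pderiv (k, k) v)) +
        a * Real.cos τ * Real.sqrt 2 * eval (γ τ) (pderiv (j, k) v)) τ := by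
    intro v τ
    have h := (hasFDerivAt_polyEval v (γ τ)).comp_hasDerivAt τ (hd τ)
    refine h.congr_deriv ?_
    simp only [ContinuousLinearMap.sum_apply, ContinuousLinearMap.smul_apply,
      ContinuousLinearMap.proj_apply, Pi.add_apply, Pi.smul_apply, Pi.sub_apply, smul_eq_mul,
      mul_add, mul_sub, Finset.sum_add_distrib, Finset.sum_sub_distrib, Pi.single_apply, mul_ite,
      mul_one, mul_zero, Finset.sum_ite_eq', Finset.mem_univ, if_true]
    ring
  have hz : ∀ τ, -(a * Real.sin τ) * (eval (γ τ) (pderiv (j, j) u) - eval (γ τ) (pderiv (k, k) u)) +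
        a * Real.cos τ * Real.sqrt 2 * eval (γ τ) (pderiv (j, k) u) = 0 := by
    intro τ
    have hc : (fun τ => eval (γ τ) u) = fun _ => eval (dg l) u :=
      funext fun τ => by
        have h0 := eval_rotated hu hjk l τ
        rw [← ha] at h0
        exact h0
    have := hp u τ
    rw [hc] at this
    exact this.unique (hasDerivAt_const τ _)
  have hs2 : Real.sqrt 2 * Real.sqrt 2 = 2 := Real.mul_self_sqrt (by norm_num)
  have e1 : eval (dg l) (pderiv (j, k) u) = 0 := by
    have := hz 0
    rw [hγ0] at this
    simpa [ha0] using this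
  refine ⟨e1, ?_⟩
  have key : ∀ (f g : ℝ → ℝ) (f' g' : ℝ), HasDerivAt f f' 0 → HasDerivAt g g' 0 →
      (∀ τ, -(a * Real.sin τ) * f τ + a * Real.cos τ * Real.sqrt 2 * g τ = 0) →
      -a * f 0 + a * Real.sqrt 2 * g' = 0 := by
    intro f g f' g' hf hg hfg
    have h1 := ((((Real.hasDerivAt_sin 0).const_mul a).fun_neg).fun_mul hf).fun_add
      ((((Real.hasDerivAt_cos 0).const_mul a).mul_const (Real.sqrt 2)).fun_mul hg)
    simp only [hfg] at h1
    have h2 := h1.unique (hasDerivAt_const (0 : ℝ) (0 : ℝ))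
    simpa using h2
  have h2 := key _ _ _ _ ((hp (pderiv (j, j) u) 0).fun_sub (hp (pderiv (k, k) u) 0))
    (hp (pderiv (j, k) u) 0) hz
  simp only [hγ0, Real.sin_zero, Real.cos_zero, mul_zero, mul_one,
    neg_zero, zero_mul, add_zero, zero_add] at h2
  have h3 : a * (2 * a * eval (dg l) (pderiv (j, k) (pderiv (j, k) u)) -
      (eval (dg l) (pderiv (j, j) u) - eval (dg l) (pderiv (k, k) u))) = 0 := by
    linear_combination h2 - a ^ 2 * eval (dg l) (pderiv (j, k) (pderiv (j, k) u)) * hs2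
  have h4 := (mul_eq_zero.1 h3).resolve_left ha0
  have h5 : l j - l k = 2 * a := by rw [ha]; ring
  rw [h5, eq_div_iff (mul_ne_zero two_ne_zero ha0)]
  linarith

lemma sum_sq_transpose_mulVec {κ : Type*} [Fintype κ] [DecidableEq κ] {k : Matrix κ κ ℝ}
    (hk : k * k.transpose = 1) (v : κ → ℝ) :
    ∑ q, (∑ i, k i q * v i) ^ 2 = ∑ i, v i ^ 2 := by
  have h : ∀ w : κ → ℝ, ∑ i, w i ^ 2 = w ⬝ᵥ w := fun w => by simp [dotProduct, sq]
  have h2 : (fun q => ∑ i, k i q * v i) = k.transpose *ᵥ v := rfl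
  rw [h, h, h2, Matrix.dotProduct_mulVec, Matrix.vecMul_transpose, Matrix.mulVec_mulVec, hk,
    Matrix.one_mulVec]

/-- The diagonal part of the gradient in an eigenbasis. -/
def gradDiag (u : MvPolynomial (Fin N × Fin N) ℝ) (x : Fin N × Fin N → ℝ)
    (U : Matrix (Fin N) (Fin N) ℂ) (j : Fin N) : ℝ := qf (polyGrad u x) (U.col j)

lemma unitConj_dg {x : Fin N × Fin N → ℝ} {l : Fin N → ℝ} {U : Matrix (Fin N) (Fin N) ℂ}
    (h : IsEigSys (herm x) l U) : (unitConj U).mulVec (dg l) = x := by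
  rw [unitConj_mulVec, herm_dg, ← h.eq_mul, coordH_herm]

open MvPolynomial in
lemma pderiv_invariant {u : MvPolynomial (Fin N × Fin N) ℝ}
    (hu : ∀ k ∈ unitSet N, polyComp k u = u) {x : Fin N × Fin N → ℝ} {l : Fin N → ℝ}
    {U : Matrix (Fin N) (Fin N) ℂ} (h : IsEigSys (herm x) l U) (q : Fin N × Fin N) :
    eval (dg l) (pderiv q u) = ∑ i, unitConj U i q * eval x (pderiv i u) := by
  have hk : unitConj U ∈ unitSet N := ⟨U, h.unit, rfl⟩
  conv_lhs => rw [← hu _ hk, pderiv_polyComp]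
  simp only [map_sum, map_mul, eval_C, eval_polyComp, unitConj_dg h]

open MvPolynomial in
lemma pderiv2_invariant {u : MvPolynomial (Fin N × Fin N) ℝ}
    (hu : ∀ k ∈ unitSet N, polyComp k u = u) {x : Fin N × Fin N → ℝ} {l : Fin N → ℝ}
    {U : Matrix (Fin N) (Fin N) ℂ} (h : IsEigSys (herm x) l U) (q r : Fin N × Fin N) :
    eval (dg l) (pderiv r (pderiv q u)) =
      ∑ j, unitConj U j r * ∑ i, unitConj U i q * eval x (pderiv j (pderiv i u)) := by
  have hk : unitConj U ∈ unitSet N := ⟨U, h.unit, rfl⟩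
  conv_lhs => rw [← hu _ hk, pderiv_polyComp]
  simp only [map_sum, Derivation.leibniz, pderiv_C, smul_zero, mul_zero, add_zero, pderiv_polyComp,
    smul_eq_mul, map_mul, eval_C, eval_polyComp, unitConj_dg h, Finset.mul_sum]
  rw [Finset.sum_comm]
  exact Finset.sum_congr rfl fun j _ => Finset.sum_congr rfl fun i _ => by ring

lemma unitConj_col_diag (U : Matrix (Fin N) (Fin N) ℂ) (j : Fin N) (p : Fin N × Fin N) :
    unitConj U p (j, j) = rk (U.col j) p := by
  have h : (unitConj U).mulVec (Pi.single (j, j) 1) = rk (U.col j) := by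
    rw [unitConj_mulVec, herm_single_diag, rk]
    congr 1
    ext a b
    simp [Matrix.mul_apply, Matrix.single_apply, vecMulVec_apply, Matrix.col]
    rw [Finset.sum_eq_single j (by intro c _ hc; simp [hc.symm]) (by simp)]
    simp
  rw [← h, Matrix.mulVec_single_one]; rfl

open MvPolynomial in
lemma gradDiag_eq {u : MvPolynomial (Fin N × Fin N) ℝ}
    (hu : ∀ k ∈ unitSet N, polyComp k u = u) {x : Fin N × Fin N → ℝ} {l : Fin N → ℝ}
    {U : Matrix (Fin N) (Fin N) ℂ} (h : IsEigSys (herm x) l U) (j : Fin N) :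
    eval (dg l) (pderiv (j, j) u) = gradDiag u x U j := by
  rw [pderiv_invariant hu h, gradDiag, qf_eq_sum]
  exact Finset.sum_congr rfl fun i _ => by rw [unitConj_col_diag, mul_comm]; rfl

open MvPolynomial in
/-- The Hessian of a unitarily invariant polynomial controls divided differences of its gradient. -/
lemma sum_gradDiag_div_le {u : MvPolynomial (Fin N × Fin N) ℝ}
    (hu : ∀ k ∈ unitSet N, polyComp k u = u) {x : Fin N × Fin N → ℝ} {l : Fin N → ℝ}
    {U : Matrix (Fin N) (Fin N) ℂ} (h : IsEigSys (herm x) l U) (hl : Function.Injective l) :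
    ∑ j, ∑ k with k ≠ j, ((gradDiag u x U j - gradDiag u x U k) / (l j - l k)) ^ 2 ≤
      ∑ q, ∑ r, eval x (pderiv r (pderiv q u)) ^ 2 := by
  have hk := unitConj_orth h.unit
  have h1 : ∑ q, ∑ r, eval (dg l) (pderiv r (pderiv q u)) ^ 2 =
      ∑ q, ∑ r, eval x (pderiv r (pderiv q u)) ^ 2 := by
    simp_rw [pderiv2_invariant hu h, sum_sq_transpose_mulVec hk]
    rw [Finset.sum_comm]
    simp_rw [sum_sq_transpose_mulVec hk]
    rw [Finset.sum_comm]
  rw [← h1, Fintype.sum_prod_type]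
  refine Finset.sum_le_sum fun j _ => ?_
  refine (Finset.sum_le_sum fun k hk => ?_).trans
    (Finset.sum_le_sum_of_subset_of_nonneg (Finset.filter_subset _ _) fun k _ _ =>
      Finset.sum_nonneg fun _ _ => sq_nonneg _)
  have hjk : j ≠ k := (Finset.mem_filter.1 hk).2.symm
  rw [← gradDiag_eq hu h, ← gradDiag_eq hu h, ← (hess_at_dg hu hjk (hl.ne hjk)).2]
  exact Finset.single_le_sum (f := fun r => eval (dg l) (pderiv r (pderiv (j, k) u)) ^ 2)
    (fun _ _ => sq_nonneg _) (Finset.mem_univ (j, k))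

open MvPolynomial in
lemma sum_gradDiag_sq_le {u : MvPolynomial (Fin N × Fin N) ℝ}
    (hu : ∀ k ∈ unitSet N, polyComp k u = u) {x : Fin N × Fin N → ℝ} {l : Fin N → ℝ}
    {U : Matrix (Fin N) (Fin N) ℂ} (h : IsEigSys (herm x) l U) :
    ∑ j, gradDiag u x U j ^ 2 ≤ ∑ q, polyGrad u x q ^ 2 := by
  have hk := unitConj_orth h.unit
  have h1 := sum_sq_transpose_mulVec hk (polyGrad u x)
  simp only [polyGrad] at h1
  simp_rw [← pderiv_invariant hu h] at h1
  change _ ≤ ∑ i, eval x (pderiv i u) ^ 2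
  rw [← h1, Fintype.sum_prod_type]
  refine Finset.sum_le_sum fun j _ => ?_
  rw [← gradDiag_eq hu h]
  exact Finset.single_le_sum (f := fun r => eval (dg l) (pderiv (j, r) u) ^ 2)
    (fun _ _ => sq_nonneg _) (Finset.mem_univ j)

open MvPolynomial in
/-- The gradient of a unitarily invariant polynomial is diagonal in an eigenbasis. -/
lemma polyGrad_eq_sum {u : MvPolynomial (Fin N × Fin N) ℝ}
    (hu : ∀ k ∈ unitSet N, polyComp k u = u) {x : Fin N × Fin N → ℝ} {l : Fin N → ℝ}
    {U : Matrix (Fin N) (Fin N) ℂ} (h : IsEigSys (herm x) l U) (hl : Function.Injective l) :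
    polyGrad u x = ∑ j, gradDiag u x U j • rk (U.col j) := by
  have hk := unitConj_orth h.unit
  have h1 : (unitConj U).transpose.mulVec (polyGrad u x) = polyGrad u (dg l) := by
    funext q
    exact (pderiv_invariant hu h q).symm
  have h2 : polyGrad u x = (unitConj U).mulVec (polyGrad u (dg l)) := by
    rw [← h1, Matrix.mulVec_mulVec, hk, Matrix.one_mulVec]
  rw [h2]
  funext p
  simp only [Matrix.mulVec, dotProduct, Finset.sum_apply, Pi.smul_apply, smul_eq_mul]
  rw [Fintype.sum_prod_type]
  refine Finset.sum_congr rfl fun j _ => ?_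
  rw [Finset.sum_eq_single j]
  · rw [unitConj_col_diag, ← gradDiag_eq hu h, mul_comm]; rfl
  · intro k _ hkj
    rw [polyGrad, (hess_at_dg hu hkj.symm (hl.ne hkj.symm)).1, mul_zero]
  · simp

end

section
open MvPolynomial
variable {N : ℕ}

lemma measurable_fderiv_comp {κ α : Type*} [Fintype κ] [MeasurableSpace α] {f : (κ → ℝ) → ℝ}
    {g v : α → κ → ℝ} (hg : Measurable g) (hv : Measurable v) :
    Measurable fun x => fderiv ℝ f (g x) (v x) :=
  ContinuousLinearMap.measurable_apply₂.comp (((measurable_fderiv ℝ f).comp hg).prodMk hv)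

lemma memLp_two_of_expBdd {κ : Type*} [Fintype κ] {f : (κ → ℝ) → ℝ} (h : ExpBdd f)
    (hm : AEStronglyMeasurable f (stdGauss κ)) : MemLp f 2 (stdGauss κ) :=
  (memLp_two_iff_integrable_sq hm).2 ((h.pow 2).integrable (hm.pow 2))

lemma memLp_two_of_lipschitz {κ : Type*} [Fintype κ] {f : (κ → ℝ) → ℝ} {K : NNReal}
    (h : LipschitzWith K f) : MemLp f 2 (stdGauss κ) :=
  memLp_two_of_expBdd (ExpBdd.of_lipschitz h) h.continuous.aestronglyMeasurable

/-- The derivative of the `j`-th eigenvalue along a polynomial gradient. -/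
def evGrad (u : MvPolynomial (Fin N × Fin N) ℝ) (j : Fin N) (x : Fin N × Fin N → ℝ) : ℝ :=
  fderiv ℝ (fun x => ev x j) x (polyGrad u x)

lemma measurable_evGrad (u : MvPolynomial (Fin N × Fin N) ℝ) (j : Fin N) :
    Measurable (evGrad u j) :=
  measurable_fderiv_comp measurable_id (continuous_polyGrad u).measurable

lemma evGrad_eq (u : MvPolynomial (Fin N × Fin N) ℝ) {x : Fin N × Fin N → ℝ} (hx : Good x)
    {U : Matrix (Fin N) (Fin N) ℂ} (h : IsEigSys (herm x) (ev x) U) (j : Fin N) :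
    evGrad u j x = gradDiag u x U j := fderiv_ev hx h j _

/-- The quadratic form of divided differences of `evGrad`. -/
def evHess (u : MvPolynomial (Fin N × Fin N) ℝ) (x : Fin N × Fin N → ℝ) : ℝ :=
  ∑ j, ∑ k with k ≠ j, ((evGrad u j x - evGrad u k x) / (ev x j - ev x k)) ^ 2

lemma measurable_evDiv (u : MvPolynomial (Fin N × Fin N) ℝ) (j k : Fin N) :
    Measurable fun x => (evGrad u j x - evGrad u k x) / (ev x j - ev x k) :=
  ((measurable_evGrad u j).sub (measurable_evGrad u k)).div
    ((continuous_ev j).measurable.sub (continuous_ev k).measurable)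

lemma measurable_evHess (u : MvPolynomial (Fin N × Fin N) ℝ) : Measurable (evHess u) :=
  Finset.measurable_fun_sum _ fun j _ => Finset.measurable_fun_sum _ fun k _ =>
    (measurable_evDiv u j k).pow_const 2

lemma evHess_nonneg (u : MvPolynomial (Fin N × Fin N) ℝ) (x : Fin N × Fin N → ℝ) :
    0 ≤ evHess u x :=
  Finset.sum_nonneg fun _ _ => Finset.sum_nonneg fun _ _ => sq_nonneg _

lemma evDiv_sq_le (u : MvPolynomial (Fin N × Fin N) ℝ) {j k : Fin N} (h : j ≠ k)
    (x : Fin N × Fin N → ℝ) :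
    2 * ((evGrad u j x - evGrad u k x) / (ev x j - ev x k)) ^ 2 ≤ evHess u x := by
  have h1 : ∀ i, 0 ≤ ∑ k with k ≠ i, ((evGrad u i x - evGrad u k x) / (ev x i - ev x k)) ^ 2 :=
    fun i => Finset.sum_nonneg fun _ _ => sq_nonneg _
  have h2 : ∀ {a b : Fin N}, a ≠ b → ((evGrad u a x - evGrad u b x) / (ev x a - ev x b)) ^ 2 ≤
      ∑ k with k ≠ a, ((evGrad u a x - evGrad u k x) / (ev x a - ev x k)) ^ 2 := fun {a b} hab =>
    Finset.single_le_sum (f := fun k => ((evGrad u a x - evGrad u k x) / (ev x a - ev x k)) ^ 2)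
      (fun _ _ => sq_nonneg _) (Finset.mem_filter.2 ⟨Finset.mem_univ b, hab.symm⟩)
  have h3 := Finset.sum_le_sum_of_subset_of_nonneg (Finset.subset_univ {j, k}) fun i _ _ => h1 i
  rw [Finset.sum_pair h] at h3
  have h4 := h2 h
  have h5 := h2 h.symm
  rw [← neg_sub (evGrad u j x), ← neg_sub (ev x j), neg_div_neg_eq] at h5
  change _ ≤ evHess u x at h3
  linarith

lemma integrable_poly_sq {κ : Type*} [Fintype κ] (p : MvPolynomial κ ℝ) :
    Integrable (fun x => eval x p ^ 2) (stdGauss κ) := by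
  simpa only [← map_pow] using integrable_poly (p ^ 2)

section
variable {u : MvPolynomial (Fin N × Fin N) ℝ} (hu : ∀ k ∈ unitSet N, polyComp k u = u)
include hu

lemma ae_evHess_le : ∀ᵐ x ∂stdGauss (Fin N × Fin N),
    evHess u x ≤ ∑ q, ∑ r, eval x (pderiv r (pderiv q u)) ^ 2 := by
  filter_upwards [ae_good] with x hx
  obtain ⟨U, h⟩ := exists_sys x
  simp only [evHess, evGrad_eq u hx h]
  exact sum_gradDiag_div_le hu h hx.injective

lemma ae_sum_evGrad_le : ∀ᵐ x ∂stdGauss (Fin N × Fin N),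
    ∑ j, evGrad u j x ^ 2 ≤ ∑ q, polyGrad u x q ^ 2 := by
  filter_upwards [ae_good] with x hx
  obtain ⟨U, h⟩ := exists_sys x
  simp only [evGrad_eq u hx h]
  exact sum_gradDiag_sq_le hu h

lemma integrable_evHess : Integrable (evHess u) (stdGauss (Fin N × Fin N)) := by
  refine Integrable.mono' (g := fun x => ∑ q, ∑ r, eval x (pderiv r (pderiv q u)) ^ 2)
    (integrable_finsetSum _ fun q _ => integrable_finsetSum _ fun r _ => integrable_poly_sq _)
    (measurable_evHess u).aestronglyMeasurable ?_
  filter_upwards [ae_evHess_le hu] with x hx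
  rwa [Real.norm_of_nonneg (evHess_nonneg u x)]

lemma integral_evHess_le :
    ∫ x, evHess u x ∂stdGauss (Fin N × Fin N) ≤
      ∫ x, eval x (ouGen u) ^ 2 ∂stdGauss (Fin N × Fin N) := by
  rw [integral_ouGen_sq]
  have h1 : ∫ x, evHess u x ∂stdGauss (Fin N × Fin N) ≤
      ∫ x, ∑ q, ∑ r, eval x (pderiv r (pderiv q u)) ^ 2 ∂stdGauss (Fin N × Fin N) :=
    integral_mono_ae (integrable_evHess hu)
      (integrable_finsetSum _ fun q _ => integrable_finsetSum _ fun r _ => integrable_poly_sq _)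
      (ae_evHess_le hu)
  have h2 : 0 ≤ ∫ x, ∑ i, polyGrad u x i ^ 2 ∂stdGauss (Fin N × Fin N) :=
    integral_nonneg fun x => Finset.sum_nonneg fun _ _ => sq_nonneg _
  linarith

lemma integrable_sum_evGrad_sq :
    Integrable (fun x => ∑ j, evGrad u j x ^ 2) (stdGauss (Fin N × Fin N)) := by
  refine Integrable.mono' (g := fun x => ∑ q, polyGrad u x q ^ 2)
    (integrable_finsetSum _ fun q _ => integrable_poly_sq _)
    (Finset.measurable_fun_sum _ fun j _ =>
      (measurable_evGrad u j).pow_const 2).aestronglyMeasurable ?_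
  filter_upwards [ae_sum_evGrad_le hu] with x hx
  rwa [Real.norm_of_nonneg (Finset.sum_nonneg fun _ _ => sq_nonneg _)]

lemma integral_sum_evGrad_sq_le :
    ∫ x, ∑ j, evGrad u j x ^ 2 ∂stdGauss (Fin N × Fin N) ≤
      ∫ x, eval x (ouGen u) ^ 2 ∂stdGauss (Fin N × Fin N) := by
  rw [integral_ouGen_sq]
  have h1 : ∫ x, ∑ j, evGrad u j x ^ 2 ∂stdGauss (Fin N × Fin N) ≤
      ∫ x, ∑ i, polyGrad u x i ^ 2 ∂stdGauss (Fin N × Fin N) :=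
    integral_mono_ae (integrable_sum_evGrad_sq hu)
      (integrable_finsetSum _ fun q _ => integrable_poly_sq _) (ae_sum_evGrad_le hu)
  have h2 : 0 ≤ ∫ x, ∑ q, ∑ r, eval x (pderiv r (pderiv q u)) ^ 2 ∂stdGauss (Fin N × Fin N) :=
    integral_nonneg fun x => Finset.sum_nonneg fun _ _ => Finset.sum_nonneg fun _ _ => sq_nonneg _
  linarith

lemma memLp_evDiv {j k : Fin N} (h : j ≠ k) :
    MemLp (fun x => (evGrad u j x - evGrad u k x) / (ev x j - ev x k)) 2
      (stdGauss (Fin N × Fin N)) := by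
  rw [memLp_two_iff_integrable_sq (measurable_evDiv u j k).aestronglyMeasurable]
  refine (integrable_evHess hu).mono' ((measurable_evDiv u j k).pow_const 2).aestronglyMeasurable
    (Filter.Eventually.of_forall fun x => ?_)
  rw [Real.norm_of_nonneg (sq_nonneg _)]
  have := evDiv_sq_le u h x
  nlinarith [sq_nonneg ((evGrad u j x - evGrad u k x) / (ev x j - ev x k))]

lemma memLp_evGrad (j : Fin N) : MemLp (evGrad u j) 2 (stdGauss (Fin N × Fin N)) := by
  rw [memLp_two_iff_integrable_sq (measurable_evGrad u j).aestronglyMeasurable]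
  refine (integrable_sum_evGrad_sq hu).mono' ((measurable_evGrad u j).pow_const 2).aestronglyMeasurable
    (Filter.Eventually.of_forall fun x => ?_)
  rw [Real.norm_of_nonneg (sq_nonneg _)]
  exact Finset.single_le_sum (f := fun j => evGrad u j x ^ 2) (fun _ _ => sq_nonneg _)
    (Finset.mem_univ j)

end

lemma unitSet_orth : ∀ k ∈ unitSet N, k * k.transpose = 1 := by
  rintro k ⟨U, hU, rfl⟩
  exact unitConj_orth hU

lemma memLp_ev (j : Fin N) : MemLp (fun x => ev x j) 2 (stdGauss (Fin N × Fin N)) :=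
  memLp_two_of_lipschitz (ev_lipschitz j)

lemma integrable_ev (j : Fin N) : Integrable (fun x => ev x j) (stdGauss (Fin N × Fin N)) :=
  (memLp_ev j).integrable one_le_two

/-- Gaps between eigenvalues have second moment comparable to the squared mean. -/
theorem integral_gap_sq_le {j k : Fin N} (h : j ≠ k) :
    ∫ x, (ev x j - ev x k) ^ 2 ∂stdGauss (Fin N × Fin N) ≤
      2 * (∫ x, (ev x j - ev x k) ∂stdGauss (Fin N × Fin N)) ^ 2 := by
  set μ := stdGauss (Fin N × Fin N)
  set Δ : (Fin N × Fin N → ℝ) → ℝ := fun x => ev x j - ev x k with hΔ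
  have hΔ2 : MemLp Δ 2 μ := (memLp_ev j).sub (memLp_ev k)
  have hΔi : Integrable Δ μ := hΔ2.integrable one_le_two
  set c := ∫ x, Δ x ∂μ with hc
  have hL : LipschitzWith (evK N + evK N) Δ := (ev_lipschitz j).sub (ev_lipschitz k)
  have hvar : ∫ x, (Δ x - c) ^ 2 ∂μ = ∫ x, Δ x ^ 2 ∂μ - c ^ 2 := by
    have : ∀ x, (Δ x - c) ^ 2 = Δ x ^ 2 - 2 * c * Δ x + c ^ 2 := fun x => by ring
    simp_rw [this]
    rw [integral_add, integral_sub, integral_const_mul, integral_const]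
    · simp [← hc]; ring
    · exact hΔ2.integrable_sq
    · exact hΔi.const_mul _
    · exact hΔ2.integrable_sq.sub (hΔi.const_mul _)
    · exact integrable_const _
  have key : ∫ x, (Δ x - c) ^ 2 ∂μ ≤ (∫ x, Δ x ^ 2 ∂μ) / 2 := by
    refine integral_sq_le_of_ouGen (φ := fun x => Δ x - c) (hΔ2.sub (memLp_const c)) ?_ (unitSet N) unitSet_orth ?_
      (div_nonneg (integral_nonneg fun _ => sq_nonneg _) zero_le_two) ?_
    · rw [integral_sub hΔi (integrable_const _)]; simp [← hc]
    · rintro k ⟨U, hU, rfl⟩ x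
      simp [hΔ, ev_unitConj hU]
    intro u hu
    have e1 : ∫ x, (Δ x - c) * eval x (ouGen u) ∂μ =
        ∫ x, Δ x * ((evGrad u j x - evGrad u k x) / (ev x j - ev x k)) ∂μ := by
      rw [integral_mul_ouGen (hL.sub (LipschitzWith.const c)) u]
      refine integral_congr_ae ?_
      filter_upwards [ae_good] with x hx
      have hne : ev x j - ev x k ≠ 0 := sub_ne_zero.2 (hx.injective.ne h)
      rw [mul_div_cancel₀ _ hne]
      change fderiv ℝ (fun x => ev x j - ev x k - c) x _ = _
      rw [fderiv_sub_const, fderiv_fun_sub (hx j) (hx k)]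
      rfl
    rw [e1]
    refine (integral_mul_sq_le hΔ2 (memLp_evDiv hu h)).trans ?_
    have e2 : ∫ x, ((evGrad u j x - evGrad u k x) / (ev x j - ev x k)) ^ 2 ∂μ ≤
        (∫ x, eval x (ouGen u) ^ 2 ∂μ) / 2 := by
      have := integral_mono (((memLp_evDiv hu h).integrable_sq).const_mul 2) (integrable_evHess hu)
        fun x => evDiv_sq_le u h x
      rw [integral_const_mul] at this
      have h3 := integral_evHess_le hu
      linarith
    have h0 : 0 ≤ ∫ x, Δ x ^ 2 ∂μ := integral_nonneg fun _ => sq_nonneg _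
    calc _ ≤ (∫ x, Δ x ^ 2 ∂μ) * ((∫ x, eval x (ouGen u) ^ 2 ∂μ) / 2) :=
          mul_le_mul_of_nonneg_left e2 h0
      _ = _ := by ring
  linarith

end

section
open Matrix
variable {N : ℕ}

lemma exists_unitary_col {v : Fin N → ℂ} (hv : nsq v = 1) (i : Fin N) :
    ∃ U : Matrix (Fin N) (Fin N) ℂ, Uᴴ * U = 1 ∧ U.col i = v := by
  have hin : ∀ a b : EuclideanSpace ℂ (Fin N), inner ℂ a b = star (a : Fin N → ℂ) ⬝ᵥ (b : Fin N → ℂ) := by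
    intro a b
    simp [PiLp.inner_apply, dotProduct, mul_comm]
  have ho : Orthonormal ℂ (({i} : Set (Fin N)).domRestrict
      fun _ : Fin N => (WithLp.toLp 2 v : EuclideanSpace ℂ (Fin N))) := by
    rw [orthonormal_iff_ite]
    rintro ⟨a, rfl⟩ ⟨b, hb⟩
    have hb' : b = a := hb
    subst hb'
    simp only [Set.domRestrict_apply, if_true]
    rw [hin]
    exact (nsq_eq v).trans (by rw [hv]; simp)
  obtain ⟨b, hb⟩ := ho.exists_orthonormalBasis_extension_of_card_eq (by simp)
  refine ⟨Matrix.of fun a j => b j a, ?_, ?_⟩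
  · ext j k
    have := orthonormal_iff_ite.1 b.orthonormal j k
    rw [hin] at this
    rw [Matrix.mul_apply, Matrix.one_apply]
    exact this
  · ext a
    exact congrArg (fun w : EuclideanSpace ℂ (Fin N) => w a) (hb i rfl)

/-- The complex vector with given real and imaginary parts. -/
def zv (s : Fin N × Fin 2 → ℝ) : Fin N → ℂ := fun i => ⟨s (i, 0), s (i, 1)⟩

lemma zv_add (s t : Fin N × Fin 2 → ℝ) : zv (s + t) = zv s + zv t := by
  ext i; simp [zv, Complex.ext_iff]

lemma zv_smul (c : ℝ) (s : Fin N × Fin 2 → ℝ) : zv (c • s) = (c : ℂ) • zv s := by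
  ext i; simp [zv, Complex.ext_iff]

lemma normSq_zv (s : Fin N × Fin 2 → ℝ) (i : Fin N) :
    Complex.normSq (zv s i) = s (i, 0) ^ 2 + s (i, 1) ^ 2 := by
  simp [zv, Complex.normSq_mk, sq]

lemma nsq_zv (s : Fin N × Fin 2 → ℝ) : nsq (zv s) = ∑ p, s p ^ 2 := by
  simp [nsq, normSq_zv, Fintype.sum_prod_type]

/-- The real form of a complex linear map. -/
def zLin (V : Matrix (Fin N) (Fin N) ℂ) : (Fin N × Fin 2 → ℝ) →ₗ[ℝ] (Fin N × Fin 2 → ℝ) where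
  toFun s p := if p.2 = 0 then ((V *ᵥ zv s) p.1).re else ((V *ᵥ zv s) p.1).im
  map_add' s t := by
    ext p; simp only [zv_add, Matrix.mulVec_add, Pi.add_apply, Complex.add_re, Complex.add_im]
    split_ifs <;> rfl
  map_smul' c s := by
    ext p
    simp only [zv_smul, Matrix.mulVec_smul, Pi.smul_apply, smul_eq_mul, Complex.re_ofReal_mul,
      Complex.im_ofReal_mul, RingHom.id_apply]
    split_ifs <;> rfl

lemma zv_zLin (V : Matrix (Fin N) (Fin N) ℂ) (s : Fin N × Fin 2 → ℝ) :
    zv (zLin V s) = V *ᵥ zv s := by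
  ext i; apply Complex.ext <;> simp [zv, zLin]

lemma re_dot_zv (t s : Fin N × Fin 2 → ℝ) : ∑ p, t p * s p = (star (zv t) ⬝ᵥ zv s).re := by
  simp [Fintype.sum_prod_type, dotProduct, zv]

lemma sum_zLin_single_sq {V : Matrix (Fin N) (Fin N) ℂ} (hV : Vᴴ * V = 1)
    (t : Fin N × Fin 2 → ℝ) :
    ∑ i, (∑ j, t j * zLin V (Pi.single i 1) j) ^ 2 = ∑ j, t j ^ 2 := by
  have hV' : Vᴴᴴ * Vᴴ = 1 := by rw [conjTranspose_conjTranspose]; exact mul_eq_one_comm.1 hV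
  have h1 : ∀ i, ∑ j, t j * zLin V (Pi.single i 1) j = zLin Vᴴ t i := by
    intro i
    rw [re_dot_zv, zv_zLin, Matrix.dotProduct_mulVec]
    have h2 : star (zv t) ᵥ* V = star (zv (zLin Vᴴ t)) := by
      rw [zv_zLin, Matrix.star_mulVec, conjTranspose_conjTranspose]
    rw [h2, ← re_dot_zv]
    simp [Pi.single_apply]
  simp_rw [h1]
  rw [← nsq_zv, ← nsq_zv, zv_zLin, nsq_mulVec hV']

lemma stdGauss_map_zLin {V : Matrix (Fin N) (Fin N) ℂ} (hV : Vᴴ * V = 1) :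
    (stdGauss (Fin N × Fin 2)).map (zLin V) = stdGauss (Fin N × Fin 2) :=
  stdGauss_map_linear _ (sum_zLin_single_sq hV)

lemma continuous_zv : Continuous (zv : (Fin N × Fin 2 → ℝ) → Fin N → ℂ) := by
  refine continuous_pi fun i => ?_
  have : (fun s : Fin N × Fin 2 → ℝ => zv s i) =
      fun s => (s (i, 0) : ℂ) + s (i, 1) * Complex.I := by
    ext s; simp [zv, Complex.ext_iff]
  rw [this]; fun_prop

/-- Unitary invariance of the complex Gaussian vector. -/
lemma integral_zv_mulVec {V : Matrix (Fin N) (Fin N) ℂ} (hV : Vᴴ * V = 1) {F : (Fin N → ℂ) → ℝ}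
    (hF : Measurable F) :
    ∫ s, F (V *ᵥ zv s) ∂stdGauss (Fin N × Fin 2) = ∫ s, F (zv s) ∂stdGauss (Fin N × Fin 2) := by
  conv_rhs => rw [← stdGauss_map_zLin hV]
  rw [integral_map (zLin V).continuous_of_finiteDimensional.measurable.aemeasurable]
  · simp_rw [zv_zLin]
  · exact (hF.comp continuous_zv.measurable).aestronglyMeasurable

/-- The fourth moment of a standard Gaussian. -/
def gaussFour : ℝ := ∫ t, t ^ 4 ∂gaussianReal 0 1

lemma gaussFour_nonneg : 0 ≤ gaussFour := integral_nonneg fun t => by positivity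

lemma integral_coord_pow_four {κ : Type*} [Fintype κ] (i : κ) :
    ∫ x, x i ^ 4 ∂stdGauss κ = gaussFour := by
  have h := measurePreserving_eval (fun _ : κ => gaussianReal 0 1) i
  rw [gaussFour, ← h.map_eq, integral_map h.measurable.aemeasurable (by fun_prop)]
  rfl

lemma integral_coord_sq {κ : Type*} [Fintype κ] (i : κ) :
    ∫ x, x i ^ 2 ∂stdGauss κ = 1 := by
  have h := measurePreserving_eval (fun _ : κ => gaussianReal 0 1) i
  have h2 : ∫ t, t ^ 2 ∂gaussianReal 0 1 = 1 := by
    have := variance_id_gaussianReal (μ := 0) (v := 1)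
    rw [variance_eq_sub (memLp_id_gaussianReal 2)] at this
    simpa using this
  rw [← h2, ← h.map_eq, integral_map h.measurable.aemeasurable (by fun_prop)]
  rfl

lemma integrable_coord_pow {κ : Type*} [Fintype κ] (i : κ) (n : ℕ) :
    Integrable (fun x : κ → ℝ => x i ^ n) (stdGauss κ) :=
  ((ExpBdd.coord i).pow n).integrable (by
    exact ((continuous_apply i).pow n).aestronglyMeasurable)

lemma integrable_dot_zv (u : Fin N → ℂ) (n : ℕ) :
    Integrable (fun s => Complex.normSq (star u ⬝ᵥ zv s) ^ n) (stdGauss (Fin N × Fin 2)) := by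
  refine ExpBdd.integrable (ExpBdd.pow ?_ n) ?_
  · have : ∀ s, Complex.normSq (star u ⬝ᵥ zv s) ≤ (∑ p, |rk u p|) * ∑ p, s p ^ 2 := by
      intro s
      rw [← nsq_zv, ← qf_rk]
      exact (le_abs_self _).trans (abs_qf_le (rk u) (zv s))
    refine ((ExpBdd.const (∑ p, |rk u p|)).mul (ExpBdd.sum Finset.univ fun p _ =>
      (ExpBdd.coord p).pow 2)).mono fun s => ?_
    rw [abs_of_nonneg (Complex.normSq_nonneg _)]
    exact (this s).trans (le_abs_self _)
  · have := continuous_zv (N := N)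
    refine Continuous.aestronglyMeasurable ?_
    simp only [dotProduct]
    have h : ∀ i, Continuous fun s : Fin N × Fin 2 → ℝ => zv s i := fun i =>
      (continuous_apply i).comp this
    exact (Complex.continuous_normSq.comp
      (continuous_finsetSum _ fun i _ => continuous_const.mul (h i))).pow n

lemma integral_dot_zv_sq_le {u : Fin N → ℂ} (hu : nsq u = 1) :
    ∫ s, Complex.normSq (star u ⬝ᵥ zv s) ^ 2 ∂stdGauss (Fin N × Fin 2) ≤ 4 * gaussFour := by
  cases N with
  | zero => simp [nsq] at hu
  | succ n =>
  obtain ⟨V, hV, hVu⟩ := exists_unitary_col hu 0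
  have h1 : ∀ z, star u ⬝ᵥ V *ᵥ z = z 0 := by
    intro z
    have : star u ᵥ* V = Pi.single 0 1 := by
      ext j
      have := congrFun (congrFun hV 0) j
      rw [← hVu]
      refine Eq.trans ?_ (this.trans ?_)
      · rfl
      · simp [Matrix.one_apply, Pi.single_apply, eq_comm]
    rw [Matrix.dotProduct_mulVec, this]; simp
  have hm : Measurable fun z : Fin (n + 1) → ℂ => Complex.normSq (star u ⬝ᵥ z) ^ 2 := by
    refine Continuous.measurable ?_
    simp only [dotProduct]
    exact (Complex.continuous_normSq.comp (by fun_prop)).pow 2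
  rw [← integral_zv_mulVec hV hm]
  simp_rw [h1, normSq_zv]
  have h2 : ∀ s : Fin (n + 1) × Fin 2 → ℝ, (s (0, 0) ^ 2 + s (0, 1) ^ 2) ^ 2 ≤
      2 * (s (0, 0) ^ 4 + s (0, 1) ^ 4) := fun s => by
    nlinarith [sq_nonneg (s (0, 0) ^ 2 - s (0, 1) ^ 2)]
  refine (integral_mono_of_nonneg (Filter.Eventually.of_forall fun s => sq_nonneg _)
    (((integrable_coord_pow _ 4).add (integrable_coord_pow _ 4)).const_mul 2)
    (Filter.Eventually.of_forall h2)).trans ?_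
  rw [integral_const_mul, integral_add' (integrable_coord_pow _ 4) (integrable_coord_pow _ 4),
    integral_coord_pow_four, integral_coord_pow_four]
  linarith

lemma integral_nsq_zv : ∫ s, nsq (zv s) ∂stdGauss (Fin N × Fin 2) = 2 * N := by
  simp_rw [nsq_zv]
  rw [integral_finsetSum _ fun p _ => integrable_coord_pow p 2]
  simp [integral_coord_sq, mul_comm]

lemma integrable_nsq_zv (n : ℕ) :
    Integrable (fun s => nsq (zv s) ^ n) (stdGauss (Fin N × Fin 2)) := by
  simp_rw [nsq_zv]
  exact ((ExpBdd.sum Finset.univ fun p _ => (ExpBdd.coord p).pow 2).pow n).integrable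
    (Continuous.aestronglyMeasurable (by fun_prop))

lemma le_integral_nsq_zv_sq :
    4 * (N : ℝ) ^ 2 ≤ ∫ s, nsq (zv s) ^ 2 ∂stdGauss (Fin N × Fin 2) := by
  have h : ∀ s : Fin N × Fin 2 → ℝ,
      4 * (N : ℝ) * nsq (zv s) - 4 * (N : ℝ) ^ 2 ≤ nsq (zv s) ^ 2 := fun s => by
    nlinarith [sq_nonneg (nsq (zv s) - 2 * N)]
  have hi := integrable_nsq_zv (N := N) 1
  simp only [pow_one] at hi
  have h2 := integral_mono ((hi.const_mul (4 * (N : ℝ))).sub (integrable_const (4 * (N : ℝ) ^ 2)))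
    (integrable_nsq_zv 2) h
  have e : ∫ s, (4 * (N : ℝ) * nsq (zv s) - 4 * (N : ℝ) ^ 2) ∂stdGauss (Fin N × Fin 2) =
      4 * (N : ℝ) ^ 2 := by
    rw [integral_sub (hi.const_mul _) (integrable_const _), integral_const_mul, integral_nsq_zv]
    simp; ring
  have e' := h2
  change ∫ s, (4 * (N : ℝ) * nsq (zv s) - 4 * (N : ℝ) ^ 2) ∂stdGauss (Fin N × Fin 2) ≤ _ at e'
  rwa [e] at e'

end

section
open Matrix
variable {N : ℕ}

lemma fderiv_ev_unitConj {U : Matrix (Fin N) (Fin N) ℂ} (hU : Uᴴ * U = 1) (j : Fin N)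
    (x d : Fin N × Fin N → ℝ) :
    fderiv ℝ (fun x => ev x j) ((unitConj U).mulVec x) ((unitConj U).mulVec d) =
      fderiv ℝ (fun x => ev x j) x d := by
  have hk := unitConj_orth hU
  let e : (Fin N × Fin N → ℝ) ≃L[ℝ] (Fin N × Fin N → ℝ) :=
    (Matrix.toLin'OfInv (mul_eq_one_comm.1 hk) hk).toContinuousLinearEquiv
  have h1 := e.comp_right_fderiv (f := fun x => ev x j) (x := x)
  have h2 : (fun x => ev x j) ∘ e = fun x => ev x j := by
    ext y
    exact congrFun (ev_unitConj hU y) j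
  rw [h2] at h1
  rw [h1]
  rfl

lemma rk_mulVec (U : Matrix (Fin N) (Fin N) ℂ) (w : Fin N → ℂ) :
    rk (U *ᵥ w) = (unitConj U).mulVec (rk w) := by
  rw [unitConj_mulVec, rk, rk, herm_coordH (isHermitian_vecMulVec w), Matrix.mul_vecMulVec,
    Matrix.vecMulVec_mul, Matrix.star_mulVec]

lemma rk_smul (c : ℝ) (w : Fin N → ℂ) : rk ((c : ℂ) • w) = c ^ 2 • rk w := by
  rw [rk, rk, ← coordH_smul]
  congr 1
  ext i j
  simp [vecMulVec_apply, sq]; ring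

lemma rk_single_last : rk (Pi.single (Fin.last N) 1 : Fin (N + 1) → ℂ) = eLast N := by
  ext ⟨a, b⟩
  by_cases ha : a = Fin.last N <;> by_cases hb : b = Fin.last N <;>
    simp [rk, coordH, vecMulVec_apply, eLast, Pi.single_apply, ha, hb, Ne.symm, Prod.ext_iff, eq_comm]

lemma exists_rk_eq (z : Fin (N + 1) → ℂ) : ∃ U : Matrix (Fin (N + 1)) (Fin (N + 1)) ℂ,
    Uᴴ * U = 1 ∧ rk z = (unitConj U).mulVec (nsq z • eLast N) := by
  by_cases hz : z = 0
  · refine ⟨1, by simp, ?_⟩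
    subst hz
    have : nsq (0 : Fin (N + 1) → ℂ) = 0 := by simp [nsq]
    rw [this]
    ext ⟨a, b⟩
    simp [rk, coordH, vecMulVec_apply]
  have hr := nsq_pos hz
  have hs : Real.sqrt (nsq z) ≠ 0 := (Real.sqrt_pos.2 hr).ne'
  set v : Fin (N + 1) → ℂ := ((Real.sqrt (nsq z))⁻¹ : ℝ) • z with hv
  have hv' : v = (((Real.sqrt (nsq z))⁻¹ : ℝ) : ℂ) • z := by
    ext i; simp [hv]
  have hv1 : nsq v = 1 := by
    rw [hv']
    simp only [nsq, Pi.smul_apply, smul_eq_mul, Complex.normSq_mul, ← Finset.mul_sum,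
      Complex.normSq_ofReal]
    have e : ∑ a, Complex.normSq (z a) = nsq z := rfl
    rw [e, ← mul_inv, Real.mul_self_sqrt hr.le, inv_mul_cancel₀ hr.ne']
  have hz2 : z = ((Real.sqrt (nsq z) : ℝ) : ℂ) • v := by
    rw [hv', smul_smul, ← Complex.ofReal_mul, mul_inv_cancel₀ hs]; simp
  obtain ⟨U, hU, hc⟩ := exists_unitary_col hv1 (Fin.last N)
  refine ⟨U, hU, ?_⟩
  have hUv : v = U *ᵥ Pi.single (Fin.last N) 1 := by
    rw [Matrix.mulVec_single_one, hc]
  conv_lhs => rw [hz2]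
  rw [rk_smul, Real.sq_sqrt hr.le, hUv, rk_mulVec, rk_single_last, Matrix.mulVec_smul]

/-- The squared modulus of the last entry of the `j`-th eigenvector. -/
def evLast (j : Fin (N + 1)) (x : Fin (N + 1) × Fin (N + 1) → ℝ) : ℝ :=
  fderiv ℝ (fun x => ev x j) x (eLast N)

lemma measurable_evLast (j : Fin (N + 1)) : Measurable (evLast j) :=
  measurable_fderiv_apply_const ℝ _ _

lemma evLast_eq {j : Fin (N + 1)} {x : Fin (N + 1) × Fin (N + 1) → ℝ} (hx : Good x)
    {U : Matrix (Fin (N + 1)) (Fin (N + 1)) ℂ} (h : IsEigSys (herm x) (ev x) U) :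
    evLast j x = Complex.normSq (U (Fin.last N) j) := by
  rw [evLast, fderiv_ev hx h, qf_eLast]; rfl

lemma continuous_rk : Continuous (rk : (Fin N → ℂ) → Fin N × Fin N → ℝ) := by
  refine continuous_pi fun p => ?_
  have h : ∀ a b : Fin N, Continuous fun w : Fin N → ℂ => w a * star (w b) := fun a b => by fun_prop
  simp only [rk, coordH, vecMulVec_apply, Pi.star_apply]
  split_ifs
  · exact Complex.continuous_re.comp (h _ _)
  · exact continuous_const.mul (Complex.continuous_re.comp (h _ _))
  · exact continuous_const.mul (Complex.continuous_im.comp (h _ _))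

lemma norm_rk_le (w : Fin N → ℂ) : ‖rk w‖ ≤ nsq w := by
  rw [pi_norm_le_iff_of_nonneg (nsq_nonneg w)]
  intro p
  rw [Real.norm_eq_abs]
  refine abs_le_of_sq_le_sq ?_ (nsq_nonneg w)
  rw [← sum_rk_sq]
  exact Finset.single_le_sum (f := fun p => rk w p ^ 2) (fun _ _ => sq_nonneg _) (Finset.mem_univ p)

lemma abs_fderiv_ev_rk_le (j : Fin N) (x : Fin N × Fin N → ℝ) (w : Fin N → ℂ) :
    |fderiv ℝ (fun x => ev x j) x (rk w)| ≤ evK N * nsq w :=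
  (abs_fderiv_le_of_lipschitz (ev_lipschitz j) _ _).trans
    (mul_le_mul_of_nonneg_left (norm_rk_le w) (NNReal.coe_nonneg _))

/-- Unitary invariance of the joint law of eigenvector entries and quadratic forms. -/
lemma integral_fderiv_rk (z : Fin (N + 1) → ℂ) {G : (Fin (N + 1) → ℝ) × ℝ → ℝ}
    (hG : Measurable G) :
    ∫ x, G (fun j => fderiv ℝ (fun x => ev x j) x (rk z), qf x z)
        ∂stdGauss (Fin (N + 1) × Fin (N + 1)) =
      ∫ x, G (fun j => nsq z * evLast j x, nsq z * x (Fin.last N, Fin.last N))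
        ∂stdGauss (Fin (N + 1) × Fin (N + 1)) := by
  obtain ⟨U, hU, h⟩ := exists_rk_eq z
  have hk := unitConj_orth hU
  rw [← integral_comp_mulVec hk]
  · congr 1
    ext x
    congr 2
    · ext j
      rw [h, fderiv_ev_unitConj hU, map_smul]; rfl
    · have h1 : ∀ y, qf y z = y ⬝ᵥ rk z := fun y => qf_eq_sum y z
      rw [h1, h, ← Matrix.vecMul_transpose, ← Matrix.dotProduct_mulVec, Matrix.mulVec_mulVec,
        mul_eq_one_comm.1 hk, Matrix.one_mulVec]
      simp [eLast, mul_comm]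
  · refine (hG.comp (Measurable.prodMk (measurable_pi_iff.2 fun j =>
      measurable_fderiv_apply_const ℝ _ _) ?_)).aestronglyMeasurable
    simp only [qf_eq_sum]
    fun_prop

lemma measurable_fderiv_rk_zv (j : Fin N) :
    Measurable fun q : (Fin N × Fin N → ℝ) × (Fin N × Fin 2 → ℝ) =>
      fderiv ℝ (fun x => ev x j) q.1 (rk (zv q.2)) :=
  measurable_fderiv_comp measurable_fst
    ((continuous_rk.comp continuous_zv).measurable.comp measurable_snd)

lemma measurable_nsq : Measurable (nsq : (Fin N → ℂ) → ℝ) := by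
  refine Continuous.measurable ?_
  unfold nsq
  exact continuous_finsetSum _ fun i _ => Complex.continuous_normSq.comp (continuous_apply i)

theorem integral_evLast_sq_le (j : Fin (N + 1)) :
    ∫ x, evLast j x ^ 2 ∂stdGauss (Fin (N + 1) × Fin (N + 1)) ≤
      gaussFour / ((N : ℝ) + 1) ^ 2 := by
  set μ := stdGauss (Fin (N + 1) × Fin (N + 1))
  set ν := stdGauss (Fin (N + 1) × Fin 2)
  set F : (Fin (N + 1) × Fin (N + 1) → ℝ) × (Fin (N + 1) × Fin 2 → ℝ) → ℝ := fun q =>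
    fderiv ℝ (fun x => ev x j) q.1 (rk (zv q.2)) ^ 2 with hF
  have hi : Integrable F (μ.prod ν) := by
    refine Integrable.mono' (((integrable_nsq_zv 2).const_mul ((evK (N + 1) : ℝ) ^ 2)).comp_snd μ)
      ((measurable_fderiv_rk_zv j).pow_const 2).aestronglyMeasurable
      (Filter.Eventually.of_forall fun q => ?_)
    rw [hF, Real.norm_of_nonneg (sq_nonneg _), ← mul_pow, ← sq_abs]
    exact pow_le_pow_left₀ (abs_nonneg _) (abs_fderiv_ev_rk_le j _ _) 2
  have h1 : ∫ q, F q ∂μ.prod ν = (∫ s, nsq (zv s) ^ 2 ∂ν) * ∫ x, evLast j x ^ 2 ∂μ := by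
    rw [integral_prod_symm _ hi, ← integral_mul_const]
    congr 1
    ext s
    have := integral_fderiv_rk (zv s) (G := fun q => q.1 j ^ 2)
      (((measurable_pi_apply j).comp measurable_fst).pow_const 2)
    rw [hF]
    refine this.trans ?_
    simp only [mul_pow, integral_const_mul]; rfl
  have h2 : ∫ q, F q ∂μ.prod ν ≤ 4 * gaussFour := by
    rw [integral_prod _ hi]
    have : ∀ᵐ x ∂μ, ∫ s, F (x, s) ∂ν ≤ 4 * gaussFour := by
      filter_upwards [ae_good] with x hx
      obtain ⟨U, h⟩ := exists_sys x
      refine le_trans (le_of_eq ?_) (integral_dot_zv_sq_le (h.nsq_col j))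
      congr 1
      ext s
      rw [hF]
      simp only
      rw [fderiv_ev hx h, qf_rk, Matrix.star_dotProduct, ← Complex.normSq_conj]
      simp
    refine (integral_mono_ae hi.integral_prod_left (integrable_const _) this).trans ?_
    simp [μ]
  have h3 := le_integral_nsq_zv_sq (N := N + 1)
  have h4 : 0 ≤ ∫ x, evLast j x ^ 2 ∂μ := integral_nonneg fun _ => sq_nonneg _
  have h5 := mul_le_mul_of_nonneg_right h3 h4
  rw [le_div_iff₀ (by positivity)]
  push_cast at h5
  change _ ≤ (∫ s, nsq (zv s) ^ 2 ∂ν) * _ at h5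
  nlinarith

/-- Averaged over directions, the larger of two eigenvalues is more correlated with the quadratic
form. -/
lemma integral_dot_zv_exp_nonneg {x : Fin N × Fin N → ℝ} {U : Matrix (Fin N) (Fin N) ℂ}
    (h : IsEigSys (herm x) (ev x) U) {j l : Fin N} (hjl : j ≤ l) {t : ℝ} (ht : 0 ≤ t)
    (hi : Integrable (fun s => (Complex.normSq (star (U.col l) ⬝ᵥ zv s) -
      Complex.normSq (star (U.col j) ⬝ᵥ zv s)) * Real.exp (-t * (qf x (zv s) / nsq (zv s))))
      (stdGauss (Fin N × Fin 2))) :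
    0 ≤ ∫ s, (Complex.normSq (star (U.col l) ⬝ᵥ zv s) -
      Complex.normSq (star (U.col j) ⬝ᵥ zv s)) * Real.exp (-t * (qf x (zv s) / nsq (zv s)))
      ∂stdGauss (Fin N × Fin 2) := by
  set F : (Fin N → ℂ) → ℝ := fun z => (Complex.normSq (star (U.col l) ⬝ᵥ z) -
      Complex.normSq (star (U.col j) ⬝ᵥ z)) * Real.exp (-t * (qf x z / nsq z)) with hF
  have hFm : Measurable F := by
    have h1 : ∀ i, Measurable fun z : Fin N → ℂ => Complex.normSq (star (U.col i) ⬝ᵥ z) := by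
      intro i
      refine Continuous.measurable ?_
      simp only [dotProduct]
      exact Complex.continuous_normSq.comp (by fun_prop)
    have h2 : Measurable fun z : Fin N → ℂ => qf x z := by
      simp only [qf_eq_sum]
      have := fun p => (measurable_pi_apply p).comp (continuous_rk (N := N)).measurable
      exact Finset.measurable_fun_sum _ fun p _ => (this p).const_mul _
    exact ((h1 l).sub (h1 j)).mul
      (Real.measurable_exp.comp ((h2.div measurable_nsq).const_mul (-t)))
  set σ := Equiv.swap l j with hσ
  set V : Matrix (Fin N) (Fin N) ℂ := U * (U.submatrix id σ)ᴴ with hV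
  have hU' : (U.submatrix id σ)ᴴ * U.submatrix id σ = 1 := by
    ext a b
    have := congrFun (congrFun h.unit (σ a)) (σ b)
    rw [Matrix.one_apply] at this ⊢
    simp only [σ.injective.eq_iff] at this
    rw [← this]; rfl
  have hVV : Vᴴ * V = 1 := by
    rw [hV, conjTranspose_mul, conjTranspose_conjTranspose, Matrix.mul_assoc, ← Matrix.mul_assoc Uᴴ,
      h.unit, Matrix.one_mul]
    exact mul_eq_one_comm.1 hU'
  have hdot : ∀ i z, star (U.col i) ⬝ᵥ V *ᵥ z = star (U.col (σ i)) ⬝ᵥ z := by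
    intro i z
    have e : Uᴴ *ᵥ (V *ᵥ z) = (U.submatrix id σ)ᴴ *ᵥ z := by
      rw [Matrix.mulVec_mulVec, hV, ← Matrix.mul_assoc, h.unit, Matrix.one_mul]
    exact congrFun e i
  have key : ∀ z, 0 ≤ F z + F (V *ᵥ z) := by
    intro z
    set n : Fin N → ℝ := fun i => Complex.normSq (star (U.col i) ⬝ᵥ z) with hn
    have e1 : F (V *ᵥ z) = -((n l - n j) * Real.exp (-t * (qf x (V *ᵥ z) / nsq z))) := by
      simp only [hF, hdot, nsq_mulVec hVV, hn]
      rw [hσ, Equiv.swap_apply_left, Equiv.swap_apply_right]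
      ring
    have e2 : qf x (V *ᵥ z) - qf x z = (ev x j - ev x l) * (n l - n j) := by
      rw [h.qf_eq, h.qf_eq]
      simp only [hdot]
      have e3 : ∑ i, ev x i * Complex.normSq (star (U.col (σ i)) ⬝ᵥ z) = ∑ i, ev x (σ i) * n i := by
        rw [← Equiv.sum_comp σ]
        refine Finset.sum_congr rfl fun i _ => ?_
        simp [hσ, hn]
      rw [e3, ← Finset.sum_sub_distrib]
      by_cases hlj : l = j
      · subst hlj; simp [hσ, hn]
      rw [← Finset.sum_subset (Finset.subset_univ {l, j}), Finset.sum_pair hlj]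
      · simp [hσ, hn]; ring
      · intro i _ hi
        simp only [Finset.mem_insert, Finset.mem_singleton, not_or] at hi
        rw [hσ, Equiv.swap_apply_of_ne_of_ne hi.1 hi.2]
        simp [hn]
    have hz := nsq_nonneg z
    have hev : 0 ≤ ev x j - ev x l := sub_nonneg.2 (h.anti hjl)
    have e4 : F z = (n l - n j) * Real.exp (-t * (qf x z / nsq z)) := rfl
    rw [e1, e4, ← sub_eq_add_neg, ← mul_sub]
    rcases le_total (n j) (n l) with hc | hc
    · refine mul_nonneg (sub_nonneg.2 hc) (sub_nonneg.2 (Real.exp_le_exp.2 ?_))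
      have h1 : qf x z ≤ qf x (V *ᵥ z) := by
        have := mul_nonneg hev (sub_nonneg.2 hc); linarith
      have := mul_le_mul_of_nonneg_left (div_le_div_of_nonneg_right h1 hz) ht
      linarith
    · refine mul_nonneg_of_nonpos_of_nonpos (sub_nonpos.2 hc)
        (sub_nonpos.2 (Real.exp_le_exp.2 ?_))
      have h1 : qf x (V *ᵥ z) ≤ qf x z := by
        have := mul_nonneg hev (sub_nonneg.2 hc); linarith
      have := mul_le_mul_of_nonneg_left (div_le_div_of_nonneg_right h1 hz) ht
      linarith
  have hI := integral_zv_mulVec hVV hFm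
  have hi2 : Integrable (fun s => F (V *ᵥ zv s)) (stdGauss (Fin N × Fin 2)) := by
    have hmp : MeasurePreserving (zLin V) (stdGauss (Fin N × Fin 2)) (stdGauss (Fin N × Fin 2)) :=
      ⟨(zLin V).continuous_of_finiteDimensional.measurable, stdGauss_map_zLin hVV⟩
    have := hmp.integrable_comp_of_integrable hi
    refine this.congr (Filter.Eventually.of_forall fun s => ?_)
    simp only [Function.comp, zv_zLin]; rfl
  have h2 : 0 ≤ ∫ s, F (zv s) ∂stdGauss (Fin N × Fin 2) +
      ∫ s, F (V *ᵥ zv s) ∂stdGauss (Fin N × Fin 2) := by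
    rw [← integral_add hi hi2]
    exact integral_nonneg fun s => key (zv s)
  rw [hI] at h2
  change 0 ≤ ∫ s, F (zv s) ∂stdGauss (Fin N × Fin 2)
  linarith

/-- The exponentially tilted mean of `evLast` is monotone in the index. -/
theorem integral_evLast_exp_nonneg {j l : Fin (N + 1)} (hjl : j ≤ l) {t : ℝ} (ht : 0 ≤ t) :
    0 ≤ ∫ x, (evLast l x - evLast j x) * Real.exp (-t * x (Fin.last N, Fin.last N))
      ∂stdGauss (Fin (N + 1) × Fin (N + 1)) := by
  set μ := stdGauss (Fin (N + 1) × Fin (N + 1))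
  set ν := stdGauss (Fin (N + 1) × Fin 2)
  set F : (Fin (N + 1) × Fin (N + 1) → ℝ) × (Fin (N + 1) × Fin 2 → ℝ) → ℝ := fun q =>
    (fderiv ℝ (fun x => ev x l) q.1 (rk (zv q.2)) - fderiv ℝ (fun x => ev x j) q.1 (rk (zv q.2))) *
      Real.exp (-t * (qf q.1 (zv q.2) / nsq (zv q.2))) with hF
  have hqm : Measurable fun q : (Fin (N + 1) × Fin (N + 1) → ℝ) × (Fin (N + 1) × Fin 2 → ℝ) =>
      qf q.1 (zv q.2) := by
    simp only [qf_eq_sum]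
    have := fun p => ((measurable_pi_apply p).comp (continuous_rk (N := N + 1)).measurable).comp
      (continuous_zv.measurable.comp (measurable_snd :
        Measurable (Prod.snd : (Fin (N + 1) × Fin (N + 1) → ℝ) × (Fin (N + 1) × Fin 2 → ℝ) → _)))
    exact Finset.measurable_fun_sum _ fun p _ =>
      ((measurable_pi_apply p).comp measurable_fst).mul (this p)
  have hFm : Measurable F :=
    ((measurable_fderiv_rk_zv l).sub (measurable_fderiv_rk_zv j)).mul (Real.measurable_exp.comp
      ((hqm.div (measurable_nsq.comp (continuous_zv.measurable.comp measurable_snd))).const_mul _))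
  have hi : Integrable F (μ.prod ν) := by
    refine Integrable.mono' (((integrable_exp_sum_abs t).mul_prod
      ((integrable_nsq_zv 1).const_mul (2 * (evK (N + 1) : ℝ)))))
      hFm.aestronglyMeasurable (Filter.Eventually.of_forall fun q => ?_)
    rw [hF, Real.norm_eq_abs, abs_mul, Real.abs_exp, mul_comm, pow_one]
    have h1 := abs_fderiv_ev_rk_le l q.1 (zv q.2)
    have h2 := abs_fderiv_ev_rk_le j q.1 (zv q.2)
    refine mul_le_mul (Real.exp_le_exp.2 ?_) ?_ (abs_nonneg _) (Real.exp_pos _).le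
    · have h3 := abs_qf_le q.1 (zv q.2)
      have h4 : |qf q.1 (zv q.2) / nsq (zv q.2)| ≤ ∑ p, |q.1 p| := by
        rw [abs_div, abs_of_nonneg (nsq_nonneg _)]
        exact div_le_of_le_mul₀ (nsq_nonneg _) (Finset.sum_nonneg fun _ _ => abs_nonneg _) h3
      have := mul_le_mul_of_nonneg_left ((neg_le_abs _).trans h4) ht
      linarith
    · refine (abs_sub _ _).trans ?_
      linarith
  have h1 : ∫ q, F q ∂μ.prod ν = (∫ s, nsq (zv s) ∂ν) *
      ∫ x, (evLast l x - evLast j x) * Real.exp (-t * x (Fin.last N, Fin.last N)) ∂μ := by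
    rw [integral_prod_symm _ hi, ← integral_mul_const]
    congr 1
    ext s
    have := integral_fderiv_rk (zv s)
      (G := fun q => (q.1 l - q.1 j) * Real.exp (-t * (q.2 / nsq (zv s)))) (by fun_prop)
    rw [hF]
    refine this.trans ?_
    rw [← integral_const_mul]
    congr 1
    ext x
    simp only
    by_cases hz : nsq (zv s) = 0
    · simp [hz]
    · rw [mul_div_cancel_left₀ _ hz]; ring
  have h2 : 0 ≤ ∫ q, F q ∂μ.prod ν := by
    rw [integral_prod _ hi]
    refine integral_nonneg_of_ae ?_
    filter_upwards [ae_good, hi.prod_right_ae] with x hx hix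
    obtain ⟨U, h⟩ := exists_sys x
    have e : ∀ s, F (x, s) = (Complex.normSq (star (U.col l) ⬝ᵥ zv s) -
      Complex.normSq (star (U.col j) ⬝ᵥ zv s)) * Real.exp (-t * (qf x (zv s) / nsq (zv s))) := by
      intro s
      have e1 : ∀ i, fderiv ℝ (fun x => ev x i) x (rk (zv s)) =
          Complex.normSq (star (U.col i) ⬝ᵥ zv s) := by
        intro i
        rw [fderiv_ev hx h, qf_rk, Matrix.star_dotProduct, ← Complex.normSq_conj]
        simp
      simp only [hF, e1]
    simp only [e] at hix ⊢
    exact integral_dot_zv_exp_nonneg h hjl ht hix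
  rw [h1, integral_nsq_zv] at h2
  exact nonneg_of_mul_nonneg_right h2 (by positivity)

end

section
open Filter
variable {N : ℕ}

lemma hasDerivAt_integral_ev_shift (j l : Fin (N + 1)) (s : ℝ) :
    HasDerivAt (fun s : ℝ => ∫ x, (ev (x + (-s) • eLast N) l - ev (x + (-s) • eLast N) j)
        ∂stdGauss (Fin (N + 1) × Fin (N + 1)))
      (-(Real.exp (-(s ^ 2 / 2)) * ∫ x, (evLast l x - evLast j x) *
        Real.exp (-s * x (Fin.last N, Fin.last N)) ∂stdGauss (Fin (N + 1) × Fin (N + 1)))) s := by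
  set φ : (Fin (N + 1) × Fin (N + 1) → ℝ) → ℝ := fun x => ev x l - ev x j with hφ
  have hL : LipschitzWith (evK (N + 1) + evK (N + 1)) φ := (ev_lipschitz l).sub (ev_lipschitz j)
  set w : (Fin (N + 1) × Fin (N + 1) → ℝ) → ℝ := fun x =>
    Real.exp (-s * x (Fin.last N, Fin.last N)) * Real.exp (-(s ^ 2 / 2)) with hw
  have hwe : ∀ x : Fin (N + 1) × Fin (N + 1) → ℝ,
      Real.exp (∑ i, (((-s) • eLast N) i * x i - ((-s) • eLast N) i ^ 2 / 2)) = w x := by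
    intro x
    simp only [hw]
    rw [← Real.exp_add]
    congr 1
    rw [Finset.sum_eq_single (Fin.last N, Fin.last N)]
    · simp [eLast]; ring
    · intro b _ hb; simp [eLast, hb]
    · simp
  have hwc : Continuous w := by fun_prop
  have hwb : ExpBdd w := by
    refine ((ExpBdd.exp_sum_abs (abs_nonneg s)).mul (ExpBdd.const (Real.exp (-(s ^ 2 / 2))))).mono
      fun x => ?_
    rw [hw, abs_mul, abs_mul]
    refine mul_le_mul_of_nonneg_right ?_ (abs_nonneg _)
    rw [Real.abs_exp, Real.abs_exp]
    refine Real.exp_le_exp.2 ((le_abs_self _).trans ?_)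
    rw [abs_mul, abs_neg]
    exact mul_le_mul_of_nonneg_left (Finset.single_le_sum (f := fun i => |x i|)
      (fun i _ => abs_nonneg _) (Finset.mem_univ _)) (abs_nonneg s)
  have h1 := hasDerivAt_integral_shift hL (-eLast N) (q := w)
    (hwb.integrable hwc.aestronglyMeasurable)
    (((ExpBdd.of_lipschitz hL).mul hwb).integrable (hL.continuous.mul hwc).aestronglyMeasurable)
  have h2 : ∀ t : ℝ, ∫ x, φ (x + t • -eLast N) * w x ∂stdGauss (Fin (N + 1) × Fin (N + 1)) =
      ∫ x, φ (x + (-(s + t)) • eLast N) ∂stdGauss (Fin (N + 1) × Fin (N + 1)) := by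
    intro t
    simp_rw [← hwe]
    rw [← integral_stdGauss_add (fun x => φ (x + t • -eLast N)) ((-s) • eLast N)]
    congr 1
    ext x
    congr 1
    ext p
    simp; ring
  simp_rw [h2] at h1
  have h3 : HasDerivAt (fun u : ℝ => u - s) 1 s := by
    simpa using (hasDerivAt_id s).sub_const s
  have h4 := HasDerivAt.comp s (by simpa using h1) h3
  refine (h4.congr_deriv ?_).congr_of_eventuallyEq (Eventually.of_forall fun u => ?_)
  · rw [mul_one, ← integral_const_mul, ← integral_neg]
    refine integral_congr_ae ?_
    filter_upwards [ae_good] with x hx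
    rw [hφ, fderiv_fun_sub (hx l) (hx j), hw]
    simp only [evLast, ContinuousLinearMap.sub_apply]
    ring
  · have h5 : s - u + -s = -u := by ring
    simp [hφ, h5]

lemma integrable_ev_shift (j : Fin (N + 1)) (h : Fin (N + 1) × Fin (N + 1) → ℝ) :
    Integrable (fun x => ev (x + h) j) (stdGauss (Fin (N + 1) × Fin (N + 1))) := by
  have hL : LipschitzWith (evK (N + 1)) fun x => ev (x + h) j :=
    LipschitzWith.of_dist_le_mul fun x y => by
      simpa using (ev_lipschitz j).dist_le_mul (x + h) (y + h)
  exact (ExpBdd.of_lipschitz hL).integrable hL.continuous.aestronglyMeasurable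

lemma integral_ev_shift_mono {j l : Fin (N + 1)} (hjl : j ≤ l) {s : ℝ} (hs : 0 ≤ s) :
    ∫ x, (ev x j - ev (x + (-s) • eLast N) j) ∂stdGauss (Fin (N + 1) × Fin (N + 1)) ≤
      ∫ x, (ev x l - ev (x + (-s) • eLast N) l) ∂stdGauss (Fin (N + 1) × Fin (N + 1)) := by
  have h := antitoneOn_of_deriv_nonpos (convex_Ici (0 : ℝ))
    (f := fun s : ℝ => ∫ x, (ev (x + (-s) • eLast N) l - ev (x + (-s) • eLast N) j)
        ∂stdGauss (Fin (N + 1) × Fin (N + 1)))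
    (fun s _ => (hasDerivAt_integral_ev_shift j l s).continuousAt.continuousWithinAt)
    (fun s _ => (hasDerivAt_integral_ev_shift j l s).differentiableAt.differentiableWithinAt)
    (fun s hs => by
      rw [interior_Ici] at hs
      rw [(hasDerivAt_integral_ev_shift j l s).deriv]
      exact neg_nonpos.2 (mul_nonneg (Real.exp_pos _).le
        (integral_evLast_exp_nonneg hjl (le_of_lt hs))))
    (Set.mem_Ici.2 le_rfl) (Set.mem_Ici.2 hs) hs
  simp only [neg_zero, zero_smul, add_zero] at h
  rw [integral_sub (integrable_ev_shift _ _) (integrable_ev_shift _ _),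
    integral_sub (integrable_ev _) (integrable_ev _)] at h
  rw [integral_sub (integrable_ev _) (integrable_ev_shift _ _),
    integral_sub (integrable_ev _) (integrable_ev_shift _ _)]
  linarith

lemma measurable_mnr : Measurable (mnr : (Fin (N + 1) × Fin (N + 1) → ℝ) → _) :=
  measurable_pi_iff.2 fun p => measurable_pi_apply _

lemma lipschitz_ev_mnr (j : Fin N) :
    LipschitzWith (evK N) fun x : Fin (N + 1) × Fin (N + 1) → ℝ => ev (mnr x) j := by
  have h : LipschitzWith 1 (mnr : (Fin (N + 1) × Fin (N + 1) → ℝ) → _) := by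
    refine LipschitzWith.of_dist_le_mul fun x y => ?_
    rw [NNReal.coe_one, one_mul]
    exact (dist_pi_le_iff dist_nonneg).2 fun p => dist_le_pi_dist x y _
  simpa [Function.comp_def] using (ev_lipschitz j).comp h

lemma integrable_ev_mnr (j : Fin N) :
    Integrable (fun x => ev (mnr x) j) (stdGauss (Fin (N + 1) × Fin (N + 1))) :=
  (ExpBdd.of_lipschitz (lipschitz_ev_mnr j)).integrable
    (lipschitz_ev_mnr j).continuous.aestronglyMeasurable

lemma ev_mnr_le_shift (x : Fin (N + 1) × Fin (N + 1) → ℝ) (j : Fin N) (s : ℝ) :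
    ev (mnr x) j ≤ ev (x + (-s) • eLast N) j.castSucc := by
  have := ev_mnr_le (x + (-s) • eLast N) j
  rwa [mnr_add_smul_eLast] at this

lemma ev_mono_of_qf_le {x y : Fin N × Fin N → ℝ} (h : ∀ w, qf x w ≤ qf y w) (j : Fin N) :
    ev x j ≤ ev y j := by
  obtain ⟨U, hU⟩ := exists_sys x
  obtain ⟨V, hV⟩ := exists_sys y
  let f : (Fin N → ℂ) →ₗ[ℂ] ({i : Fin N // i ≠ j} → ℂ) := LinearMap.pi fun i =>
    if j < i.1 then LinearMap.proj i.1 ∘ₗ colForm U else LinearMap.proj i.1 ∘ₗ colForm V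
  obtain ⟨w, hw0, hw⟩ := exists_ne_zero_of_card_lt f (by
    have := j.pos
    simp [Fintype.card_subtype_compl]; omega)
  have h1 : ev x j * nsq w ≤ qf x w := by
    refine hU.le_qf fun i hi => ?_
    have := congrFun hw ⟨i, hi.ne'⟩
    simpa [f, hi, colForm_apply] using this
  have h2 : qf y w ≤ ev y j * nsq w := by
    refine hV.qf_le fun i hi => ?_
    have := congrFun hw ⟨i, hi.ne⟩
    simpa [f, hi.not_gt, colForm_apply] using this
  exact le_of_mul_le_mul_right (h1.trans ((h w).trans h2)) (nsq_pos hw0)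

lemma ev_shift_le {s : ℝ} (hs : 0 ≤ s) (x : Fin (N + 1) × Fin (N + 1) → ℝ) (j : Fin (N + 1)) :
    ev (x + (-s) • eLast N) j ≤ ev x j := by
  refine ev_mono_of_qf_le (fun w => ?_) j
  have h1 : qf (x + (-s) • eLast N) w = qf x w + (-s) * qf (eLast N) w := by
    simp only [qf_eq_sum, Finset.mul_sum, ← Finset.sum_add_distrib]
    refine Finset.sum_congr rfl fun p _ => ?_
    simp; ring
  rw [h1, qf_eLast]
  nlinarith [Complex.normSq_nonneg (w (Fin.last N))]

/-- The mean interlacing gap at `j` is at most the mean spacing at any later index. -/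
theorem integral_gap_le {j l : Fin N} (hjl : j ≤ l) :
    ∫ x, (ev x j.castSucc - ev (mnr x) j) ∂stdGauss (Fin (N + 1) × Fin (N + 1)) ≤
      ∫ x, (ev x l.castSucc - ev x l.succ) ∂stdGauss (Fin (N + 1) × Fin (N + 1)) := by
  have h1 : Tendsto (fun s : ℝ => ∫ x, (ev x j.castSucc - ev (x + (-s) • eLast N) j.castSucc)
      ∂stdGauss (Fin (N + 1) × Fin (N + 1))) atTop
      (nhds (∫ x, (ev x j.castSucc - ev (mnr x) j) ∂stdGauss (Fin (N + 1) × Fin (N + 1)))) := by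
    refine tendsto_integral_filter_of_dominated_convergence
      (fun x => ev x j.castSucc - ev (mnr x) j) (Eventually.of_forall fun s =>
        ((integrable_ev _).sub (integrable_ev_shift _ _)).aestronglyMeasurable) ?_
      ((integrable_ev _).sub (integrable_ev_mnr j))
      (Eventually.of_forall fun x => (tendsto_ev_sub_smul_eLast x j).const_sub _)
    filter_upwards [eventually_ge_atTop 0] with s hs
    refine Eventually.of_forall fun x => ?_
    have h2 := ev_mnr_le_shift x j s
    have h3 := ev_shift_le hs x j.castSucc
    rw [Real.norm_of_nonneg (by linarith)]
    linarith
  refine le_of_tendsto h1 ?_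
  filter_upwards [eventually_ge_atTop 0] with s hs
  refine (integral_ev_shift_mono (Fin.castSucc_le_castSucc_iff.2 hjl) hs).trans ?_
  refine integral_mono ((integrable_ev _).sub (integrable_ev_shift _ _))
    ((integrable_ev _).sub (integrable_ev _)) fun x => ?_
  have h4 := ev_mnr_le_shift x l s
  have h5 := ev_succ_le x l
  simp only
  linarith

lemma mnr_neg (x : Fin (N + 1) × Fin (N + 1) → ℝ) : mnr (-x) = -mnr x := rfl

lemma integral_neg_stdGauss {κ : Type*} [Fintype κ] (F : (κ → ℝ) → ℝ) :
    ∫ x, F (-x) ∂stdGauss κ = ∫ x, F x ∂stdGauss κ := by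
  rw [integral_stdGauss, integral_stdGauss, ← integral_neg_eq_self]
  congr 1
  ext x
  simp [stdGaussPDF, gaussianPDFReal]

theorem integral_gap_le' {j l : Fin N} (hlj : l ≤ j) :
    ∫ x, (ev (mnr x) j - ev x j.succ) ∂stdGauss (Fin (N + 1) × Fin (N + 1)) ≤
      ∫ x, (ev x l.castSucc - ev x l.succ) ∂stdGauss (Fin (N + 1) × Fin (N + 1)) := by
  have h := integral_gap_le (Fin.rev_le_rev.2 hlj)
  rw [← integral_neg_stdGauss,
    ← integral_neg_stdGauss (fun x => ev x l.rev.castSucc - ev x l.rev.succ)] at h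
  simp only [mnr_neg, ev_neg, Fin.rev_castSucc, Fin.rev_succ, Fin.rev_rev] at h
  convert h using 3 <;> ring

end

section
variable {N : ℕ}

lemma ev_sub_sq_le {K : ℕ} (x : Fin N × Fin N → ℝ) {a b : Fin N} (hab : a ≤ b)
    (ha : N ≤ 2 * K * (a + 1)) (hb : N ≤ 2 * K * (N - b)) :
    N * (ev x a - ev x b) ^ 2 ≤ 8 * K * ∑ p, x p ^ 2 := by
  rw [← sum_ev_sq]
  have hS : 0 ≤ ∑ j, ev x j ^ 2 := Finset.sum_nonneg fun _ _ => sq_nonneg _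
  have hK : (0 : ℝ) ≤ K := K.cast_nonneg
  have hmono := ev_anti x hab
  have h1 : 0 ≤ ev x a → N * ev x a ^ 2 ≤ 2 * K * ∑ j, ev x j ^ 2 := by
    intro h0
    have h2 : ((a : ℕ) + 1 : ℝ) * ev x a ^ 2 ≤ ∑ j, ev x j ^ 2 := by
      calc ((a : ℕ) + 1 : ℝ) * ev x a ^ 2 = ∑ j ∈ Finset.Iic a, ev x a ^ 2 := by
            simp [Fin.card_Iic]
        _ ≤ ∑ j ∈ Finset.Iic a, ev x j ^ 2 := Finset.sum_le_sum fun j hj =>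
            pow_le_pow_left₀ h0 (ev_anti x (Finset.mem_Iic.1 hj)) 2
        _ ≤ _ := Finset.sum_le_univ_sum_of_nonneg fun _ => sq_nonneg _
    have h3 : (N : ℝ) ≤ 2 * K * ((a : ℕ) + 1) := by exact_mod_cast ha
    calc N * ev x a ^ 2 ≤ 2 * K * ((a : ℕ) + 1) * ev x a ^ 2 :=
          mul_le_mul_of_nonneg_right h3 (sq_nonneg _)
      _ = 2 * K * (((a : ℕ) + 1) * ev x a ^ 2) := by ring
      _ ≤ _ := mul_le_mul_of_nonneg_left h2 (by positivity)
  have h1' : ev x b ≤ 0 → N * ev x b ^ 2 ≤ 2 * K * ∑ j, ev x j ^ 2 := by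
    intro h0
    have h2 : ((N - b : ℕ) : ℝ) * ev x b ^ 2 ≤ ∑ j, ev x j ^ 2 := by
      calc ((N - b : ℕ) : ℝ) * ev x b ^ 2 = ∑ j ∈ Finset.Ici b, ev x b ^ 2 := by
            simp [Fin.card_Ici]
        _ ≤ ∑ j ∈ Finset.Ici b, ev x j ^ 2 := Finset.sum_le_sum fun j hj => by
            have := ev_anti x (Finset.mem_Ici.1 hj)
            nlinarith
        _ ≤ _ := Finset.sum_le_univ_sum_of_nonneg fun _ => sq_nonneg _
    have h3 : (N : ℝ) ≤ 2 * K * ((N - b : ℕ) : ℝ) := by exact_mod_cast hb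
    calc N * ev x b ^ 2 ≤ 2 * K * ((N - b : ℕ) : ℝ) * ev x b ^ 2 :=
          mul_le_mul_of_nonneg_right h3 (sq_nonneg _)
      _ = 2 * K * (((N - b : ℕ) : ℝ) * ev x b ^ 2) := by ring
      _ ≤ _ := mul_le_mul_of_nonneg_left h2 (by positivity)
  have hN : (0 : ℝ) ≤ N := N.cast_nonneg
  have hKS : 0 ≤ K * ∑ j, ev x j ^ 2 := mul_nonneg hK hS
  rcases le_total 0 (ev x b) with hb0 | hb0
  · have h4 := h1 (hb0.trans hmono)
    have h5 : (ev x a - ev x b) ^ 2 ≤ ev x a ^ 2 := by nlinarith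
    nlinarith [mul_le_mul_of_nonneg_left h5 hN]
  · have h6 := h1' hb0
    rcases le_total 0 (ev x a) with ha0 | ha0
    · have h4 := h1 ha0
      have h5 : (ev x a - ev x b) ^ 2 ≤ 2 * (ev x a ^ 2 + ev x b ^ 2) := by
        nlinarith [sq_nonneg (ev x a + ev x b)]
      nlinarith [mul_le_mul_of_nonneg_left h5 hN]
    · have h5 : (ev x a - ev x b) ^ 2 ≤ ev x b ^ 2 := by nlinarith
      nlinarith [mul_le_mul_of_nonneg_left h5 hN]

lemma integral_ev_sub_sq_le {K : ℕ} {a b : Fin N} (hab : a ≤ b)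
    (ha : N ≤ 2 * K * (a + 1)) (hb : N ≤ 2 * K * (N - b)) :
    (∫ x, (ev x a - ev x b) ∂stdGauss (Fin N × Fin N)) ^ 2 ≤ 8 * K * N := by
  have hN : (0 : ℝ) < N := by exact_mod_cast a.pos
  have hm : MemLp (fun x => ev x a - ev x b) 2 (stdGauss (Fin N × Fin N)) :=
    (memLp_ev a).sub (memLp_ev b)
  have h1 := integral_mul_sq_le hm (memLp_const (1 : ℝ))
  simp only [mul_one, one_pow, integral_const, probReal_univ, smul_eq_mul] at h1
  have h2 : ∫ x, N * (ev x a - ev x b) ^ 2 ∂stdGauss (Fin N × Fin N) ≤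
      ∫ x, 8 * K * ∑ p, x p ^ 2 ∂stdGauss (Fin N × Fin N) :=
    integral_mono (hm.integrable_sq.const_mul _)
      ((integrable_finsetSum _ fun p _ => integrable_coord_pow p 2).const_mul _)
      fun x => ev_sub_sq_le x hab ha hb
  rw [integral_const_mul, integral_const_mul,
    integral_finsetSum _ fun p _ => integrable_coord_pow p 2] at h2
  simp only [integral_coord_sq, Finset.sum_const, Finset.card_univ, Fintype.card_prod,
    Fintype.card_fin, nsmul_eq_mul, mul_one, Nat.cast_mul] at h2
  refine h1.trans (le_of_mul_le_mul_left (h2.trans_eq ?_) hN)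
  ring

lemma mul_le_ev_sub {c : ℝ} {a b : Fin (N + 1)} (hab : a ≤ b)
    (h : ∀ l : Fin N, a ≤ l.castSucc → l.succ ≤ b →
      c ≤ ∫ x, (ev x l.castSucc - ev x l.succ) ∂stdGauss (Fin (N + 1) × Fin (N + 1))) :
    ((b - a : ℕ) : ℝ) * c ≤ ∫ x, (ev x a - ev x b) ∂stdGauss (Fin (N + 1) × Fin (N + 1)) := by
  set F : ℕ → ℝ := fun k => if hk : k < N + 1 then
    ∫ x, ev x ⟨k, hk⟩ ∂stdGauss (Fin (N + 1) × Fin (N + 1)) else 0 with hF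
  have h1 : ∑ i ∈ Finset.range (b - a), (F (a + i) - F (a + (i + 1))) = F (a + 0) - F (a + (b - a)) :=
    Finset.sum_range_sub' (fun i => F (a + i)) _
  have h2 : (a : ℕ) + (b - a) = b := by have : (a : ℕ) ≤ b := hab; omega
  have h3 : ∫ x, (ev x a - ev x b) ∂stdGauss (Fin (N + 1) × Fin (N + 1)) =
      F (a + 0) - F (a + (b - a)) := by
    rw [h2, integral_sub (integrable_ev _) (integrable_ev _)]
    simp only [hF, add_zero, dif_pos a.isLt, dif_pos b.isLt, Fin.eta]
  rw [h3, ← h1]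
  have h4 : ((b - a : ℕ) : ℝ) * c = ∑ i ∈ Finset.range (b - a), c := by simp
  rw [h4]
  refine Finset.sum_le_sum fun i hi => ?_
  have hi' := Finset.mem_range.1 hi
  have hb := b.isLt
  have := h ⟨a + i, by omega⟩ (by rw [Fin.le_def]; simp) (by rw [Fin.le_def]; simp; omega)
  rw [integral_sub (integrable_ev _) (integrable_ev _)] at this
  refine this.trans_eq ?_
  simp only [hF]
  rw [dif_pos (by omega), dif_pos (by omega)]
  rfl

lemma sq_le_of_mul_le {K n L : ℕ} {c D : ℝ} (hn : 0 < n) (hc : 0 ≤ c) (h : (L : ℝ) * c ≤ D)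
    (hD : D ^ 2 ≤ 8 * K * n) (hL : n ≤ 2 * K * L) : n * c ^ 2 ≤ 32 * K ^ 3 := by
  have hn' : (0 : ℝ) < n := by exact_mod_cast hn
  have h1 : (n : ℝ) ≤ 2 * K * L := by exact_mod_cast hL
  have h2 : n * c ≤ 2 * K * D := by
    calc n * c ≤ 2 * K * L * c := mul_le_mul_of_nonneg_right h1 hc
      _ = 2 * K * (L * c) := by ring
      _ ≤ _ := mul_le_mul_of_nonneg_left h (by positivity)
  have h3 : (n * c) ^ 2 ≤ (2 * K * D) ^ 2 := pow_le_pow_left₀ (by positivity) h2 2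
  have h4 : n * (n * c ^ 2) ≤ n * (32 * K ^ 3) := by
    have : (2 * K * D) ^ 2 ≤ 4 * K ^ 2 * (8 * K * n) := by
      rw [mul_pow]
      refine (mul_le_mul_of_nonneg_left hD (by positivity)).trans_eq ?_
      ring
    nlinarith
  exact le_of_mul_le_mul_left h4 hn'

/-- In the bulk, mean interlacing gaps are of order `N ^ (-1/2)`. -/
theorem integral_gap_sq_bulk {K : ℕ} (j : Fin N) (h1 : N + 1 ≤ K * j) (h2 : N + 1 ≤ K * (N - j)) :
    ((N : ℝ) + 1) * (∫ x, (ev x j.castSucc - ev (mnr x) j)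
      ∂stdGauss (Fin (N + 1) × Fin (N + 1))) ^ 2 ≤ 32 * K ^ 3 := by
  have hj := j.isLt
  set L := (N - j + 1) / 2 with hL
  have hLj : N + 1 ≤ 2 * K * L := by
    have : N - j ≤ 2 * L := by omega
    nlinarith
  set b : Fin (N + 1) := ⟨j + L, by omega⟩ with hb
  have hjb : j.castSucc ≤ b := by rw [Fin.le_def]; simp [hb]
  have h3 := mul_le_ev_sub (c := ∫ x, (ev x j.castSucc - ev (mnr x) j)
      ∂stdGauss (Fin (N + 1) × Fin (N + 1))) hjb
    fun l hl _ => integral_gap_le (Fin.castSucc_le_castSucc_iff.1 hl)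
  have h4 := integral_ev_sub_sq_le (K := K) hjb (by simp; nlinarith) (by
    have : L ≤ N + 1 - b := by simp [hb]; omega
    nlinarith)
  have h5 : (b : ℕ) - (j.castSucc : ℕ) = L := by simp [hb]
  rw [h5] at h3
  have := sq_le_of_mul_le (n := N + 1) (Nat.succ_pos _)
    (integral_nonneg fun x => sub_nonneg.2 (ev_mnr_le x j)) h3 h4 hLj
  simpa using this

theorem integral_gap_sq_bulk' {K : ℕ} (j : Fin N) (h1 : N + 1 ≤ K * j)
    (h2 : N + 1 ≤ K * (N - j)) :
    ((N : ℝ) + 1) * (∫ x, (ev (mnr x) j - ev x j.succ)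
      ∂stdGauss (Fin (N + 1) × Fin (N + 1))) ^ 2 ≤ 32 * K ^ 3 := by
  have hj := j.isLt
  set L := ((j : ℕ) + 1) / 2 with hL
  have hLj : N + 1 ≤ 2 * K * L := by
    have : (j : ℕ) ≤ 2 * L := by omega
    nlinarith
  set a : Fin (N + 1) := ⟨j + 1 - L, by omega⟩ with ha
  have haj : a ≤ j.succ := by rw [Fin.le_def]; simp [ha]
  have h3 := mul_le_ev_sub (c := ∫ x, (ev (mnr x) j - ev x j.succ)
      ∂stdGauss (Fin (N + 1) × Fin (N + 1))) haj
    fun l _ hl => integral_gap_le' (Fin.succ_le_succ_iff.1 hl)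
  have h4 := integral_ev_sub_sq_le (K := K) haj (by
    have : L ≤ a + 1 := by simp [ha]; omega
    nlinarith) (by
    have : N - j ≤ N + 1 - j.succ := by simp
    nlinarith)
  have h5 : (j.succ : ℕ) - (a : ℕ) = L := by simp [ha]; omega
  rw [h5] at h3
  have := sq_le_of_mul_le (n := N + 1) (Nat.succ_pos _)
    (integral_nonneg fun x => sub_nonneg.2 (ev_succ_le x j)) h3 h4 hLj
  simpa using this

theorem integral_sq_gap_bulk {K : ℕ} (j : Fin N) (h1 : N + 1 ≤ K * j)
    (h2 : N + 1 ≤ K * (N - j)) :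
    ((N : ℝ) + 1) * ∫ x, (ev x j.castSucc - ev (mnr x) j) ^ 2
      ∂stdGauss (Fin (N + 1) × Fin (N + 1)) ≤ 256 * K ^ 3 := by
  have h3 := integral_gap_sq_bulk j h1 h2
  have h4 := integral_gap_sq_bulk' j h1 h2
  have h5 := integral_gap_sq_le (N := N + 1) (j := j.castSucc) (k := j.succ)
    (Fin.castSucc_lt_succ).ne
  have hm : MemLp (fun x : Fin (N + 1) × Fin (N + 1) → ℝ => ev (mnr x) j) 2 (stdGauss _) :=
    memLp_two_of_lipschitz (lipschitz_ev_mnr j)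
  have h6 : ∫ x, (ev x j.castSucc - ev (mnr x) j) ^ 2 ∂stdGauss (Fin (N + 1) × Fin (N + 1)) ≤
      ∫ x, (ev x j.castSucc - ev x j.succ) ^ 2 ∂stdGauss (Fin (N + 1) × Fin (N + 1)) :=
    integral_mono ((memLp_ev j.castSucc).sub hm).integrable_sq
      ((memLp_ev j.castSucc).sub (memLp_ev j.succ)).integrable_sq fun x => by
        have := ev_succ_le x j
        have := ev_mnr_le x j
        simp only
        gcongr
  rw [integral_sub (integrable_ev _) (integrable_ev_mnr _)] at h3
  rw [integral_sub (integrable_ev_mnr _) (integrable_ev _)] at h4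
  rw [integral_sub (integrable_ev _) (integrable_ev _)] at h5
  have hN : (0 : ℝ) ≤ (N : ℝ) + 1 := by positivity
  set A := ∫ x, ev x j.castSucc ∂stdGauss (Fin (N + 1) × Fin (N + 1))
  set B := ∫ x, ev (mnr x) j ∂stdGauss (Fin (N + 1) × Fin (N + 1))
  set D := ∫ x, ev x j.succ ∂stdGauss (Fin (N + 1) × Fin (N + 1))
  have h7 : (A - D) ^ 2 ≤ 2 * ((A - B) ^ 2 + (B - D) ^ 2) := by
    nlinarith [sq_nonneg ((A - B) - (B - D))]
  nlinarith [mul_le_mul_of_nonneg_left (h6.trans h5) hN, mul_le_mul_of_nonneg_left h7 hN]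

end

section
open Matrix
variable {N : ℕ}

/-- The position of each coordinate of a Hermitian matrix of size `N + 1`: in the minor, in the
last column, or at the last diagonal entry. -/
def rowEquiv (N : ℕ) :
    Fin (N + 1) × Fin (N + 1) ≃ (Fin N × Fin N) ⊕ ((Fin N × Fin 2) ⊕ Unit) where
  toFun p := Fin.lastCases
    (Fin.lastCases (.inr (.inr ())) (fun j => .inr (.inl (j, 1))) p.2)
    (fun i => Fin.lastCases (.inr (.inl (i, 0))) (fun j => .inl (i, j)) p.2) p.1
  invFun q := q.elim (fun p => (p.1.castSucc, p.2.castSucc)) fun q =>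
    q.elim (fun p => if p.2 = 0 then (p.1.castSucc, Fin.last N) else (Fin.last N, p.1.castSucc))
      fun _ => (Fin.last N, Fin.last N)
  left_inv p := by
    obtain ⟨a, b⟩ := p
    refine Fin.lastCases ?_ (fun i => ?_) a <;> refine Fin.lastCases ?_ (fun j => ?_) b <;> simp
  right_inv q := by
    rcases q with ⟨i, j⟩ | ⟨i, c⟩ | _
    · simp
    · fin_cases c <;> simp
    · simp

/-- Assemble a Hermitian matrix from its top-left minor and its last row. -/
def asm (y : Fin N × Fin N → ℝ) (r : (Fin N × Fin 2) ⊕ Unit → ℝ) :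
    Fin (N + 1) × Fin (N + 1) → ℝ := fun p => Sum.elim y r (rowEquiv N p)

lemma asm_cc (y : Fin N × Fin N → ℝ) (r : (Fin N × Fin 2) ⊕ Unit → ℝ) (i j : Fin N) :
    asm y r (i.castSucc, j.castSucc) = y (i, j) := by simp [asm, rowEquiv]

lemma asm_cl (y : Fin N × Fin N → ℝ) (r : (Fin N × Fin 2) ⊕ Unit → ℝ) (i : Fin N) :
    asm y r (i.castSucc, Fin.last N) = r (.inl (i, 0)) := by simp [asm, rowEquiv]

lemma asm_lc (y : Fin N × Fin N → ℝ) (r : (Fin N × Fin 2) ⊕ Unit → ℝ) (i : Fin N) :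
    asm y r (Fin.last N, i.castSucc) = r (.inl (i, 1)) := by simp [asm, rowEquiv]

lemma asm_ll (y : Fin N × Fin N → ℝ) (r : (Fin N × Fin 2) ⊕ Unit → ℝ) :
    asm y r (Fin.last N, Fin.last N) = r (.inr ()) := by simp [asm, rowEquiv]

@[simp] lemma mnr_asm (y : Fin N × Fin N → ℝ) (r : (Fin N × Fin 2) ⊕ Unit → ℝ) :
    mnr (asm y r) = y := by
  ext ⟨i, j⟩
  exact asm_cc y r i j

lemma measurable_asm : Measurable fun q : (Fin N × Fin N → ℝ) × ((Fin N × Fin 2) ⊕ Unit → ℝ) =>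
    asm q.1 q.2 := by
  refine measurable_pi_iff.2 fun p => ?_
  simp only [asm]
  rcases rowEquiv N p with i | i
  · exact (measurable_pi_apply i).comp measurable_fst
  · exact (measurable_pi_apply i).comp measurable_snd

lemma asm_add (y y' : Fin N × Fin N → ℝ) (r r' : (Fin N × Fin 2) ⊕ Unit → ℝ) :
    asm (y + y') (r + r') = asm y r + asm y' r' := by
  ext p
  simp only [asm, Pi.add_apply]
  rcases rowEquiv N p with i | i <;> simp

lemma asm_smul (c : ℝ) (y : Fin N × Fin N → ℝ) (r : (Fin N × Fin 2) ⊕ Unit → ℝ) :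
    asm (c • y) (c • r) = c • asm y r := by
  ext p
  simp only [asm, Pi.smul_apply]
  rcases rowEquiv N p with i | i <;> simp

/-- The inclusion of the minor. -/
def asmFst (N : ℕ) : (Fin N × Fin N → ℝ) →ₗ[ℝ] (Fin (N + 1) × Fin (N + 1) → ℝ) where
  toFun y := asm y 0
  map_add' y y' := by rw [← asm_add, add_zero]
  map_smul' c y := by rw [RingHom.id_apply, ← asm_smul, smul_zero]

/-- The inclusion of the last row. -/
def asmSnd (N : ℕ) :
    ((Fin N × Fin 2) ⊕ Unit → ℝ) →ₗ[ℝ] (Fin (N + 1) × Fin (N + 1) → ℝ) where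
  toFun r := asm 0 r
  map_add' r r' := by rw [← asm_add, add_zero]
  map_smul' c r := by rw [RingHom.id_apply, ← asm_smul, smul_zero]

lemma asm_eq (y : Fin N × Fin N → ℝ) (r : (Fin N × Fin 2) ⊕ Unit → ℝ) :
    asm y r = asmFst N y + asmSnd N r := by
  change _ = asm y 0 + asm 0 r
  rw [← asm_add, add_zero, zero_add]

lemma measurePreserving_asm : MeasurePreserving
    (fun q : (Fin N × Fin N → ℝ) × ((Fin N × Fin 2) ⊕ Unit → ℝ) => asm q.1 q.2)
    ((stdGauss (Fin N × Fin N)).prod (stdGauss ((Fin N × Fin 2) ⊕ Unit)))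
    (stdGauss (Fin (N + 1) × Fin (N + 1))) := by
  have h1 := measurePreserving_sumPiEquivProdPi_symm
    (X := fun _ : (Fin N × Fin N) ⊕ ((Fin N × Fin 2) ⊕ Unit) => ℝ)
    (fun _ => gaussianReal 0 1)
  have h2 : MeasurePreserving (LinearMap.funLeft ℝ ℝ (rowEquiv N))
      (stdGauss ((Fin N × Fin N) ⊕ ((Fin N × Fin 2) ⊕ Unit)))
      (stdGauss (Fin (N + 1) × Fin (N + 1))) := by
    refine ⟨(LinearMap.continuous_of_finiteDimensional _).measurable,
      stdGauss_map_linear _ fun t => ?_⟩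
    rw [← (rowEquiv N).sum_comp]
    refine Finset.sum_congr rfl fun p _ => ?_
    congr 1
    rw [Finset.sum_eq_single p]
    · simp [LinearMap.funLeft]
    · intro q _ hq
      simp [LinearMap.funLeft, hq]
    · simp
  exact h2.comp h1

lemma measurePreserving_mnr : MeasurePreserving
    (mnr : (Fin (N + 1) × Fin (N + 1) → ℝ) → Fin N × Fin N → ℝ)
    (stdGauss (Fin (N + 1) × Fin (N + 1))) (stdGauss (Fin N × Fin N)) := by
  refine ⟨measurable_mnr, ?_⟩
  rw [← measurePreserving_asm.map_eq, Measure.map_map measurable_mnr measurable_asm]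
  have : (mnr ∘ fun q : (Fin N × Fin N → ℝ) × ((Fin N × Fin 2) ⊕ Unit → ℝ) => asm q.1 q.2) =
      Prod.fst := by ext q; simp
  rw [this]
  exact measurePreserving_fst.map_eq

lemma integral_asm {F : (Fin (N + 1) × Fin (N + 1) → ℝ) → ℝ}
    (hF : Integrable F (stdGauss (Fin (N + 1) × Fin (N + 1)))) :
    ∫ x, F x ∂stdGauss (Fin (N + 1) × Fin (N + 1)) =
      ∫ y, ∫ r, F (asm y r) ∂stdGauss ((Fin N × Fin 2) ⊕ Unit) ∂stdGauss (Fin N × Fin N) := by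
  have h1 := measurePreserving_asm (N := N)
  have h2 : Integrable (fun q : (Fin N × Fin N → ℝ) × ((Fin N × Fin 2) ⊕ Unit → ℝ) =>
      F (asm q.1 q.2)) _ := h1.integrable_comp_of_integrable hF
  rw [← integral_prod (fun q : (Fin N × Fin N → ℝ) × ((Fin N × Fin 2) ⊕ Unit → ℝ) =>
      F (asm q.1 q.2)) h2, ← h1.map_eq, integral_map h1.measurable.aemeasurable]
  rw [h1.map_eq]
  exact hF.aestronglyMeasurable

lemma integrable_asm {F : (Fin (N + 1) × Fin (N + 1) → ℝ) → ℝ}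
    (hF : Integrable F (stdGauss (Fin (N + 1) × Fin (N + 1)))) :
    Integrable (fun q : (Fin N × Fin N → ℝ) × ((Fin N × Fin 2) ⊕ Unit → ℝ) => F (asm q.1 q.2))
      ((stdGauss (Fin N × Fin N)).prod (stdGauss ((Fin N × Fin 2) ⊕ Unit))) :=
  measurePreserving_asm.integrable_comp_of_integrable hF

lemma ae_asm {p : (Fin (N + 1) × Fin (N + 1) → ℝ) → Prop}
    (h : ∀ᵐ x ∂stdGauss (Fin (N + 1) × Fin (N + 1)), p x) :
    ∀ᵐ q ∂(stdGauss (Fin N × Fin N)).prod (stdGauss ((Fin N × Fin 2) ⊕ Unit)),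
      p (asm q.1 q.2) :=
  measurePreserving_asm.quasiMeasurePreserving.ae h

lemma herm_asm_cc (y : Fin N × Fin N → ℝ) (r : (Fin N × Fin 2) ⊕ Unit → ℝ) (i j : Fin N) :
    herm (asm y r) i.castSucc j.castSucc = herm y i j := by
  rw [← mnr_asm y r, herm_mnr, mnr_asm]; rfl

lemma herm_asm_cl (y : Fin N × Fin N → ℝ) (r : (Fin N × Fin 2) ⊕ Unit → ℝ) (i : Fin N) :
    herm (asm y r) i.castSucc (Fin.last N) =
      zv (fun p => r (.inl p)) i / (Real.sqrt 2 : ℝ) := by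
  simp only [herm, of_apply, (Fin.castSucc_lt_last i).ne, if_false, Fin.castSucc_lt_last, if_true,
    asm_cl, asm_lc]
  congr 1
  apply Complex.ext <;> simp [zv]

lemma herm_asm_ll (y : Fin N × Fin N → ℝ) (r : (Fin N × Fin 2) ⊕ Unit → ℝ) :
    herm (asm y r) (Fin.last N) (Fin.last N) = r (.inr ()) := by
  simp [herm, asm_ll]

/-- The action of a unitary matrix on the last row. -/
def rowRot (V : Matrix (Fin N) (Fin N) ℂ) :
    ((Fin N × Fin 2) ⊕ Unit → ℝ) →ₗ[ℝ] ((Fin N × Fin 2) ⊕ Unit → ℝ) where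
  toFun r := Sum.elim (zLin V fun p => r (.inl p)) fun p => r (.inr p)
  map_add' r r' := by
    have : (fun p => (r + r') (.inl p)) = (fun p => r (.inl p)) + fun p => r' (.inl p) := rfl
    ext p
    rcases p with p | p
    · rw [this, map_add]; rfl
    · rfl
  map_smul' c r := by
    have : (fun p => (c • r) (.inl p)) = c • fun p => r (.inl p) := rfl
    ext p
    rcases p with p | p
    · rw [this, map_smul]; rfl
    · rfl

lemma measurePreserving_rowRot {V : Matrix (Fin N) (Fin N) ℂ} (hV : Vᴴ * V = 1) :
    MeasurePreserving (rowRot V) (stdGauss ((Fin N × Fin 2) ⊕ Unit))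
      (stdGauss ((Fin N × Fin 2) ⊕ Unit)) := by
  refine ⟨(LinearMap.continuous_of_finiteDimensional _).measurable,
    stdGauss_map_linear _ fun t => ?_⟩
  have h1 : ∀ i : Fin N × Fin 2, (fun p => (Pi.single (Sum.inl i) 1 :
      (Fin N × Fin 2) ⊕ Unit → ℝ) (.inl p)) = Pi.single i 1 := by
    intro i; ext p; simp [Pi.single_apply]
  have h2 : (fun p => (Pi.single (Sum.inr ()) 1 :
      (Fin N × Fin 2) ⊕ Unit → ℝ) (.inl p)) = 0 := by
    ext p; simp
  rw [Fintype.sum_sum_type, Fintype.sum_sum_type]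
  congr 1
  · rw [← sum_zLin_single_sq hV fun p => t (.inl p)]
    refine Finset.sum_congr rfl fun i _ => ?_
    rw [Fintype.sum_sum_type]
    simp [rowRot, h1]
  · have h3 : (fun p : Fin N × Fin 2 => (0 : ℝ)) = 0 := rfl
    simp [Fintype.sum_sum_type, rowRot, h3]

lemma exists_unitary_asm {V : Matrix (Fin N) (Fin N) ℂ} (hV : Vᴴ * V = 1) :
    ∃ W : Matrix (Fin (N + 1)) (Fin (N + 1)) ℂ, Wᴴ * W = 1 ∧
      ∀ y r, asm ((unitConj V).mulVec y) (rowRot V r) = (unitConj W).mulVec (asm y r) := by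
  set W : Matrix (Fin (N + 1)) (Fin (N + 1)) ℂ := Matrix.of fun a b =>
    Fin.lastCases (motive := fun _ => ℂ) (Fin.lastCases (motive := fun _ => ℂ) 1 (fun _ => 0) b)
      (fun i => Fin.lastCases (motive := fun _ => ℂ) 0 (fun j => V i j) b) a with hW
  have w1 : ∀ i j, W (Fin.castSucc i) (Fin.castSucc j) = V i j := fun i j => by simp [hW]
  have w2 : ∀ i, W (Fin.castSucc i) (Fin.last N) = 0 := fun i => by simp [hW]
  have w3 : ∀ i, W (Fin.last N) (Fin.castSucc i) = 0 := fun i => by simp [hW]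
  have w4 : W (Fin.last N) (Fin.last N) = 1 := by simp [hW]
  refine ⟨W, ?_, fun y r => ?_⟩
  · ext a b
    have hV' : ∀ i j, ∑ k, star (V k i) * V k j = (1 : Matrix (Fin N) (Fin N) ℂ) i j := fun i j => by
      rw [← hV]; rfl
    refine Fin.lastCases ?_ (fun i => ?_) a <;> refine Fin.lastCases ?_ (fun j => ?_) b <;>
      rw [mul_apply, Fin.sum_univ_castSucc] <;>
      simp only [conjTranspose_apply, w1, w2, w3, w4, star_zero, star_one, zero_mul, mul_zero,
        Finset.sum_const_zero, zero_add, add_zero, mul_one, hV']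
    · simp
    · simp [one_apply, (Fin.castSucc_lt_last _).ne']
    · simp [one_apply, (Fin.castSucc_lt_last _).ne]
    · simp [one_apply]
  · have h1 : herm (asm ((unitConj V).mulVec y) (rowRot V r)) =
        herm ((unitConj W).mulVec (asm y r)) := by
      have hr : zv (fun p => rowRot V r (.inl p)) = V *ᵥ zv (fun p => r (.inl p)) :=
        zv_zLin V fun p => r (.inl p)
      have hc : ∀ i, herm (asm ((unitConj V).mulVec y) (rowRot V r)) (Fin.castSucc i) (Fin.last N) =
          herm ((unitConj W).mulVec (asm y r)) (Fin.castSucc i) (Fin.last N) := by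
        intro i
        rw [herm_asm_cl, hr, herm_unitConj]
        simp only [mul_apply, Fin.sum_univ_castSucc, conjTranspose_apply, w1, w2, w3, w4, star_zero,
          star_one, mul_zero, Finset.sum_const_zero, zero_add, mul_one, add_zero, zero_mul,
          herm_asm_cl, mulVec, dotProduct, Finset.sum_div, mul_div_assoc]
      ext a b
      refine Fin.lastCases ?_ (fun i => ?_) a <;> refine Fin.lastCases ?_ (fun j => ?_) b
      · rw [herm_asm_ll, herm_unitConj]
        simp only [mul_apply, Fin.sum_univ_castSucc, conjTranspose_apply, w1, w2, w3, w4, star_zero,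
          star_one, mul_zero, Finset.sum_const_zero, zero_add, mul_one, one_mul, zero_mul,
          herm_asm_ll]
        rfl
      · rw [← (herm_isHermitian _).apply, hc, (herm_isHermitian _).apply]
      · exact hc i
      · rw [herm_asm_cc, herm_unitConj, herm_unitConj]
        simp only [mul_apply, Fin.sum_univ_castSucc, conjTranspose_apply, w1, w2, w3, w4, star_zero,
          star_one, mul_zero, Finset.sum_const_zero, zero_add, mul_one, add_zero, zero_mul,
          herm_asm_cc]
    rw [← coordH_herm (asm ((unitConj V).mulVec y) (rowRot V r)), h1, coordH_herm]

lemma integral_ev_asm_unitConj {V : Matrix (Fin N) (Fin N) ℂ} (hV : Vᴴ * V = 1)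
    (F : (Fin (N + 1) → ℝ) → ℝ) (hF : Continuous F) (y : Fin N × Fin N → ℝ) :
    ∫ r, F (ev (asm ((unitConj V).mulVec y) r)) ∂stdGauss ((Fin N × Fin 2) ⊕ Unit) =
      ∫ r, F (ev (asm y r)) ∂stdGauss ((Fin N × Fin 2) ⊕ Unit) := by
  obtain ⟨W, hW, hWr⟩ := exists_unitary_asm hV
  have h1 := measurePreserving_rowRot hV
  have hm : Measurable fun r => F (ev (asm ((unitConj V).mulVec y) r)) :=
    hF.measurable.comp ((measurable_pi_iff.2 fun j => (continuous_ev j).measurable).comp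
      (measurable_asm.comp (measurable_const.prodMk measurable_id)))
  rw [← h1.map_eq, integral_map h1.measurable.aemeasurable hm.aestronglyMeasurable, h1.map_eq]
  simp_rw [hWr, ev_unitConj hW]

end

section
open Matrix
variable {N : ℕ}

/-- Truncation of a vector, dropping its last coordinate. -/
def vtr (w : Fin (N + 1) → ℂ) : Fin N → ℂ := fun i => w i.castSucc

lemma qf_asmFst (y : Fin N × Fin N → ℝ) (w : Fin (N + 1) → ℂ) :
    qf (asmFst N y) w = qf y (vtr w) := by
  have h0 : herm (asmFst N y) (Fin.last N) (Fin.last N) = 0 := by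
    refine (herm_asm_ll y 0).trans ?_
    simp
  have hz : zv (fun p : Fin N × Fin 2 => (0 : (Fin N × Fin 2) ⊕ Unit → ℝ) (.inl p)) = 0 := by
    ext i; simp [zv, Complex.ext_iff]
  have h1 : ∀ i, herm (asmFst N y) (Fin.castSucc i) (Fin.last N) = 0 := fun i => by
    refine (herm_asm_cl y 0 i).trans ?_
    rw [hz]; simp
  have h2 : ∀ i, herm (asmFst N y) (Fin.last N) (Fin.castSucc i) = 0 := fun i => by
    rw [← (herm_isHermitian _).apply, h1, star_zero]
  have h3 : ∀ i j, herm (asmFst N y) (Fin.castSucc i) (Fin.castSucc j) = herm y i j :=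
    herm_asm_cc y 0
  simp only [qf, dotProduct, mulVec, Fin.sum_univ_castSucc, h0, h1, h2, h3, zero_mul, mul_zero,
    Finset.sum_const_zero, add_zero, Pi.star_apply, vtr]

lemma qf_asmFst_rk (v : Fin N → ℂ) (w : Fin (N + 1) → ℂ) :
    qf (asmFst N (rk v)) w = Complex.normSq (star v ⬝ᵥ vtr w) := by
  rw [qf_asmFst, qf_rk]

lemma nsq_vtr (w : Fin (N + 1) → ℂ) : nsq (vtr w) = nsq w - Complex.normSq (w (Fin.last N)) := by
  rw [nsq_snoc w, add_sub_cancel_right]; rfl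

section overlap
variable {y : Fin N × Fin N → ℝ} {r : (Fin N × Fin 2) ⊕ Unit → ℝ}
  {U : Matrix (Fin (N + 1)) (Fin (N + 1)) ℂ} {W : Matrix (Fin N) (Fin N) ℂ}
  {l : Fin (N + 1) → ℝ} {μ : Fin N → ℝ}

lemma sum_overlap (hU : IsEigSys (herm (asm y r)) l U) (hW : IsEigSys (herm y) μ W)
    (j : Fin (N + 1)) :
    ∑ k, Complex.normSq (star (W.col k) ⬝ᵥ vtr (U.col j)) =
      1 - Complex.normSq (U (Fin.last N) j) := by
  rw [hW.nsq_eq_sum, nsq_vtr, hU.nsq_col]; rfl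

lemma overlap_mul_sq (hU : IsEigSys (herm (asm y r)) l U) (hW : IsEigSys (herm y) μ W)
    (j : Fin (N + 1)) (k : Fin N) :
    Complex.normSq (star (W.col k) ⬝ᵥ vtr (U.col j)) * (l j - μ k) ^ 2 =
      Complex.normSq (U (Fin.last N) j) *
        (Complex.normSq (star (W.col k) ⬝ᵥ zv fun p => r (.inl p)) / 2) := by
  set b := zv fun p => r (.inl p) with hb
  have h1 : herm y *ᵥ vtr (U.col j) + (U (Fin.last N) j / (Real.sqrt 2 : ℝ)) • b =
      (l j : ℂ) • vtr (U.col j) := by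
    ext i
    have := congrFun (congrFun hU.mul_eq i.castSucc) j
    rw [mul_apply, Fin.sum_univ_castSucc, mul_diagonal, herm_asm_cl, ← hb] at this
    simp only [herm_asm_cc] at this
    simp only [Pi.add_apply, mulVec, dotProduct, vtr, Pi.smul_apply, smul_eq_mul, col_apply]
    rw [mul_comm (l j : ℂ), ← this]
    ring
  have h2 : star (W.col k) ᵥ* herm y = (μ k : ℂ) • star (W.col k) := by
    have h3 : herm y *ᵥ W.col k = (μ k : ℂ) • W.col k := by
      ext i
      have := congrFun (congrFun hW.mul_eq i) k
      rw [mul_apply, mul_diagonal] at this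
      simp only [mulVec, dotProduct, Pi.smul_apply, smul_eq_mul, col_apply]
      rw [this, mul_comm]
    have h4 := congrArg star h3
    rw [star_mulVec, (herm_isHermitian y).eq, star_smul] at h4
    simpa using h4
  have h5 := congrArg (fun v => star (W.col k) ⬝ᵥ v) h1
  simp only [dotProduct_add, dotProduct_mulVec, h2, dotProduct_smul, smul_dotProduct,
    smul_eq_mul] at h5
  have h6 : (star (W.col k) ⬝ᵥ vtr (U.col j)) * ((l j - μ k : ℝ) : ℂ) =
      U (Fin.last N) j / (Real.sqrt 2 : ℝ) * (star (W.col k) ⬝ᵥ b) := by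
    push_cast
    linear_combination -h5
  have h7 := congrArg Complex.normSq h6
  rw [Complex.normSq_mul, Complex.normSq_mul, Complex.normSq_div, Complex.normSq_ofReal,
    Complex.normSq_ofReal, Real.mul_self_sqrt (by norm_num)] at h7
  rw [sq, h7]
  ring

end overlap

lemma qf_asmSnd_single (i : (Fin N × Fin 2) ⊕ Unit) (w : Fin (N + 1) → ℂ) :
    qf (asmSnd N (Pi.single i 1)) w = rk w ((rowEquiv N).symm (.inr i)) := by
  rw [qf_eq_sum, Finset.sum_eq_single ((rowEquiv N).symm (.inr i))]
  · simp [asmSnd, asm]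
  · intro p _ hp
    have : asmSnd N (Pi.single i 1) p = 0 := by
      change Sum.elim (0 : Fin N × Fin N → ℝ) (Pi.single i 1) (rowEquiv N p) = 0
      rcases h : rowEquiv N p with q | q
      · rfl
      · have : q ≠ i := by
          rintro rfl
          exact hp (by rw [← h, Equiv.symm_apply_apply])
        simp [this]
    rw [this, zero_mul]
  · simp

lemma sum_qf_asmSnd_sq_le {U : Matrix (Fin (N + 1)) (Fin (N + 1)) ℂ} (hU : Uᴴ * U = 1)
    (v : Fin (N + 1) → ℝ) :
    ∑ i, (∑ j, v j * qf (asmSnd N (Pi.single i 1)) (U.col j)) ^ 2 ≤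
      2 * ∑ j, v j ^ 2 * Complex.normSq (U (Fin.last N) j) := by
  set z : Fin (N + 1) → ℂ := U *ᵥ fun j => v j * star (U (Fin.last N) j) with hz
  have h1 : ∑ j, v j ^ 2 * Complex.normSq (U (Fin.last N) j) = nsq z := by
    rw [hz, nsq_mulVec hU, nsq]
    refine Finset.sum_congr rfl fun j _ => ?_
    rw [Complex.normSq_mul, Complex.normSq_ofReal, ← sq, ← Complex.normSq_conj]; rfl
  have h2 : ∀ i, z i = ∑ j, v j * (U i j * star (U (Fin.last N) j)) := fun i => by
    rw [hz, mulVec, dotProduct]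
    exact Finset.sum_congr rfl fun j _ => by ring
  have h3 : ∀ i : Fin N, ∑ j, v j * qf (asmSnd N (Pi.single (.inl (i, 0)) 1)) (U.col j) =
      Real.sqrt 2 * (z i.castSucc).re := by
    intro i
    rw [h2, Complex.re_sum, Finset.mul_sum]
    refine Finset.sum_congr rfl fun j _ => ?_
    rw [qf_asmSnd_single, Complex.re_ofReal_mul]
    simp only [rowEquiv, Equiv.coe_fn_symm_mk, Sum.elim_inr, Sum.elim_inl, if_true, rk, coordH,
      (Fin.castSucc_lt_last i).ne, if_false, Fin.castSucc_lt_last, vecMulVec_apply, Pi.star_apply,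
      col_apply]
    ring
  have h4 : ∀ i : Fin N, ∑ j, v j * qf (asmSnd N (Pi.single (.inl (i, 1)) 1)) (U.col j) =
      Real.sqrt 2 * (z i.castSucc).im := by
    intro i
    rw [h2, Complex.im_sum, Finset.mul_sum]
    refine Finset.sum_congr rfl fun j _ => ?_
    rw [qf_asmSnd_single, Complex.im_ofReal_mul]
    simp only [rowEquiv, Equiv.coe_fn_symm_mk, Sum.elim_inr, Sum.elim_inl, one_ne_zero, rk, coordH,
      (Fin.castSucc_lt_last i).ne', if_false, (Fin.castSucc_lt_last i).not_gt, vecMulVec_apply,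
      Pi.star_apply, col_apply]
    ring
  have h5 : ∑ j, v j * qf (asmSnd N (Pi.single (.inr ()) 1)) (U.col j) = (z (Fin.last N)).re := by
    rw [h2, Complex.re_sum]
    refine Finset.sum_congr rfl fun j _ => ?_
    rw [qf_asmSnd_single, Complex.re_ofReal_mul]
    simp [rowEquiv, rk, coordH, vecMulVec_apply]
  rw [h1, Fintype.sum_sum_type, Fintype.sum_prod_type]
  simp only [Fin.sum_univ_two, h3, h4, Finset.univ_unique, Finset.sum_singleton, PUnit.default_eq_unit,
    h5]
  rw [nsq, Fin.sum_univ_castSucc, mul_add, Finset.mul_sum]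
  refine add_le_add (Finset.sum_le_sum fun i _ => ?_) ?_
  · rw [mul_pow, mul_pow, Real.sq_sqrt (by norm_num), Complex.normSq_apply]
    linarith
  · rw [Complex.normSq_apply]
    nlinarith [sq_nonneg (z (Fin.last N)).re, sq_nonneg (z (Fin.last N)).im]

/-- The gradient of the `k`-th eigenvalue. -/
def evVec (k : Fin N) (y : Fin N × Fin N → ℝ) : Fin N × Fin N → ℝ :=
  fun p => fderiv ℝ (fun x => ev x k) y (Pi.single p 1)

lemma measurable_evVec (k : Fin N) : Measurable (evVec k) :=
  measurable_pi_iff.2 fun p => measurable_fderiv_apply_const ℝ _ _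

lemma evVec_eq {y : Fin N × Fin N → ℝ} (hy : Good y) {W : Matrix (Fin N) (Fin N) ℂ}
    (hW : IsEigSys (herm y) (ev y) W) (k : Fin N) : evVec k y = rk (W.col k) := by
  ext p
  rw [evVec, fderiv_ev hy hW, qf_eq_sum, Finset.sum_eq_single p]
  · simp
  · intro q _ hq; simp [hq]
  · simp

/-- The squared overlap between an eigenvector and an eigenvector of the minor. -/
def ovl (j k : Fin N) (x : Fin (N + 1) × Fin (N + 1) → ℝ) : ℝ :=
  fderiv ℝ (fun x => ev x j.castSucc) x (asmFst N (evVec k (mnr x)))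

lemma measurable_asmFst : Measurable (asmFst N) :=
  (LinearMap.continuous_of_finiteDimensional _).measurable

lemma measurable_ovl (j k : Fin N) : Measurable (ovl j k) :=
  measurable_fderiv_comp measurable_id
    (measurable_asmFst.comp ((measurable_evVec k).comp measurable_mnr))

lemma ovl_eq {y : Fin N × Fin N → ℝ} {r : (Fin N × Fin 2) ⊕ Unit → ℝ} (hx : Good (asm y r))
    (hy : Good y) {U : Matrix (Fin (N + 1)) (Fin (N + 1)) ℂ} {W : Matrix (Fin N) (Fin N) ℂ}
    (hU : IsEigSys (herm (asm y r)) (ev (asm y r)) U) (hW : IsEigSys (herm y) (ev y) W)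
    (j k : Fin N) :
    ovl j k (asm y r) = Complex.normSq (star (W.col k) ⬝ᵥ vtr (U.col j.castSucc)) := by
  rw [ovl, mnr_asm, evVec_eq hy hW, fderiv_ev hx hU, qf_asmFst_rk]

end

section
open Matrix
variable {N : ℕ}

lemma exists_lipschitz_sum {ι α : Type*} [PseudoEMetricSpace α] (s : Finset ι)
    {f : ι → α → ℝ} (v : ι → ℝ) (h : ∀ i, ∃ L, LipschitzWith L (f i)) :
    ∃ L, LipschitzWith L fun x => ∑ i ∈ s, v i * f i x := by
  classical
  induction s using Finset.induction with
  | empty => exact ⟨0, by simpa using LipschitzWith.const (0 : ℝ)⟩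
  | insert i s hi ih =>
    obtain ⟨L, hL⟩ := ih
    obtain ⟨M, hM⟩ := h i
    simp only [Finset.sum_insert hi]
    exact ⟨_, (LipschitzWith.comp (lipschitzWith_smul (v i)) hM).add hL⟩

lemma dist_asm_le (y y' : Fin N × Fin N → ℝ) (r r' : (Fin N × Fin 2) ⊕ Unit → ℝ) :
    dist (asm y r) (asm y' r') ≤ max (dist y y') (dist r r') := by
  refine (dist_pi_le_iff (le_max_of_le_left dist_nonneg)).2 fun p => ?_
  simp only [asm]
  rcases rowEquiv N p with i | i
  · exact le_max_of_le_left (dist_le_pi_dist y y' i)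
  · exact le_max_of_le_right (dist_le_pi_dist r r' i)

lemma lipschitz_mnr : LipschitzWith 1 (mnr : (Fin (N + 1) × Fin (N + 1) → ℝ) → _) := by
  refine LipschitzWith.of_dist_le_mul fun x x' => ?_
  rw [NNReal.coe_one, one_mul]
  exact (dist_pi_le_iff dist_nonneg).2 fun p => dist_le_pi_dist x x' _

/-- A linear combination of the interlacing gaps of the last two rows. -/
def gapSum (v : Fin N → ℝ) (x : Fin (N + 1) × Fin (N + 1) → ℝ) : ℝ :=
  ∑ j, v j * (ev x j.castSucc - ev (mnr x) j)

lemma exists_lipschitz_gapSum (v : Fin N → ℝ) : ∃ L, LipschitzWith L (gapSum v) :=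
  exists_lipschitz_sum _ v fun j => ⟨_, (ev_lipschitz j.castSucc).sub (lipschitz_ev_mnr j)⟩

lemma lipschitz_comp_asm {f : (Fin (N + 1) × Fin (N + 1) → ℝ) → ℝ} {L : NNReal}
    (h : LipschitzWith L f) (y : Fin N × Fin N → ℝ) : LipschitzWith L fun r => f (asm y r) := by
  refine LipschitzWith.of_dist_le_mul fun r r' => (h.dist_le_mul _ _).trans ?_
  refine mul_le_mul_of_nonneg_left ((dist_asm_le y y r r').trans ?_) (NNReal.coe_nonneg L)
  simp

lemma lipschitz_comp_asm' {f : (Fin (N + 1) × Fin (N + 1) → ℝ) → ℝ} {L : NNReal}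
    (h : LipschitzWith L f) (r : (Fin N × Fin 2) ⊕ Unit → ℝ) :
    LipschitzWith L fun y => f (asm y r) := by
  refine LipschitzWith.of_dist_le_mul fun y y' => (h.dist_le_mul _ _).trans ?_
  refine mul_le_mul_of_nonneg_left ((dist_asm_le y y' r r).trans ?_) (NNReal.coe_nonneg L)
  simp

lemma integrable_comp_asm {f : (Fin (N + 1) × Fin (N + 1) → ℝ) → ℝ} {L : NNReal}
    (h : LipschitzWith L f) (y : Fin N × Fin N → ℝ) :
    Integrable (fun r => f (asm y r)) (stdGauss ((Fin N × Fin 2) ⊕ Unit)) :=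
  (memLp_two_of_lipschitz (lipschitz_comp_asm h y)).integrable one_le_two

/-- Averaging over the last row. -/
def rowAvg (f : (Fin (N + 1) × Fin (N + 1) → ℝ) → ℝ) (y : Fin N × Fin N → ℝ) : ℝ :=
  ∫ r, f (asm y r) ∂stdGauss ((Fin N × Fin 2) ⊕ Unit)

lemma lipschitz_rowAvg {f : (Fin (N + 1) × Fin (N + 1) → ℝ) → ℝ} {L : NNReal}
    (h : LipschitzWith L f) : LipschitzWith L (rowAvg f) := by
  refine LipschitzWith.of_dist_le_mul fun y y' => ?_
  rw [rowAvg, rowAvg, Real.dist_eq,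
    ← integral_sub (integrable_comp_asm h y) (integrable_comp_asm h y')]
  have := norm_integral_le_of_norm_le_const (μ := stdGauss ((Fin N × Fin 2) ⊕ Unit))
    (f := fun r => f (asm y r) - f (asm y' r)) (C := L * dist y y')
    (Filter.Eventually.of_forall fun r => ?_)
  · rwa [probReal_univ, mul_one] at this
  exact (lipschitz_comp_asm' h r).dist_le_mul y y'

lemma integral_rowAvg {f : (Fin (N + 1) × Fin (N + 1) → ℝ) → ℝ} {L : NNReal}
    (h : LipschitzWith L f) : ∫ y, rowAvg f y ∂stdGauss (Fin N × Fin N) =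
      ∫ x, f x ∂stdGauss (Fin (N + 1) × Fin (N + 1)) :=
  (integral_asm ((memLp_two_of_lipschitz h).integrable one_le_two)).symm

lemma integral_mnr {G : (Fin N × Fin N → ℝ) → ℝ}
    (hG : AEStronglyMeasurable G (stdGauss (Fin N × Fin N))) :
    ∫ x, G (mnr x) ∂stdGauss (Fin (N + 1) × Fin (N + 1)) = ∫ y, G y ∂stdGauss (Fin N × Fin N) := by
  have h := measurePreserving_mnr (N := N)
  rw [← integral_map h.measurable.aemeasurable (by rwa [h.map_eq]), h.map_eq]

/-- The law of total variance. -/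
lemma integral_sub_sq_eq {f : (Fin (N + 1) × Fin (N + 1) → ℝ) → ℝ} {L : NNReal}
    (h : LipschitzWith L f) (c : ℝ) :
    ∫ x, (f x - c) ^ 2 ∂stdGauss (Fin (N + 1) × Fin (N + 1)) =
      (∫ y, ∫ r, (f (asm y r) - rowAvg f y) ^ 2 ∂stdGauss ((Fin N × Fin 2) ⊕ Unit)
        ∂stdGauss (Fin N × Fin N)) + ∫ y, (rowAvg f y - c) ^ 2 ∂stdGauss (Fin N × Fin N) := by
  have hg := lipschitz_rowAvg h
  have m1 : MemLp (fun x => f x - rowAvg f (mnr x)) 2 (stdGauss (Fin (N + 1) × Fin (N + 1))) :=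
    memLp_two_of_lipschitz (h.sub (hg.comp lipschitz_mnr))
  have m2 : MemLp (fun x : Fin (N + 1) × Fin (N + 1) → ℝ => rowAvg f (mnr x) - c) 2
      (stdGauss (Fin (N + 1) × Fin (N + 1))) :=
    memLp_two_of_lipschitz ((hg.comp lipschitz_mnr).sub (LipschitzWith.const c))
  have m3 : Integrable (fun x => (f x - rowAvg f (mnr x)) * (rowAvg f (mnr x) - c))
      (stdGauss (Fin (N + 1) × Fin (N + 1))) := m1.integrable_mul m2
  have h1 : ∫ x, (f x - c) ^ 2 ∂stdGauss (Fin (N + 1) × Fin (N + 1)) =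
      (∫ x, (f x - rowAvg f (mnr x)) ^ 2 ∂stdGauss (Fin (N + 1) × Fin (N + 1))) +
      2 * (∫ x, (f x - rowAvg f (mnr x)) * (rowAvg f (mnr x) - c)
        ∂stdGauss (Fin (N + 1) × Fin (N + 1))) +
      ∫ x, (rowAvg f (mnr x) - c) ^ 2 ∂stdGauss (Fin (N + 1) × Fin (N + 1)) := by
    rw [← integral_const_mul, ← integral_add m1.integrable_sq (m3.const_mul 2),
      ← integral_add (m1.integrable_sq.fun_add (m3.const_mul 2)) m2.integrable_sq]
    refine integral_congr_ae (Filter.Eventually.of_forall fun x => ?_)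
    ring
  have h2 : ∫ x, (f x - rowAvg f (mnr x)) * (rowAvg f (mnr x) - c)
        ∂stdGauss (Fin (N + 1) × Fin (N + 1)) = 0 := by
    rw [integral_asm m3]
    simp only [mnr_asm, integral_mul_const]
    refine integral_eq_zero_of_ae (Filter.Eventually.of_forall fun y => ?_)
    have : ∫ r, (f (asm y r) - rowAvg f y) ∂stdGauss ((Fin N × Fin 2) ⊕ Unit) = 0 := by
      rw [integral_sub (integrable_comp_asm h y) (integrable_const _)]
      simp [rowAvg]
    simp [this]
  have h3 : ∫ x, (rowAvg f (mnr x) - c) ^ 2 ∂stdGauss (Fin (N + 1) × Fin (N + 1)) =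
      ∫ y, (rowAvg f y - c) ^ 2 ∂stdGauss (Fin N × Fin N) := by
    have hc : Continuous fun y => (rowAvg f y - c) ^ 2 :=
      (hg.continuous.sub continuous_const).pow 2
    exact integral_mnr hc.aestronglyMeasurable
  rw [h1, h2, h3, integral_asm m1.integrable_sq]
  simp

lemma abs_evLast_le (j : Fin (N + 1)) (x : Fin (N + 1) × Fin (N + 1) → ℝ) :
    |evLast j x| ≤ evK (N + 1) * ‖eLast N‖ :=
  abs_fderiv_le_of_lipschitz (ev_lipschitz j) _ _

lemma memLp_evLast (j : Fin (N + 1)) :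
    MemLp (evLast j) 2 (stdGauss (Fin (N + 1) × Fin (N + 1))) :=
  MemLp.of_bound (measurable_evLast j).aestronglyMeasurable _
    (Filter.Eventually.of_forall (abs_evLast_le j))

lemma integral_evLast_le (j : Fin (N + 1)) :
    ∫ x, evLast j x ∂stdGauss (Fin (N + 1) × Fin (N + 1)) ≤
      Real.sqrt gaussFour / ((N : ℝ) + 1) := by
  have h1 := integral_mul_sq_le (memLp_evLast j) (memLp_const (1 : ℝ))
  simp only [mul_one, one_pow, integral_const, probReal_univ, smul_eq_mul] at h1
  have h2 := h1.trans (integral_evLast_sq_le j)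
  refine Real.le_sqrt_of_sq_le h2 |>.trans ?_
  rw [Real.sqrt_div gaussFour_nonneg, Real.sqrt_sq (by positivity)]

lemma sum_fderiv_gapSum_sq_le (v : Fin N → ℝ) {y : Fin N × Fin N → ℝ}
    {r : (Fin N × Fin 2) ⊕ Unit → ℝ} (hx : Good (asm y r)) :
    ∑ i, (fderiv ℝ (fun r => gapSum v (asm y r)) r (Pi.single i 1)) ^ 2 ≤
      2 * ∑ j, v j ^ 2 * evLast j.castSucc (asm y r) := by
  obtain ⟨U, hU⟩ := exists_sys (asm y r)
  have h0 : HasFDerivAt (fun r => asm y r) (LinearMap.toContinuousLinearMap (asmSnd N)) r := by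
    simp only [asm_eq]
    exact (LinearMap.toContinuousLinearMap (asmSnd N)).hasFDerivAt.const_add _
  have h1 : ∀ i, fderiv ℝ (fun r => gapSum v (asm y r)) r (Pi.single i 1) =
      ∑ j : Fin N, v j * qf (asmSnd N (Pi.single i 1)) (U.col j.castSucc) := by
    intro i
    have h2 : HasFDerivAt (fun r => gapSum v (asm y r)) (∑ j : Fin N, v j •
        (fderiv ℝ (fun x => ev x j.castSucc) (asm y r)).comp
          (LinearMap.toContinuousLinearMap (asmSnd N))) r := by
      simp only [gapSum, mnr_asm]
      refine HasFDerivAt.fun_sum fun j _ => ?_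
      exact (((hx j.castSucc).hasFDerivAt.comp r h0).sub_const _).const_mul (v j)
    rw [h2.fderiv]
    simp only [ContinuousLinearMap.sum_apply, ContinuousLinearMap.smul_apply,
      ContinuousLinearMap.comp_apply, LinearMap.coe_toContinuousLinearMap', smul_eq_mul,
      fderiv_ev hx hU]
  have h3 := sum_qf_asmSnd_sq_le hU.unit
    (Fin.snoc (α := fun _ => ℝ) v 0)
  simp only [Fin.sum_univ_castSucc, Fin.snoc_castSucc, Fin.snoc_last] at h3
  simp only [h1, evLast_eq hx hU]
  simpa using h3

/-- The contribution of the last row to the variance. -/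
theorem integral_gapSum_row_le (v : Fin N → ℝ) :
    ∫ y, ∫ r, (gapSum v (asm y r) - rowAvg (gapSum v) y) ^ 2 ∂stdGauss ((Fin N × Fin 2) ⊕ Unit)
        ∂stdGauss (Fin N × Fin N) ≤
      2 * Real.sqrt gaussFour / ((N : ℝ) + 1) * ∑ j, v j ^ 2 := by
  obtain ⟨L, hL⟩ := exists_lipschitz_gapSum v
  have hi : Integrable (fun x => 2 * ∑ j : Fin N, v j ^ 2 * evLast j.castSucc x)
      (stdGauss (Fin (N + 1) × Fin (N + 1))) :=
    (integrable_finsetSum _ fun j _ =>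
      ((memLp_evLast j.castSucc).integrable one_le_two).const_mul _).const_mul 2
  have hia := integrable_asm hi
  calc _ ≤ ∫ y, ∫ r, 2 * ∑ j : Fin N, v j ^ 2 * evLast j.castSucc (asm y r)
          ∂stdGauss ((Fin N × Fin 2) ⊕ Unit) ∂stdGauss (Fin N × Fin N) := by
        refine integral_mono_of_nonneg (Filter.Eventually.of_forall fun y =>
          integral_nonneg fun r => sq_nonneg _) hia.integral_prod_left ?_
        filter_upwards [Measure.ae_ae_of_ae_prod (ae_asm ae_good), hia.prod_right_ae] with y hy hy2
        refine (gauss_poincare (lipschitz_comp_asm hL y)).trans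
          (integral_mono_of_nonneg (Filter.Eventually.of_forall fun r =>
            Finset.sum_nonneg fun _ _ => sq_nonneg _) hy2 ?_)
        filter_upwards [hy] with r hr
        exact sum_fderiv_gapSum_sq_le v hr
    _ = ∫ x, 2 * ∑ j : Fin N, v j ^ 2 * evLast j.castSucc x
          ∂stdGauss (Fin (N + 1) × Fin (N + 1)) := (integral_asm hi).symm
    _ = 2 * ∑ j : Fin N, v j ^ 2 * ∫ x, evLast j.castSucc x
          ∂stdGauss (Fin (N + 1) × Fin (N + 1)) := by
        rw [integral_const_mul, integral_finsetSum _ fun j _ =>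
          ((memLp_evLast j.castSucc).integrable one_le_two).const_mul _]
        simp only [integral_const_mul]
    _ ≤ 2 * ∑ j : Fin N, v j ^ 2 * (Real.sqrt gaussFour / ((N : ℝ) + 1)) := by
        gcongr with j
        exact integral_evLast_le _
    _ = _ := by rw [← Finset.sum_mul]; ring

end

section
open Matrix
variable {N : ℕ}

lemma measurePreserving_inl {κ κ' : Type*} [Fintype κ] [Fintype κ'] [DecidableEq κ]
    [DecidableEq κ'] : MeasurePreserving (LinearMap.funLeft ℝ ℝ (Sum.inl : κ → κ ⊕ κ'))
      (stdGauss (κ ⊕ κ')) (stdGauss κ) := by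
  refine ⟨(LinearMap.continuous_of_finiteDimensional _).measurable,
    stdGauss_map_linear _ fun t => ?_⟩
  rw [Fintype.sum_sum_type]
  simp [LinearMap.funLeft, Pi.single_apply]

lemma measurable_rowAvg {g : (Fin (N + 1) × Fin (N + 1) → ℝ) → ℝ} (hg : Measurable g) :
    Measurable (rowAvg g) :=
  ((hg.comp measurable_asm).stronglyMeasurable.integral_prod_right').measurable

/-- The points where both the matrix and its minor have differentiable eigenvalues, for almost
every choice of the last row. -/
def GoodMnr (y : Fin N × Fin N → ℝ) : Prop :=
  Good y ∧ ∀ᵐ r ∂stdGauss ((Fin N × Fin 2) ⊕ Unit), Good (asm y r)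

lemma ae_goodMnr : ∀ᵐ y ∂stdGauss (Fin N × Fin N), GoodMnr y :=
  ae_good.and (Measure.ae_ae_of_ae_prod (ae_asm ae_good))

section pointwise
variable {y : Fin N × Fin N → ℝ} {r : (Fin N × Fin 2) ⊕ Unit → ℝ}

lemma ovl_nonneg (hx : Good (asm y r)) (hy : Good y) (j k : Fin N) : 0 ≤ ovl j k (asm y r) := by
  obtain ⟨U, hU⟩ := exists_sys (asm y r)
  obtain ⟨W, hW⟩ := exists_sys y
  rw [ovl_eq hx hy hU hW]
  exact Complex.normSq_nonneg _

lemma sum_ovl (hx : Good (asm y r)) (hy : Good y) (j : Fin N) :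
    ∑ k, ovl j k (asm y r) = 1 - evLast j.castSucc (asm y r) := by
  obtain ⟨U, hU⟩ := exists_sys (asm y r)
  obtain ⟨W, hW⟩ := exists_sys y
  simp only [ovl_eq hx hy hU hW, evLast_eq hx hU]
  exact sum_overlap hU hW _

lemma evLast_nonneg (hx : Good (asm y r)) (j : Fin (N + 1)) : 0 ≤ evLast j (asm y r) := by
  obtain ⟨U, hU⟩ := exists_sys (asm y r)
  rw [evLast_eq hx hU]
  exact Complex.normSq_nonneg _

lemma ovl_le_one (hx : Good (asm y r)) (hy : Good y) (j k : Fin N) : ovl j k (asm y r) ≤ 1 := by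
  have h1 := Finset.single_le_sum (f := fun k => ovl j k (asm y r))
    (fun k _ => ovl_nonneg hx hy j k) (Finset.mem_univ k)
  have h2 := sum_ovl hx hy j
  have h3 := evLast_nonneg hx j.castSucc
  linarith

lemma abs_ovl_le_one (hx : Good (asm y r)) (hy : Good y) (j k : Fin N) :
    |ovl j k (asm y r)| ≤ 1 := by
  rw [abs_of_nonneg (ovl_nonneg hx hy j k)]
  exact ovl_le_one hx hy j k

end pointwise

section avg
variable {y : Fin N × Fin N → ℝ}

lemma measurable_asm_right (y : Fin N × Fin N → ℝ) :
    Measurable fun r : (Fin N × Fin 2) ⊕ Unit → ℝ => asm y r :=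
  measurable_asm.comp measurable_prodMk_left

lemma integrable_ovl_asm (hy : GoodMnr y) (j k : Fin N) :
    Integrable (fun r => ovl j k (asm y r)) (stdGauss ((Fin N × Fin 2) ⊕ Unit)) :=
  Integrable.of_bound ((measurable_ovl j k).comp (measurable_asm_right y)).aestronglyMeasurable 1
    (hy.2.mono fun r hr => abs_ovl_le_one hr hy.1 j k)

lemma integrable_evLast_asm (y : Fin N × Fin N → ℝ) (j : Fin (N + 1)) :
    Integrable (fun r => evLast j (asm y r)) (stdGauss ((Fin N × Fin 2) ⊕ Unit)) :=
  Integrable.of_bound ((measurable_evLast j).comp (measurable_asm_right y)).aestronglyMeasurable _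
    (Filter.Eventually.of_forall fun r => abs_evLast_le j _)

lemma memLp_evLast_asm (y : Fin N × Fin N → ℝ) (j : Fin (N + 1)) :
    MemLp (fun r => evLast j (asm y r)) 2 (stdGauss ((Fin N × Fin 2) ⊕ Unit)) :=
  MemLp.of_bound ((measurable_evLast j).comp (measurable_asm_right y)).aestronglyMeasurable _
    (Filter.Eventually.of_forall fun r => abs_evLast_le j _)

lemma rowAvg_ovl_nonneg (hy : GoodMnr y) (j k : Fin N) : 0 ≤ rowAvg (ovl j k) y :=
  integral_nonneg_of_ae (hy.2.mono fun r hr => ovl_nonneg hr hy.1 j k)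

lemma sum_rowAvg_ovl (hy : GoodMnr y) (j : Fin N) :
    ∑ k, rowAvg (ovl j k) y = 1 - rowAvg (evLast j.castSucc) y := by
  simp only [rowAvg]
  rw [← integral_finsetSum _ fun k _ => integrable_ovl_asm hy j k,
    integral_congr_ae (hy.2.mono fun r hr => sum_ovl hr hy.1 j),
    integral_sub (integrable_const _) (integrable_evLast_asm y _)]
  simp

lemma rowAvg_evLast_nonneg (hy : GoodMnr y) (j : Fin (N + 1)) : 0 ≤ rowAvg (evLast j) y :=
  integral_nonneg_of_ae (hy.2.mono fun r hr => evLast_nonneg hr j)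

lemma sum_rowAvg_ovl_le_one (hy : GoodMnr y) (j : Fin N) : ∑ k, rowAvg (ovl j k) y ≤ 1 := by
  rw [sum_rowAvg_ovl hy]
  linarith [rowAvg_evLast_nonneg hy j.castSucc]

lemma abs_rowAvg_ovl_le_one (hy : GoodMnr y) (j k : Fin N) : |rowAvg (ovl j k) y| ≤ 1 := by
  rw [abs_of_nonneg (rowAvg_ovl_nonneg hy j k)]
  exact (Finset.single_le_sum (f := fun k => rowAvg (ovl j k) y)
    (fun k _ => rowAvg_ovl_nonneg hy j k) (Finset.mem_univ k)).trans (sum_rowAvg_ovl_le_one hy j)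

lemma rowAvg_evLast_sq_le (y : Fin N × Fin N → ℝ) (j : Fin (N + 1)) :
    rowAvg (evLast j) y ^ 2 ≤ rowAvg (fun x => evLast j x ^ 2) y := by
  have h1 := integral_mul_sq_le (memLp_evLast_asm y j) (memLp_const (1 : ℝ))
  simp only [mul_one, one_pow, integral_const, probReal_univ, smul_eq_mul] at h1
  exact h1

lemma lipschitz_gap (j : Fin N) : LipschitzWith (evK (N + 1) + evK N)
    fun x : Fin (N + 1) × Fin (N + 1) → ℝ => ev x j.castSucc - ev (mnr x) j :=
  (ev_lipschitz j.castSucc).sub (lipschitz_ev_mnr j)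

/-- A bound for the mean squared displacement of the minor's spectrum seen from an eigenvector. -/
def rowBd (j : Fin N) (y : Fin N × Fin N → ℝ) : ℝ :=
  ((N : ℝ) + 1) / 2 * rowAvg (fun x => evLast j.castSucc x ^ 2) y +
    2 * rowAvg (fun x => (ev x j.castSucc - ev (mnr x) j) ^ 2) y + 2 * gaussFour / ((N : ℝ) + 1)

lemma rowAvg_ovl_mul_sq_le (hy : GoodMnr y) (j k : Fin N) :
    rowAvg (ovl j k) y * (ev y j - ev y k) ^ 2 ≤ rowBd j y := by
  obtain ⟨W, hW⟩ := exists_sys y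
  set b : ((Fin N × Fin 2) ⊕ Unit → ℝ) → ℝ := fun r =>
    Complex.normSq (star (W.col k) ⬝ᵥ zv (LinearMap.funLeft ℝ ℝ Sum.inl r)) with hb
  have hn : (0 : ℝ) < (N : ℝ) + 1 := by positivity
  have hbi : Integrable (fun r => b r ^ 2) (stdGauss ((Fin N × Fin 2) ⊕ Unit)) :=
    (measurePreserving_inl (κ := Fin N × Fin 2) (κ' := Unit)).integrable_comp_of_integrable
      (integrable_dot_zv (W.col k) 2)
  have hbe : ∫ r, b r ^ 2 ∂stdGauss ((Fin N × Fin 2) ⊕ Unit) ≤ 4 * gaussFour := by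
    have hp := measurePreserving_inl (κ := Fin N × Fin 2) (κ' := Unit)
    refine le_trans (le_of_eq ?_) (integral_dot_zv_sq_le (u := W.col k) (hW.nsq_col k))
    rw [← hp.map_eq, integral_map hp.measurable.aemeasurable]
    rw [hp.map_eq]
    exact (integrable_dot_zv (W.col k) 2).aestronglyMeasurable
  have hgi : Integrable (fun r => (ev (asm y r) j.castSucc - ev y j) ^ 2)
      (stdGauss ((Fin N × Fin 2) ⊕ Unit)) := by
    have := (memLp_two_of_lipschitz (lipschitz_comp_asm (lipschitz_gap j) y)).integrable_sq
    simpa only [mnr_asm] using this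
  have hpi := (memLp_evLast_asm y j.castSucc).integrable_sq
  have hpt : ∀ r, Good (asm y r) → ovl j k (asm y r) * (ev y j - ev y k) ^ 2 ≤
      (((N : ℝ) + 1) / 2 * evLast j.castSucc (asm y r) ^ 2 +
        2 * (ev (asm y r) j.castSucc - ev y j) ^ 2) + 1 / (2 * ((N : ℝ) + 1)) * b r ^ 2 := by
    intro r hr
    obtain ⟨U, hU⟩ := exists_sys (asm y r)
    have h1 : ovl j k (asm y r) * (ev (asm y r) j.castSucc - ev y k) ^ 2 =
        evLast j.castSucc (asm y r) * (b r / 2) := by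
      rw [ovl_eq hr hy.1 hU hW, evLast_eq hr hU]
      exact overlap_mul_sq hU hW _ _
    have h0 := ovl_nonneg hr hy.1 j k
    have h2 := ovl_le_one hr hy.1 j k
    have h3 : evLast j.castSucc (asm y r) * b r ≤ ((N : ℝ) + 1) / 2 * evLast j.castSucc (asm y r) ^ 2
        + 1 / (2 * ((N : ℝ) + 1)) * b r ^ 2 := by
      have : 0 ≤ 1 / (2 * ((N : ℝ) + 1)) *
          (((N : ℝ) + 1) * evLast j.castSucc (asm y r) - b r) ^ 2 := by positivity
      have h4 : 1 / (2 * ((N : ℝ) + 1)) *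
          (((N : ℝ) + 1) * evLast j.castSucc (asm y r) - b r) ^ 2 =
          ((N : ℝ) + 1) / 2 * evLast j.castSucc (asm y r) ^ 2
        + 1 / (2 * ((N : ℝ) + 1)) * b r ^ 2 - evLast j.castSucc (asm y r) * b r := by
        field_simp; ring
      linarith
    have h5 : (ev y j - ev y k) ^ 2 ≤ 2 * (ev (asm y r) j.castSucc - ev y k) ^ 2 +
        2 * (ev (asm y r) j.castSucc - ev y j) ^ 2 := by
      nlinarith [sq_nonneg (ev (asm y r) j.castSucc - ev y k +
        (ev (asm y r) j.castSucc - ev y j))]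
    have h6 := mul_le_mul_of_nonneg_left h5 h0
    have h7 := mul_le_mul_of_nonneg_right h2 (sq_nonneg (ev (asm y r) j.castSucc - ev y j))
    linarith
  rw [rowAvg, ← integral_mul_const]
  have hi1 := (hpi.const_mul (((N : ℝ) + 1) / 2)).fun_add (hgi.const_mul 2)
  refine (integral_mono_ae ((integrable_ovl_asm hy j k).mul_const _)
    (hi1.fun_add (hbi.const_mul (1 / (2 * ((N : ℝ) + 1))))) (hy.2.mono hpt)).trans ?_
  rw [integral_add hi1 (hbi.const_mul _), integral_add (hpi.const_mul _) (hgi.const_mul _),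
    integral_const_mul, integral_const_mul, integral_const_mul]
  simp only [rowBd, rowAvg, mnr_asm]
  have : 1 / (2 * ((N : ℝ) + 1)) * ∫ r, b r ^ 2 ∂stdGauss ((Fin N × Fin 2) ⊕ Unit) ≤
      2 * gaussFour / ((N : ℝ) + 1) := by
    refine (mul_le_mul_of_nonneg_left hbe (by positivity)).trans_eq ?_
    field_simp; ring
  linarith

lemma sum_rowAvg_ovl_sq_le (hy : GoodMnr y) (j : Fin N) (s : Finset (Fin N)) :
    ∑ k ∈ s, (rowAvg (ovl j k) y * (ev y j - ev y k)) ^ 2 ≤ rowBd j y := by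
  have h0 : 0 ≤ rowBd j y := by
    refine le_trans ?_ (rowAvg_ovl_mul_sq_le hy j j)
    simp
  calc ∑ k ∈ s, (rowAvg (ovl j k) y * (ev y j - ev y k)) ^ 2
      ≤ ∑ k, (rowAvg (ovl j k) y * (ev y j - ev y k)) ^ 2 :=
        Finset.sum_le_sum_of_subset_of_nonneg (Finset.subset_univ _) fun _ _ _ => sq_nonneg _
    _ ≤ ∑ k, rowAvg (ovl j k) y * rowBd j y := by
        refine Finset.sum_le_sum fun k _ => ?_
        have := mul_le_mul_of_nonneg_left (rowAvg_ovl_mul_sq_le hy j k) (rowAvg_ovl_nonneg hy j k)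
        calc _ = rowAvg (ovl j k) y * (rowAvg (ovl j k) y * (ev y j - ev y k) ^ 2) := by ring
          _ ≤ _ := this
    _ ≤ rowBd j y := by
        rw [← Finset.sum_mul]
        exact mul_le_of_le_one_left h0 (sum_rowAvg_ovl_le_one hy j)

end avg

lemma integrable_rowAvg {f : (Fin (N + 1) × Fin (N + 1) → ℝ) → ℝ}
    (hf : Integrable f (stdGauss (Fin (N + 1) × Fin (N + 1)))) :
    Integrable (rowAvg f) (stdGauss (Fin N × Fin N)) :=
  (integrable_asm hf).integral_prod_left

lemma integrable_rowBd (j : Fin N) : Integrable (rowBd j) (stdGauss (Fin N × Fin N)) :=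
  (((integrable_rowAvg (memLp_evLast j.castSucc).integrable_sq).const_mul _).fun_add
    ((integrable_rowAvg (memLp_two_of_lipschitz (lipschitz_gap j)).integrable_sq).const_mul 2)).fun_add
      (integrable_const _)

lemma integral_rowBd_le {K : ℕ} (j : Fin N) (h1 : N + 1 ≤ K * j) (h2 : N + 1 ≤ K * (N - j)) :
    ∫ y, rowBd j y ∂stdGauss (Fin N × Fin N) ≤ (3 * gaussFour + 512 * K ^ 3) / ((N : ℝ) + 1) := by
  have hn : (0 : ℝ) < (N : ℝ) + 1 := by positivity
  have i1 := (memLp_evLast j.castSucc).integrable_sq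
  have i2 := (memLp_two_of_lipschitz (lipschitz_gap j)).integrable_sq
  have e1 := integral_evLast_sq_le j.castSucc
  have e2 := integral_sq_gap_bulk j h1 h2
  simp only [rowBd]
  rw [integral_add (((integrable_rowAvg i1).const_mul _).fun_add ((integrable_rowAvg i2).const_mul 2))
    (integrable_const _), integral_add ((integrable_rowAvg i1).const_mul _)
    ((integrable_rowAvg i2).const_mul 2), integral_const_mul, integral_const_mul]
  simp only [rowAvg]
  rw [← integral_asm i1, ← integral_asm i2, integral_const, probReal_univ, one_smul, le_div_iff₀ hn]
  have e3 : ((N : ℝ) + 1) / 2 * (∫ x, evLast j.castSucc x ^ 2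
      ∂stdGauss (Fin (N + 1) × Fin (N + 1))) * ((N : ℝ) + 1) ≤ gaussFour / 2 := by
    rw [le_div_iff₀ (by positivity)] at e1
    linarith
  have e4 : 2 * gaussFour / ((N : ℝ) + 1) * ((N : ℝ) + 1) = 2 * gaussFour := by field_simp
  have := gaussFour_nonneg
  rw [add_mul, add_mul, e4]
  linarith

end

section
open Matrix MvPolynomial
variable {N : ℕ}

section
variable {u : MvPolynomial (Fin N × Fin N) ℝ} (hu : ∀ k ∈ unitSet N, polyComp k u = u)
include hu

/-- The derivative of the gaps along the gradient of an invariant polynomial. -/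
lemma fderiv_gapSum_polyGrad (v : Fin N → ℝ) {y : Fin N × Fin N → ℝ}
    {r : (Fin N × Fin 2) ⊕ Unit → ℝ} (hx : Good (asm y r)) (hy : Good y) :
    fderiv ℝ (fun y => gapSum v (asm y r)) y (polyGrad u y) =
      ∑ j, v j * ((∑ k, ovl j k (asm y r) * evGrad u k y) - evGrad u j y) := by
  obtain ⟨W, hW⟩ := exists_sys y
  have h0 : HasFDerivAt (fun y => asm y r) (LinearMap.toContinuousLinearMap (asmFst N)) y := by
    simp only [asm_eq]
    exact (LinearMap.toContinuousLinearMap (asmFst N)).hasFDerivAt.add_const _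
  have h2 : HasFDerivAt (fun y => gapSum v (asm y r)) (∑ j : Fin N, v j •
      ((fderiv ℝ (fun x => ev x j.castSucc) (asm y r)).comp
        (LinearMap.toContinuousLinearMap (asmFst N)) - fderiv ℝ (fun x => ev x j) y)) y := by
    simp only [gapSum, mnr_asm]
    refine HasFDerivAt.fun_sum fun j _ => ?_
    exact (((hx j.castSucc).hasFDerivAt.comp y h0).sub (hy j).hasFDerivAt).const_mul (v j)
  have h3 : polyGrad u y = ∑ k, evGrad u k y • evVec k y := by
    rw [polyGrad_eq_sum hu hW hy.injective]
    exact Finset.sum_congr rfl fun k _ => by rw [evGrad_eq u hy hW, evVec_eq hy hW]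
  rw [h2.fderiv]
  simp only [ContinuousLinearMap.sum_apply, ContinuousLinearMap.smul_apply,
    ContinuousLinearMap.sub_apply, ContinuousLinearMap.comp_apply,
    LinearMap.coe_toContinuousLinearMap', smul_eq_mul]
  refine Finset.sum_congr rfl fun j _ => ?_
  congr 2
  conv_lhs => rw [h3]
  rw [map_sum, map_sum]
  refine Finset.sum_congr rfl fun k _ => ?_
  rw [map_smul, map_smul, ovl, mnr_asm, smul_eq_mul, mul_comm]

lemma integrable_ovl_mul_evGrad (j k : Fin N) :
    Integrable (fun q : (Fin N × Fin N → ℝ) × ((Fin N × Fin 2) ⊕ Unit → ℝ) =>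
      ovl j k (asm q.1 q.2) * evGrad u k q.1)
      ((stdGauss (Fin N × Fin N)).prod (stdGauss ((Fin N × Fin 2) ⊕ Unit))) := by
  have hi : Integrable (fun q : (Fin N × Fin N → ℝ) × ((Fin N × Fin 2) ⊕ Unit → ℝ) =>
      evGrad u k q.1) ((stdGauss (Fin N × Fin N)).prod (stdGauss ((Fin N × Fin 2) ⊕ Unit))) :=
    ((memLp_evGrad hu k).integrable one_le_two).comp_fst _
  have hm : Measurable fun q : (Fin N × Fin N → ℝ) × ((Fin N × Fin 2) ⊕ Unit → ℝ) =>
      ovl j k (asm q.1 q.2) := (measurable_ovl j k).comp measurable_asm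
  refine hi.bdd_mul (c := 1) hm.aestronglyMeasurable ?_
  filter_upwards [ae_asm (ae_good (N := N + 1)),
    Measure.quasiMeasurePreserving_fst.ae (ae_good (N := N))] with q h1 h2
  exact abs_ovl_le_one h1 h2 j k

lemma integral_rowAvg_gapSum_mul_ouGen (v : Fin N → ℝ) :
    ∫ y, rowAvg (gapSum v) y * eval y (ouGen u) ∂stdGauss (Fin N × Fin N) =
      ∫ y, ∑ j, v j * ((∑ k, rowAvg (ovl j k) y * evGrad u k y) - evGrad u j y)
        ∂stdGauss (Fin N × Fin N) := by
  set μ := stdGauss (Fin N × Fin N)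
  set ν := stdGauss ((Fin N × Fin 2) ⊕ Unit)
  obtain ⟨L, hL⟩ := exists_lipschitz_gapSum v
  have hf2 : MemLp (fun q : (Fin N × Fin N → ℝ) × ((Fin N × Fin 2) ⊕ Unit → ℝ) =>
      gapSum v (asm q.1 q.2)) 2 (μ.prod ν) :=
    (memLp_two_of_lipschitz hL).comp_measurePreserving measurePreserving_asm
  have hp2 : MemLp (fun q : (Fin N × Fin N → ℝ) × ((Fin N × Fin 2) ⊕ Unit → ℝ) =>
      eval q.1 (ouGen u)) 2 (μ.prod ν) :=
    (memLp_poly (ouGen u)).comp_measurePreserving measurePreserving_fst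
  have hi1 : Integrable (fun q : (Fin N × Fin N → ℝ) × ((Fin N × Fin 2) ⊕ Unit → ℝ) =>
      gapSum v (asm q.1 q.2) * eval q.1 (ouGen u)) (μ.prod ν) := hf2.integrable_mul hp2
  have hig : ∀ j, Integrable (fun q : (Fin N × Fin N → ℝ) × ((Fin N × Fin 2) ⊕ Unit → ℝ) =>
      evGrad u j q.1) (μ.prod ν) := fun j =>
    ((memLp_evGrad hu j).integrable one_le_two).comp_fst _
  have hi2 : Integrable (fun q : (Fin N × Fin N → ℝ) × ((Fin N × Fin 2) ⊕ Unit → ℝ) =>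
      ∑ j, v j * ((∑ k, ovl j k (asm q.1 q.2) * evGrad u k q.1) - evGrad u j q.1)) (μ.prod ν) :=
    integrable_finsetSum _ fun j _ => ((integrable_finsetSum _ fun k _ =>
      integrable_ovl_mul_evGrad hu j k).sub (hig j)).const_mul (v j)
  calc _ = ∫ y, ∫ r, gapSum v (asm y r) * eval y (ouGen u) ∂ν ∂μ := by
        simp only [integral_mul_const]; rfl
    _ = ∫ r, ∫ y, gapSum v (asm y r) * eval y (ouGen u) ∂μ ∂ν := integral_integral_swap hi1
    _ = ∫ r, ∫ y, ∑ j, v j * ((∑ k, ovl j k (asm y r) * evGrad u k y) - evGrad u j y) ∂μ ∂ν := by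
        have hae : ∀ᵐ q ∂(ν.prod μ), Good (asm q.2 q.1) ∧ Good q.2 :=
          ((Measure.measurePreserving_swap (μ := ν) (ν := μ)).quasiMeasurePreserving.ae
            (ae_asm (ae_good (N := N + 1)))).and
            (Measure.quasiMeasurePreserving_snd.ae (ae_good (N := N)))
        refine integral_congr_ae ?_
        filter_upwards [Measure.ae_ae_of_ae_prod hae] with r hr
        rw [integral_mul_ouGen (lipschitz_comp_asm' hL r)]
        refine integral_congr_ae (hr.mono fun y hy => ?_)
        exact fderiv_gapSum_polyGrad hu v hy.1 hy.2
    _ = ∫ y, ∫ r, ∑ j, v j * ((∑ k, ovl j k (asm y r) * evGrad u k y) - evGrad u j y) ∂ν ∂μ :=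
        (integral_integral_swap hi2).symm
    _ = _ := by
        refine integral_congr_ae ?_
        filter_upwards [ae_goodMnr] with y hy
        have hs : ∀ j, Integrable (fun r => ∑ k, ovl j k (asm y r) * evGrad u k y) ν := fun j =>
          integrable_finsetSum _ fun k _ => (integrable_ovl_asm hy j k).mul_const _
        have hs2 : ∀ j, Integrable (fun r =>
            v j * ((∑ k, ovl j k (asm y r) * evGrad u k y) - evGrad u j y)) ν := fun j =>
          ((hs j).sub (integrable_const _)).const_mul _
        rw [integral_finsetSum _ fun j _ => hs2 j]
        refine Finset.sum_congr rfl fun j _ => ?_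
        rw [integral_const_mul, integral_sub (hs j) (integrable_const _), integral_finsetSum _
          fun k _ => (integrable_ovl_asm hy j k).mul_const _]
        simp only [integral_mul_const, integral_const, probReal_univ, one_smul]
        rfl

omit hu in
lemma sum_rowAvg_ovl_mul_evGrad (v : Fin N → ℝ) {y : Fin N × Fin N → ℝ} (hy : GoodMnr y) :
    ∑ j, v j * ((∑ k, rowAvg (ovl j k) y * evGrad u k y) - evGrad u j y) =
      -((∑ j, ∑ k with k ≠ j, (v j * (rowAvg (ovl j k) y * (ev y j - ev y k))) *
          ((evGrad u j y - evGrad u k y) / (ev y j - ev y k))) +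
        ∑ j, (v j * rowAvg (evLast j.castSucc) y) * evGrad u j y) := by
  rw [← Finset.sum_add_distrib, ← Finset.sum_neg_distrib]
  refine Finset.sum_congr rfl fun j _ => ?_
  have h1 : ∑ k with k ≠ j, (v j * (rowAvg (ovl j k) y * (ev y j - ev y k))) *
          ((evGrad u j y - evGrad u k y) / (ev y j - ev y k)) =
      ∑ k, v j * (rowAvg (ovl j k) y * (evGrad u j y - evGrad u k y)) := by
    rw [Finset.sum_filter]
    refine Finset.sum_congr rfl fun k _ => ?_
    split_ifs with h
    · have : ev y j - ev y k ≠ 0 := sub_ne_zero.2 fun e => h (hy.1.injective e).symm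
      field_simp
    · rw [not_not.1 h]; simp
  have h2 := sum_rowAvg_ovl hy j
  rw [h1, ← Finset.mul_sum]
  simp only [mul_sub, Finset.sum_sub_distrib, ← Finset.sum_mul, h2]
  ring

omit hu in
lemma memLp_rowAvg_ovl_mul (v : Fin N → ℝ) (j k : Fin N) :
    MemLp (fun y => v j * (rowAvg (ovl j k) y * (ev y j - ev y k))) 2
      (stdGauss (Fin N × Fin N)) := by
  refine MemLp.const_mul (MemLp.of_le ((memLp_ev j).sub (memLp_ev k))
    ((measurable_rowAvg (measurable_ovl j k)).mul ((continuous_ev j).measurable.sub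
      (continuous_ev k).measurable)).aestronglyMeasurable ?_) (v j)
  filter_upwards [ae_goodMnr] with y hy
  change ‖rowAvg (ovl j k) y * (ev y j - ev y k)‖ ≤ ‖ev y j - ev y k‖
  rw [norm_mul]
  exact mul_le_of_le_one_left (norm_nonneg _) (abs_rowAvg_ovl_le_one hy j k)

omit hu in
lemma memLp_rowAvg_evLast (j : Fin (N + 1)) :
    MemLp (rowAvg (evLast j)) 2 (stdGauss (Fin N × Fin N)) := by
  refine MemLp.of_bound (measurable_rowAvg (measurable_evLast j)).aestronglyMeasurable
    (evK (N + 1) * ‖eLast N‖) (Filter.Eventually.of_forall fun y => ?_)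
  have := norm_integral_le_of_norm_le_const (μ := stdGauss ((Fin N × Fin 2) ⊕ Unit))
    (f := fun r => evLast j (asm y r)) (C := evK (N + 1) * ‖eLast N‖)
    (Filter.Eventually.of_forall fun r => abs_evLast_le j _)
  rwa [probReal_univ, mul_one] at this

omit hu in
lemma integral_rowAvg_evLast_sq_le (j : Fin (N + 1)) :
    ∫ y, rowAvg (evLast j) y ^ 2 ∂stdGauss (Fin N × Fin N) ≤ gaussFour / ((N : ℝ) + 1) ^ 2 := by
  refine le_trans ?_ (integral_evLast_sq_le j)
  rw [integral_asm (memLp_evLast j).integrable_sq]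
  exact integral_mono (memLp_rowAvg_evLast j).integrable_sq
    (integrable_rowAvg (memLp_evLast j).integrable_sq) fun y => rowAvg_evLast_sq_le y j

omit hu in
lemma integral_sum_rowAvg_ovl_mul_sq_le {K : ℕ} (v : Fin N → ℝ)
    (hv : ∀ j, v j ≠ 0 → N + 1 ≤ K * j ∧ N + 1 ≤ K * (N - j)) :
    ∫ y, ∑ j, ∑ k with k ≠ j, (v j * (rowAvg (ovl j k) y * (ev y j - ev y k))) ^ 2
        ∂stdGauss (Fin N × Fin N) ≤
      (3 * gaussFour + 512 * K ^ 3) / ((N : ℝ) + 1) * ∑ j, v j ^ 2 := by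
  calc _ ≤ ∫ y, ∑ j, v j ^ 2 * rowBd j y ∂stdGauss (Fin N × Fin N) := by
        refine integral_mono_ae (integrable_finsetSum _ fun j _ => integrable_finsetSum _ fun k _ =>
          (memLp_rowAvg_ovl_mul v j k).integrable_sq)
          (integrable_finsetSum _ fun j _ => (integrable_rowBd j).const_mul _) ?_
        filter_upwards [ae_goodMnr] with y hy
        refine Finset.sum_le_sum fun j _ => ?_
        simp only [mul_pow (v j), ← Finset.mul_sum]
        exact mul_le_mul_of_nonneg_left (sum_rowAvg_ovl_sq_le hy j _) (sq_nonneg _)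
    _ = ∑ j, v j ^ 2 * ∫ y, rowBd j y ∂stdGauss (Fin N × Fin N) := by
        rw [integral_finsetSum _ fun j _ => (integrable_rowBd j).const_mul _]
        simp only [integral_const_mul]
    _ ≤ ∑ j, v j ^ 2 * ((3 * gaussFour + 512 * K ^ 3) / ((N : ℝ) + 1)) := by
        refine Finset.sum_le_sum fun j _ => ?_
        by_cases h : v j = 0
        · simp [h]
        · exact mul_le_mul_of_nonneg_left (integral_rowBd_le j (hv j h).1 (hv j h).2)
            (sq_nonneg _)
    _ = _ := by rw [← Finset.sum_mul, mul_comm]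

omit hu in
lemma integral_sum_rowAvg_evLast_sq_le (v : Fin N → ℝ) :
    ∫ y, ∑ j, (v j * rowAvg (evLast j.castSucc) y) ^ 2 ∂stdGauss (Fin N × Fin N) ≤
      gaussFour / ((N : ℝ) + 1) * ∑ j, v j ^ 2 := by
  have hn : (0 : ℝ) < (N : ℝ) + 1 := by positivity
  rw [integral_finsetSum _ fun j _ =>
    ((memLp_rowAvg_evLast j.castSucc).const_mul (v j)).integrable_sq, Finset.mul_sum]
  refine Finset.sum_le_sum fun j _ => ?_
  simp only [mul_pow, integral_const_mul]
  rw [mul_comm]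
  refine mul_le_mul_of_nonneg_right ((integral_rowAvg_evLast_sq_le j.castSucc).trans ?_)
    (sq_nonneg _)
  refine div_le_div_of_nonneg_left gaussFour_nonneg hn ?_
  nlinarith [(Nat.cast_nonneg N : (0 : ℝ) ≤ N)]

omit hu in
lemma integral_sum_sum_mul_sq_le {Ω ι : Type*} [Fintype ι] [MeasurableSpace Ω] {μ : Measure Ω}
    {f g : ι → ι → Ω → ℝ} (s : ι → Finset ι) (hf : ∀ j, ∀ k ∈ s j, MemLp (f j k) 2 μ)
    (hg : ∀ j, ∀ k ∈ s j, MemLp (g j k) 2 μ) :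
    (∫ x, ∑ j, ∑ k ∈ s j, f j k x * g j k x ∂μ) ^ 2 ≤
      (∫ x, ∑ j, ∑ k ∈ s j, f j k x ^ 2 ∂μ) * ∫ x, ∑ j, ∑ k ∈ s j, g j k x ^ 2 ∂μ := by
  have := integral_sum_mul_sq_le (μ := μ) (Finset.univ.sigma s) (f := fun i => f i.1 i.2)
    (g := fun i => g i.1 i.2) (fun i hi => hf _ _ (Finset.mem_sigma.1 hi).2)
    (fun i hi => hg _ _ (Finset.mem_sigma.1 hi).2)
  simpa only [Finset.sum_sigma] using this

lemma integral_offDiag_sq_le {K : ℕ} (v : Fin N → ℝ)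
    (hv : ∀ j, v j ≠ 0 → N + 1 ≤ K * j ∧ N + 1 ≤ K * (N - j)) :
    (∫ y, ∑ j, ∑ k with k ≠ j, (v j * (rowAvg (ovl j k) y * (ev y j - ev y k))) *
      ((evGrad u j y - evGrad u k y) / (ev y j - ev y k)) ∂stdGauss (Fin N × Fin N)) ^ 2 ≤
      ((3 * gaussFour + 512 * K ^ 3) / ((N : ℝ) + 1) * ∑ j, v j ^ 2) *
        ∫ y, eval y (ouGen u) ^ 2 ∂stdGauss (Fin N × Fin N) := by
  have c1 := integral_sum_sum_mul_sq_le (μ := stdGauss (Fin N × Fin N))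
    (fun j : Fin N => Finset.univ.filter fun k => k ≠ j)
    (f := fun j k y => v j * (rowAvg (ovl j k) y * (ev y j - ev y k)))
    (g := fun j k y => (evGrad u j y - evGrad u k y) / (ev y j - ev y k))
    (fun j k _ => memLp_rowAvg_ovl_mul v j k)
    (fun j k hk => memLp_evDiv hu (Finset.mem_filter.1 hk).2.symm)
  have d1 := integral_evHess_le hu
  simp only [evHess] at d1
  have hg := gaussFour_nonneg
  have b1 := integral_sum_rowAvg_ovl_mul_sq_le v hv
  have hV : 0 ≤ (3 * gaussFour + 512 * K ^ 3) / ((N : ℝ) + 1) * ∑ j, v j ^ 2 :=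
    mul_nonneg (by positivity) (Finset.sum_nonneg fun _ _ => sq_nonneg _)
  refine c1.trans ?_
  refine le_trans (mul_le_mul_of_nonneg_right b1 ?_) (mul_le_mul_of_nonneg_left d1 hV)
  refine integral_nonneg fun y => ?_
  exact Finset.sum_nonneg fun _ _ => Finset.sum_nonneg fun _ _ => sq_nonneg _

lemma integral_diag_sq_le (v : Fin N → ℝ) :
    (∫ y, ∑ j, (v j * rowAvg (evLast j.castSucc) y) * evGrad u j y
      ∂stdGauss (Fin N × Fin N)) ^ 2 ≤
      (gaussFour / ((N : ℝ) + 1) * ∑ j, v j ^ 2) *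
        ∫ y, eval y (ouGen u) ^ 2 ∂stdGauss (Fin N × Fin N) := by
  have c2 := integral_sum_mul_sq_le (μ := stdGauss (Fin N × Fin N)) Finset.univ
    (f := fun j y => v j * rowAvg (evLast j.castSucc) y) (g := fun j y => evGrad u j y)
    (fun j _ => (memLp_rowAvg_evLast j.castSucc).const_mul (v j)) (fun j _ => memLp_evGrad hu j)
  have hg := gaussFour_nonneg
  exact c2.trans (mul_le_mul (integral_sum_rowAvg_evLast_sq_le v) (integral_sum_evGrad_sq_le hu)
    (integral_nonneg fun y => Finset.sum_nonneg fun _ _ => sq_nonneg _)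
    (mul_nonneg (by positivity) (Finset.sum_nonneg fun _ _ => sq_nonneg _)))

lemma integral_rowAvg_gapSum_mul_ouGen_sq_le {K : ℕ} (v : Fin N → ℝ)
    (hv : ∀ j, v j ≠ 0 → N + 1 ≤ K * j ∧ N + 1 ≤ K * (N - j)) :
    (∫ y, rowAvg (gapSum v) y * eval y (ouGen u) ∂stdGauss (Fin N × Fin N)) ^ 2 ≤
      ((8 * gaussFour + 1024 * K ^ 3) / ((N : ℝ) + 1) * ∑ j, v j ^ 2) *
        ∫ y, eval y (ouGen u) ^ 2 ∂stdGauss (Fin N × Fin N) := by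
  have e1 := integral_offDiag_sq_le hu v hv
  have e2 := integral_diag_sq_le hu v
  have i1 : Integrable (fun y => ∑ j, ∑ k with k ≠ j,
      (v j * (rowAvg (ovl j k) y * (ev y j - ev y k))) *
        ((evGrad u j y - evGrad u k y) / (ev y j - ev y k))) (stdGauss (Fin N × Fin N)) :=
    integrable_finsetSum _ fun j _ => integrable_finsetSum _ fun k hk =>
      (memLp_rowAvg_ovl_mul v j k).integrable_mul (memLp_evDiv hu (Finset.mem_filter.1 hk).2.symm)
  have i2 : Integrable (fun y => ∑ j, (v j * rowAvg (evLast j.castSucc) y) * evGrad u j y)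
      (stdGauss (Fin N × Fin N)) := integrable_finsetSum _ fun j _ =>
    ((memLp_rowAvg_evLast j.castSucc).const_mul (v j)).integrable_mul (memLp_evGrad hu j)
  rw [integral_rowAvg_gapSum_mul_ouGen hu v, integral_congr_ae (ae_goodMnr.mono fun y hy =>
    sum_rowAvg_ovl_mul_evGrad v hy), integral_neg, neg_sq, integral_add i1 i2]
  generalize (∫ y, ∑ j, ∑ k with k ≠ j, (v j * (rowAvg (ovl j k) y * (ev y j - ev y k))) *
    ((evGrad u j y - evGrad u k y) / (ev y j - ev y k)) ∂stdGauss (Fin N × Fin N)) = A at *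
  generalize (∫ y, ∑ j, (v j * rowAvg (evLast j.castSucc) y) * evGrad u j y
    ∂stdGauss (Fin N × Fin N)) = B at *
  generalize (∫ y, eval y (ouGen u) ^ 2 ∂stdGauss (Fin N × Fin N)) = R at *
  have h1 : 2 * A * B ≤ A ^ 2 + B ^ 2 := two_mul_le_add_sq A B
  have h2 : (8 * gaussFour + 1024 * (K : ℝ) ^ 3) / ((N : ℝ) + 1) =
      2 * ((3 * gaussFour + 512 * K ^ 3) / ((N : ℝ) + 1)) + 2 * (gaussFour / ((N : ℝ) + 1)) := by
    ring
  rw [h2]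
  linarith [add_sq' A B]

end

lemma rowAvg_gapSum_unitConj (v : Fin N → ℝ) {V : Matrix (Fin N) (Fin N) ℂ} (hV : Vᴴ * V = 1)
    (y : Fin N × Fin N → ℝ) :
    rowAvg (gapSum v) ((unitConj V).mulVec y) = rowAvg (gapSum v) y := by
  simp only [rowAvg, gapSum, mnr_asm, ev_unitConj hV]
  exact integral_ev_asm_unitConj hV (fun l => ∑ j, v j * (l j.castSucc - ev y j)) (by fun_prop) y

/-- The variance of a linear combination of bulk interlacing gaps of two consecutive rows. -/
theorem integral_gapSum_sub_sq_le {K : ℕ} (v : Fin N → ℝ)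
    (hv : ∀ j, v j ≠ 0 → N + 1 ≤ K * j ∧ N + 1 ≤ K * (N - j)) :
    ∫ x, (gapSum v x - ∫ x', gapSum v x' ∂stdGauss (Fin (N + 1) × Fin (N + 1))) ^ 2
      ∂stdGauss (Fin (N + 1) × Fin (N + 1)) ≤
      (2 * Real.sqrt gaussFour + 8 * gaussFour + 1024 * K ^ 3) / ((N : ℝ) + 1) * ∑ j, v j ^ 2 := by
  obtain ⟨L, hL⟩ := exists_lipschitz_gapSum v
  have hφ := lipschitz_rowAvg hL
  set c := ∫ x', gapSum v x' ∂stdGauss (Fin (N + 1) × Fin (N + 1)) with hc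
  have hn : (0 : ℝ) < (N : ℝ) + 1 := by positivity
  have hg := gaussFour_nonneg
  have h1 := integral_gapSum_row_le v
  have hV : 0 ≤ ∑ j, v j ^ 2 := Finset.sum_nonneg fun _ _ => sq_nonneg _
  have hm := memLp_two_of_lipschitz hφ
  have h2 : ∫ y, (rowAvg (gapSum v) y - c) ^ 2 ∂stdGauss (Fin N × Fin N) ≤
      (8 * gaussFour + 1024 * K ^ 3) / ((N : ℝ) + 1) * ∑ j, v j ^ 2 := by
    have hm2 : MemLp (fun y => rowAvg (gapSum v) y - c) 2 (stdGauss (Fin N × Fin N)) :=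
      hm.sub (memLp_const c)
    refine integral_sq_le_of_ouGen (φ := fun y => rowAvg (gapSum v) y - c) hm2 ?_ (unitSet N)
      unitSet_orth ?_ (by positivity) ?_
    · rw [integral_sub (hm.integrable one_le_two) (integrable_const _), integral_rowAvg hL,
        integral_const, probReal_univ, one_smul, sub_self]
    · rintro k ⟨V, hV, rfl⟩ y
      simp only [rowAvg_gapSum_unitConj v hV]
    · intro u hu
      have h3 : ∫ y, (rowAvg (gapSum v) y - c) * eval y (ouGen u) ∂stdGauss (Fin N × Fin N) =
          ∫ y, rowAvg (gapSum v) y * eval y (ouGen u) ∂stdGauss (Fin N × Fin N) := by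
        have hi : Integrable (fun y => rowAvg (gapSum v) y * eval y (ouGen u))
            (stdGauss (Fin N × Fin N)) := hm.integrable_mul (memLp_poly _)
        simp only [sub_mul]
        rw [integral_sub hi ((integrable_poly _).const_mul _),
          integral_const_mul, integral_ouGen, mul_zero, sub_zero]
      rw [h3]
      exact integral_rowAvg_gapSum_mul_ouGen_sq_le hu v hv
  rw [integral_sub_sq_eq hL]
  calc _ ≤ 2 * Real.sqrt gaussFour / ((N : ℝ) + 1) * ∑ j, v j ^ 2 +
        (8 * gaussFour + 1024 * K ^ 3) / ((N : ℝ) + 1) * ∑ j, v j ^ 2 := add_le_add h1 h2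
    _ = _ := by ring

end

section
open Matrix
variable {N n : ℕ}

/-- The real coordinates of a Gaussian Hermitian matrix in terms of its entries. -/
def gueCoord (ω : (Fin n → ℝ) × (Fin n × Fin n → ℝ × ℝ)) : Fin n × Fin n → ℝ := fun p =>
  if p.1 = p.2 then ω.1 p.1
  else if p.1 < p.2 then Real.sqrt 2 * (ω.2 p).1 else Real.sqrt 2 * (ω.2 p.swap).2

lemma herm_gueCoord (ω : (Fin n → ℝ) × (Fin n × Fin n → ℝ × ℝ)) :
    herm (gueCoord ω) = Matrix.of fun i j =>
        if i = j then (ω.1 i : ℂ)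
        else if i < j then ((ω.2 (i, j)).1 : ℂ) + ((ω.2 (i, j)).2 : ℂ) * Complex.I
        else ((ω.2 (j, i)).1 : ℂ) - ((ω.2 (j, i)).2 : ℂ) * Complex.I := by
  have h2 : ((Real.sqrt 2 : ℝ) : ℂ) ≠ 0 := by
    simp
  ext i j
  simp only [herm, gueCoord, Matrix.of_apply]
  rcases lt_trichotomy i j with h | h | h
  · simp only [h.ne, h.ne', h, h.not_gt, if_true, if_false, Prod.swap]
    push_cast
    field_simp
  · simp [h]
  · simp only [h.ne, h.ne', h, h.not_gt, if_true, if_false, Prod.swap]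
    push_cast
    field_simp

lemma measurable_gueCoord : Measurable (gueCoord (n := n)) := by
  refine measurable_pi_lambda _ fun p => ?_
  unfold gueCoord
  split_ifs <;> fun_prop

lemma gaussianReal_half_map :
    (gaussianReal 0 (1 / 2)).map (fun t => Real.sqrt 2 * t) = gaussianReal 0 1 := by
  rw [gaussianReal_map_const_mul]
  congr 1
  · simp
  · ext
    simp

lemma prod_diag_mul_prod_lt {M : Type*} [CommMonoid M] (f : Fin n × Fin n → M) :
    (∏ a, f (a, a)) * ∏ p : Fin n × Fin n, (if p.1 < p.2 then f p * f p.swap else 1) =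
      ∏ p, f p := by
  have h1 : ∏ p : Fin n × Fin n, (if p.1 < p.2 then f p * f p.swap else 1) =
      (∏ p : Fin n × Fin n, if p.1 < p.2 then f p else 1) *
        ∏ p : Fin n × Fin n, if p.2 < p.1 then f p else 1 := by
    rw [← (Equiv.prodComm (Fin n) (Fin n)).prod_comp fun p => if p.2 < p.1 then f p else 1,
      ← Finset.prod_mul_distrib]
    refine Finset.prod_congr rfl fun p _ => ?_
    by_cases h : p.1 < p.2
    · rw [if_pos h, if_pos h, if_pos (by exact h)]
      rfl
    · rw [if_neg h, if_neg h, if_neg (by exact h), one_mul]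
  have h2 : ∏ a, f (a, a) = ∏ p : Fin n × Fin n, if p.1 = p.2 then f p else 1 := by
    rw [Fintype.prod_prod_type]
    simp
  rw [h1, h2, ← Finset.prod_mul_distrib, ← Finset.prod_mul_distrib]
  refine Finset.prod_congr rfl fun p _ => ?_
  rcases lt_trichotomy p.1 p.2 with h | h | h
  · simp [h, h.ne, h.not_gt]
  · simp [h]
  · simp [h, h.ne', h.not_gt]

lemma map_gueCoord :
    ((Measure.pi fun _ : Fin n => gaussianReal 0 1).prod
      (Measure.pi fun _ : Fin n × Fin n =>
        (gaussianReal 0 (1 / 2)).prod (gaussianReal 0 (1 / 2)))).map gueCoord =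
      stdGauss (Fin n × Fin n) := by
  refine (Measure.pi_eq fun s hs => ?_).symm
  have hsm : Measurable fun t : ℝ => Real.sqrt 2 * t := by fun_prop
  have h1 : gueCoord ⁻¹' (Set.univ.pi s) = (Set.univ.pi fun a : Fin n => s (a, a)) ×ˢ
      (Set.univ.pi fun p : Fin n × Fin n => if p.1 < p.2 then
        ((fun t : ℝ => Real.sqrt 2 * t) ⁻¹' s p) ×ˢ ((fun t : ℝ => Real.sqrt 2 * t) ⁻¹' s p.swap)
        else Set.univ) := by
    ext ω
    simp only [Set.mem_preimage, Set.mem_univ_pi, Set.mem_prod]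
    constructor
    · refine fun h => ⟨fun a => by simpa [gueCoord] using h (a, a), fun p => ?_⟩
      split_ifs with hp
      · have e1 := h p
        have e2 := h p.swap
        simp only [gueCoord, hp.ne, hp, if_true, if_false, Prod.fst_swap, Prod.snd_swap, hp.ne',
          hp.not_gt, Prod.swap_swap] at e1 e2
        exact ⟨e1, e2⟩
      · trivial
    · rintro ⟨ha, hb⟩ p
      rcases lt_trichotomy p.1 p.2 with h | h | h
      · have := hb p
        rw [if_pos h] at this
        simpa [gueCoord, h, h.ne] using this.1
      · have := ha p.1
        simp only [gueCoord, h, if_true]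
        rw [h] at this
        convert this using 2
        exact Prod.ext h rfl
      · have := hb p.swap
        rw [if_pos (by simpa using h)] at this
        simpa [gueCoord, h.not_gt, h.ne'] using this.2
  rw [Measure.map_apply measurable_gueCoord (MeasurableSet.univ_pi hs), h1, Measure.prod_prod,
    Measure.pi_pi, Measure.pi_pi, ← prod_diag_mul_prod_lt fun p => gaussianReal 0 1 (s p)]
  congr 1
  refine Finset.prod_congr rfl fun p _ => ?_
  split_ifs
  · rw [Measure.prod_prod, ← Measure.map_apply hsm (hs _), ← Measure.map_apply hsm (hs _),
      gaussianReal_half_map]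
  · simp

lemma measurable_herm : Measurable (herm (N := n)) := by
  refine measurable_pi_lambda _ fun i => measurable_pi_lambda _ fun j => ?_
  simp only [herm, Matrix.of_apply]
  split_ifs <;> fun_prop

lemma gueMeasure_eq : gueMeasure n = (stdGauss (Fin n × Fin n)).map herm := by
  rw [← map_gueCoord, Measure.map_map measurable_herm measurable_gueCoord, gueMeasure]
  congr 1
  funext ω
  exact (herm_gueCoord ω).symm

lemma measurable_entry (i j : Fin n) : Measurable fun A : Matrix (Fin n) (Fin n) ℂ => A i j :=
  (measurable_pi_apply (X := fun _ : Fin n => ℂ) j).comp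
    (measurable_pi_apply (X := fun _ : Fin n => Fin n → ℂ) i)

lemma measurable_coordH : Measurable (coordH (N := n)) := by
  have h := measurable_entry (n := n)
  refine measurable_pi_lambda _ fun p => ?_
  unfold coordH
  split_ifs
  · exact Complex.measurable_re.comp (h _ _)
  · exact (Complex.measurable_re.comp (h _ _)).const_mul _
  · exact (Complex.measurable_im.comp (h _ _)).const_mul _

lemma measurable_eigsDesc (j : Fin n) :
    Measurable fun A : Matrix (Fin n) (Fin n) ℂ => eigsDesc A j := by
  have h := measurable_entry (n := n)
  have hs : MeasurableSet {A : Matrix (Fin n) (Fin n) ℂ | A.IsHermitian} := by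
    have : {A : Matrix (Fin n) (Fin n) ℂ | A.IsHermitian} =
        ⋂ i, ⋂ j, {A : Matrix (Fin n) (Fin n) ℂ | star (A j i) = A i j} := by
      ext A
      simp only [Set.mem_setOf_eq, Set.mem_iInter, Matrix.IsHermitian.ext_iff]
    rw [this]
    refine MeasurableSet.iInter fun i => MeasurableSet.iInter fun j => ?_
    exact measurableSet_eq_fun (continuous_star.measurable.comp (h j i)) (h i j)
  have h2 : (fun A : Matrix (Fin n) (Fin n) ℂ => eigsDesc A j) =
      {A : Matrix (Fin n) (Fin n) ℂ | A.IsHermitian}.indicator fun A => ev (coordH A) j := by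
    funext A
    by_cases hA : A.IsHermitian
    · rw [Set.indicator_of_mem (show A ∈ {A : Matrix (Fin n) (Fin n) ℂ | A.IsHermitian} from hA),
        ev, herm_coordH hA]
    · rw [Set.indicator_of_notMem (show A ∉ {A : Matrix (Fin n) (Fin n) ℂ | A.IsHermitian} from hA),
        eigsDesc, dif_neg hA]
      rfl
  rw [h2]
  exact ((continuous_ev j).measurable.comp measurable_coordH).indicator hs

lemma measurable_minorEig (σ : ℝ) (i j : ℕ) :
    Measurable fun A : Matrix (Fin n) (Fin n) ℂ => minorEig σ A i j := by
  unfold minorEig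
  split_ifs with h
  · refine Measurable.const_mul ((measurable_eigsDesc _).comp ?_) _
    exact measurable_pi_lambda _ fun a => measurable_pi_lambda _ fun b =>
      measurable_entry _ _
  · exact measurable_const

lemma measurable_patchGap (σ i0 j0 : ℝ) (m : ℕ) (p : Fin (2 * m + 1) × Fin (2 * m + 1)) :
    Measurable fun A : Matrix (Fin n) (Fin n) ℂ => patchGap σ i0 j0 m p A :=
  (measurable_minorEig _ _ _).sub (measurable_minorEig _ _ _)

/-- The coordinates of the top-left minor of size `i`. -/
def topMnr {i : ℕ} (h : i ≤ n) (x : Fin n × Fin n → ℝ) : Fin i × Fin i → ℝ := fun p =>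
  x (p.1.castLE h, p.2.castLE h)

lemma herm_topMnr {i : ℕ} (h : i ≤ n) (x : Fin n × Fin n → ℝ) :
    herm (topMnr h x) = (herm x).submatrix (Fin.castLE h) (Fin.castLE h) := by
  ext a b
  simp [herm, topMnr]

lemma mnr_topMnr (h : N + 1 ≤ n) (x : Fin n × Fin n → ℝ) :
    mnr (topMnr h x) = topMnr ((Nat.le_succ N).trans h) x := rfl

lemma measurePreserving_topMnr {i : ℕ} (h : i ≤ n) :
    MeasurePreserving (topMnr h) (stdGauss (Fin n × Fin n)) (stdGauss (Fin i × Fin i)) := by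
  have he : Function.Injective fun p : Fin i × Fin i => (p.1.castLE h, p.2.castLE h) := by
    rintro ⟨a, b⟩ ⟨c, d⟩ hab
    simpa [Fin.ext_iff] using hab
  set e : Fin i × Fin i → Fin n × Fin n := fun p => (p.1.castLE h, p.2.castLE h) with hedef
  have h2 : MeasurePreserving (LinearMap.funLeft ℝ ℝ e) (stdGauss (Fin n × Fin n))
      (stdGauss (Fin i × Fin i)) := by
    refine ⟨(LinearMap.continuous_of_finiteDimensional _).measurable,
      stdGauss_map_linear _ fun t => ?_⟩
    symm
    refine Finset.sum_of_injOn e he.injOn (fun _ _ => Finset.mem_univ _) ?_ ?_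
    · intro q _ hq
      have : ∀ p, q ≠ e p := fun p hp => hq ⟨p, by simp, hp.symm⟩
      rw [Finset.sum_eq_zero, zero_pow two_ne_zero]
      intro p _
      simp [LinearMap.funLeft, Ne.symm (this p)]
    · intro p _
      congr 1
      rw [Finset.sum_eq_single p]
      · simp [LinearMap.funLeft]
      · intro q _ hq
        simp [LinearMap.funLeft, he.ne hq]
      · simp
  exact h2

lemma minorEig_herm (σ : ℝ) {i j : ℕ} (h1 : 1 ≤ j) (h2 : j ≤ i) (h3 : i ≤ n)
    (x : Fin n × Fin n → ℝ) :
    minorEig σ (herm x) i j =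
      Real.sqrt (σ ^ 2 * n) * ev (topMnr h3 x) ⟨j - 1, by omega⟩ := by
  rw [minorEig, dif_pos ⟨h1, h2, h3⟩, ev, herm_topMnr]
  rfl

lemma minorEig_sub_herm (σ : ℝ) {j : ℕ} (h1 : 1 ≤ j) (h2 : j ≤ N) (h3 : N + 1 ≤ n)
    (x : Fin n × Fin n → ℝ) :
    minorEig σ (herm x) (N + 1) j - minorEig σ (herm x) N j =
      Real.sqrt (σ ^ 2 * n) * (ev (topMnr h3 x) (Fin.castSucc ⟨j - 1, by omega⟩) -
        ev (mnr (topMnr h3 x)) ⟨j - 1, by omega⟩) := by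
  rw [minorEig_herm σ h1 (h2.trans (Nat.le_succ N)) h3, minorEig_herm σ h1 h2 (by omega),
    mul_sub, mnr_topMnr]
  rfl

end

section
open Matrix
variable {N n : ℕ}

/-- The operator norm of a covariance matrix is bounded by the variances of linear combinations. -/
lemma norm_toEuclideanCLM_cov_le {Ω ι : Type*} [Fintype ι] [DecidableEq ι] [MeasurableSpace Ω]
    {μ : Measure Ω} [IsProbabilityMeasure μ] {g : ι → Ω → ℝ} (hg : ∀ i, MemLp (g i) 2 μ) {B : ℝ}
    (hB : 0 ≤ B)
    (h : ∀ w : ι → ℝ, ∫ x, (∑ i, w i * (g i x - ∫ y, g i y ∂μ)) ^ 2 ∂μ ≤ B * ∑ i, w i ^ 2) :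
    ‖Matrix.toEuclideanCLM (𝕜 := ℝ) (Matrix.of fun p q : ι =>
      (∫ x, g p x * g q x ∂μ) - (∫ x, g p x ∂μ) * ∫ x, g q x ∂μ)‖ ≤ B := by
  set M : Matrix ι ι ℝ := Matrix.of fun p q : ι =>
      (∫ x, g p x * g q x ∂μ) - (∫ x, g p x ∂μ) * ∫ x, g q x ∂μ with hM
  set c : ι → ℝ := fun i => ∫ y, g i y ∂μ with hc
  have hgc : ∀ i, MemLp (fun x => g i x - c i) 2 μ := fun i => (hg i).sub (memLp_const _)
  have hii : ∀ p q, Integrable (fun x => (g p x - c p) * (g q x - c q)) μ := fun p q =>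
    (hgc p).integrable_mul (hgc q)
  have hMe : ∀ p q, M p q = ∫ x, (g p x - c p) * (g q x - c q) ∂μ := fun p q => by
    have i1 : Integrable (fun x => g p x * g q x) μ := (hg p).integrable_mul (hg q)
    have i2 := (hg p).integrable one_le_two
    have i3 := (hg q).integrable one_le_two
    have i6 : Integrable (fun x => g p x * g q x - g p x * c q) μ := i1.sub (i2.mul_const _)
    have i4 : Integrable (fun x => c p * g q x - c p * c q) μ :=
      (i3.const_mul _).sub (integrable_const _)
    have i5 : Integrable (fun x => g p x * c q) μ := i2.mul_const _
    have e : ∀ x, (g p x - c p) * (g q x - c q) =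
        (g p x * g q x - g p x * c q) - (c p * g q x - c p * c q) := fun x => by ring
    simp only [e]
    rw [integral_sub i6 i4, integral_sub i1 i5, integral_sub (i3.const_mul _)
      (integrable_const _), integral_mul_const, integral_const_mul, integral_const]
    simp [hM, hc]
  have hS : ∀ w : ι → ℝ, MemLp (fun x => ∑ i, w i * (g i x - c i)) 2 μ := fun w =>
    memLp_finsetSum _ fun i _ => (hgc i).const_mul (w i)
  have hq : ∀ w z : ι → ℝ, w ⬝ᵥ M *ᵥ z =
      ∫ x, (∑ i, w i * (g i x - c i)) * ∑ i, z i * (g i x - c i) ∂μ := fun w z => by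
    have e : ∀ x, (∑ i, w i * (g i x - c i)) * ∑ i, z i * (g i x - c i) =
        ∑ p, ∑ q, w p * z q * ((g p x - c p) * (g q x - c q)) := fun x => by
      rw [Finset.sum_mul_sum]
      exact Finset.sum_congr rfl fun p _ => Finset.sum_congr rfl fun q _ => by ring
    simp only [e]
    rw [integral_finsetSum _ fun p _ => integrable_finsetSum _ fun q _ => (hii p q).const_mul _]
    refine Finset.sum_congr rfl fun p _ => ?_
    rw [integral_finsetSum _ fun q _ => (hii p q).const_mul _, mulVec, dotProduct, Finset.mul_sum]
    refine Finset.sum_congr rfl fun q _ => ?_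
    rw [integral_const_mul, hMe]
    ring
  refine ContinuousLinearMap.opNorm_le_bound _ hB fun z => ?_
  set w := Matrix.toEuclideanCLM (𝕜 := ℝ) M z with hw
  have h1 : ‖w‖ ^ 2 = w.ofLp ⬝ᵥ M *ᵥ z.ofLp := by
    rw [← inner_toEuclideanCLM, ← hw, real_inner_self_eq_norm_sq]
  have h2 := integral_mul_sq_le (hS w.ofLp) (hS z.ofLp)
  rw [← hq, ← h1] at h2
  have h3 := h w.ofLp
  have h4 := h z.ofLp
  have e1 : ∑ i, w.ofLp i ^ 2 = ‖w‖ ^ 2 := by rw [EuclideanSpace.real_norm_sq_eq]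
  have e2 : ∑ i, z.ofLp i ^ 2 = ‖z‖ ^ 2 := by rw [EuclideanSpace.real_norm_sq_eq]
  rw [e1] at h3
  rw [e2] at h4
  have h5 := h2.trans (mul_le_mul h3 h4 (integral_nonneg fun x => sq_nonneg _) (by positivity))
  rcases (norm_nonneg w).eq_or_lt with h0 | h0
  · rw [← h0]; positivity
  · have h6 : ‖w‖ ^ 2 ≤ (B * ‖z‖) ^ 2 := by
      have : ‖w‖ ^ 2 * ‖w‖ ^ 2 ≤ ‖w‖ ^ 2 * (B * ‖z‖) ^ 2 := by nlinarith
      exact le_of_mul_le_mul_left this (by positivity)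
    exact le_of_sq_le_sq h6 (by positivity)

/-- The variance bound for linear combinations over a product index set, from a bound for rows. -/
lemma integral_sum_prod_sq_le {Ω α β : Type*} [Fintype α] [Fintype β] [MeasurableSpace Ω]
    {μ : Measure Ω} {g : α × β → Ω → ℝ} (hg : ∀ p, MemLp (g p) 2 μ) {B : ℝ}
    (h : ∀ a, ∀ w : β → ℝ, ∫ x, (∑ b, w b * g (a, b) x) ^ 2 ∂μ ≤ B * ∑ b, w b ^ 2)
    (w : α × β → ℝ) :
    ∫ x, (∑ p, w p * g p x) ^ 2 ∂μ ≤ (Fintype.card α * B) * ∑ p, w p ^ 2 := by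
  have hS : ∀ a, MemLp (fun x => ∑ b, w (a, b) * g (a, b) x) 2 μ := fun a =>
    memLp_finsetSum _ fun b _ => (hg (a, b)).const_mul _
  calc _ ≤ ∫ x, Fintype.card α * ∑ a, (∑ b, w (a, b) * g (a, b) x) ^ 2 ∂μ := by
        refine integral_mono (memLp_finsetSum _ fun p _ => (hg p).const_mul _).integrable_sq
          ((integrable_finsetSum _ fun a _ => (hS a).integrable_sq).const_mul _) fun x => ?_
        simp only [Fintype.sum_prod_type]
        exact sq_sum_le_card_mul_sum_sq
    _ = Fintype.card α * ∑ a, ∫ x, (∑ b, w (a, b) * g (a, b) x) ^ 2 ∂μ := by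
        rw [integral_const_mul, integral_finsetSum _ fun a _ => (hS a).integrable_sq]
    _ ≤ Fintype.card α * ∑ a, B * ∑ b, w (a, b) ^ 2 :=
        mul_le_mul_of_nonneg_left (Finset.sum_le_sum fun a _ => h a _) (Nat.cast_nonneg _)
    _ = _ := by rw [← Finset.mul_sum, Fintype.sum_prod_type, mul_assoc]

/-- The constant in the variance bound for one row. -/
def rowConst (K : ℕ) : ℝ := 2 * Real.sqrt gaussFour + 8 * gaussFour + 1024 * K ^ 3

lemma rowConst_nonneg (K : ℕ) : 0 ≤ rowConst K := by
  have := gaussFour_nonneg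
  unfold rowConst
  positivity

lemma memLp_gue {f : Matrix (Fin n) (Fin n) ℂ → ℝ} (hf : Measurable f) (h3 : N + 1 ≤ n) {s : ℝ}
    {k : Fin N} (h : ∀ x, f (herm x) =
      s * (ev (topMnr h3 x) k.castSucc - ev (mnr (topMnr h3 x)) k)) :
    MemLp f 2 (gueMeasure n) := by
  rw [gueMeasure_eq, memLp_map_measure_iff hf.aestronglyMeasurable measurable_herm.aemeasurable]
  have hl := memLp_two_of_lipschitz ((ev_lipschitz k.castSucc).sub (lipschitz_ev_mnr k))
  have := (hl.comp_measurePreserving (measurePreserving_topMnr h3)).const_mul s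
  convert this using 1
  funext x
  exact h x

instance : IsProbabilityMeasure (gueMeasure n) := by
  rw [gueMeasure_eq]
  exact Measure.isProbabilityMeasure_map measurable_herm.aemeasurable

lemma integral_gue {f : Matrix (Fin n) (Fin n) ℂ → ℝ} (hf : Measurable f) :
    ∫ A, f A ∂gueMeasure n = ∫ x, f (herm x) ∂stdGauss (Fin n × Fin n) := by
  rw [gueMeasure_eq, integral_map measurable_herm.aemeasurable hf.aestronglyMeasurable]

lemma integral_topMnr {i : ℕ} (h : i ≤ n) {f : (Fin i × Fin i → ℝ) → ℝ} (hf : Measurable f) :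
    ∫ x, f (topMnr h x) ∂stdGauss (Fin n × Fin n) = ∫ x, f x ∂stdGauss (Fin i × Fin i) := by
  rw [← (measurePreserving_topMnr h).map_eq,
    integral_map (measurePreserving_topMnr h).measurable.aemeasurable hf.aestronglyMeasurable]

lemma integral_row_sq_le {β : Type*} [Fintype β] {K : ℕ} (h3 : N + 1 ≤ n) {c : β → Fin N}
    (hc : Function.Injective c) (hK : ∀ b, N + 1 ≤ K * (c b) ∧ N + 1 ≤ K * (N - (c b)))
    {s : ℝ} {g : β → Matrix (Fin n) (Fin n) ℂ → ℝ} (hm : ∀ b, Measurable (g b))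
    (hg : ∀ b x, g b (herm x) =
      s * (ev (topMnr h3 x) (c b).castSucc - ev (mnr (topMnr h3 x)) (c b))) (w : β → ℝ) :
    ∫ A, (∑ b, w b * (g b A - ∫ A', g b A' ∂gueMeasure n)) ^ 2 ∂gueMeasure n ≤
      s ^ 2 * (rowConst K / ((N : ℝ) + 1)) * ∑ b, w b ^ 2 := by
  classical
  set v : Fin N → ℝ := fun j => ∑ b, if c b = j then w b else 0 with hv
  have hvc : ∀ b, v (c b) = w b := fun b => by
    simp [hv, hc.eq_iff]
  have hsum : ∀ f : Fin N → ℝ, ∑ j, v j * f j = ∑ b, w b * f (c b) := fun f => by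
    simp only [hv, Finset.sum_mul, ite_mul, zero_mul]
    rw [Finset.sum_comm]
    simp
  have hvs : ∑ j, v j ^ 2 = ∑ b, w b ^ 2 := by
    simp only [sq]
    rw [hsum v]
    simp only [hvc]
  have hv0 : ∀ j, v j ≠ 0 → N + 1 ≤ K * j ∧ N + 1 ≤ K * (N - j) := fun j hj => by
    obtain ⟨b, -, hb⟩ := Finset.exists_ne_zero_of_sum_ne_zero hj
    have : c b = j := by
      by_contra h
      simp [h] at hb
    exact this ▸ hK b
  have hrow := integral_gapSum_sub_sq_le v hv0
  obtain ⟨L, hL⟩ := exists_lipschitz_gapSum v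
  have hgs : Measurable (gapSum v) := hL.continuous.measurable
  have hlin : ∀ x, ∑ b, w b * g b (herm x) = s * gapSum v (topMnr h3 x) := fun x => by
    rw [gapSum, hsum fun j => ev (topMnr h3 x) j.castSucc - ev (mnr (topMnr h3 x)) j,
      Finset.mul_sum]
    exact Finset.sum_congr rfl fun b _ => by rw [hg]; ring
  have hmean : ∑ b, w b * ∫ A', g b A' ∂gueMeasure n =
      s * ∫ x', gapSum v x' ∂stdGauss (Fin (N + 1) × Fin (N + 1)) := by
    have hi : ∀ b, Integrable (fun A => w b * g b A) (gueMeasure n) := fun b =>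
      ((memLp_gue (hm b) h3 (hg b)).integrable one_le_two).const_mul _
    simp only [← integral_const_mul]
    rw [← integral_finsetSum _ fun b _ => hi b, integral_gue (Finset.measurable_fun_sum _
      fun b _ => (hm b).const_mul _)]
    simp only [hlin]
    rw [integral_const_mul, integral_const_mul, integral_topMnr h3 hgs]
  have hfm : Measurable fun A => (∑ b, w b * (g b A - ∫ A', g b A' ∂gueMeasure n)) ^ 2 :=
    (Finset.measurable_fun_sum _ fun b _ => ((hm b).sub_const _).const_mul _).pow_const 2
  have e1 : ∫ A, (∑ b, w b * (g b A - ∫ A', g b A' ∂gueMeasure n)) ^ 2 ∂gueMeasure n =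
      s ^ 2 * ∫ x, (gapSum v x - ∫ x', gapSum v x' ∂stdGauss (Fin (N + 1) × Fin (N + 1))) ^ 2
      ∂stdGauss (Fin (N + 1) × Fin (N + 1)) := by
    rw [integral_gue hfm]
    simp only [mul_sub, Finset.sum_sub_distrib, hlin, hmean]
    simp only [← mul_sub, mul_pow]
    rw [integral_const_mul]
    congr 1
    exact integral_topMnr h3 ((hgs.sub_const _).pow_const 2)
  rw [e1, ← hvs, mul_assoc]
  exact mul_le_mul_of_nonneg_left hrow (sq_nonneg s)

end

section
open Matrix

/-- For a small patch, all indices lie in the bulk. -/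
lemma patchIdx_bulk {i0 j0 ε : ℝ} (hε : 0 < ε) (h1 : ε ≤ j0) (h2 : ε ≤ i0 - j0) (h3 : ε ≤ 1 - i0)
    {K : ℕ} (hK : 2 ≤ K * ε) {n m : ℕ} (hm : (m : ℝ) ≤ ε * n / 8) (hn : 1 ≤ ε * n / 8)
    (a b : Fin (2 * m + 1)) :
    (patchIdx i0 j0 n m (a, b)).1 ≤ n ∧ 1 ≤ (patchIdx i0 j0 n m (a, b)).2 ∧
      (patchIdx i0 j0 n m (a, b)).2 + 1 ≤ (patchIdx i0 j0 n m (a, b)).1 ∧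
      ε * n / 2 ≤ (patchIdx i0 j0 n m (a, b)).1 ∧
      (patchIdx i0 j0 n m (a, b)).1 ≤ K * ((patchIdx i0 j0 n m (a, b)).2 - 1) ∧
      (patchIdx i0 j0 n m (a, b)).1 ≤
        K * ((patchIdx i0 j0 n m (a, b)).1 - (patchIdx i0 j0 n m (a, b)).2) ∧
      ((patchIdx i0 j0 n m (a, b)).2 : ℤ) = ⌈j0 * n⌉ - m + b.val := by
  have ha : (a.val : ℝ) ≤ 2 * m := by exact_mod_cast Nat.lt_succ_iff.1 a.isLt
  have hb : (b.val : ℝ) ≤ 2 * m := by exact_mod_cast Nat.lt_succ_iff.1 b.isLt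
  have ha0 : (0 : ℝ) ≤ a.val := Nat.cast_nonneg _
  have hb0 : (0 : ℝ) ≤ b.val := Nat.cast_nonneg _
  have hn0 : (0 : ℝ) ≤ n := Nat.cast_nonneg _
  have c1 := Int.le_ceil (i0 * n)
  have c2 := Int.ceil_lt_add_one (i0 * n)
  have c3 := Int.le_ceil (j0 * n)
  have c4 := Int.ceil_lt_add_one (j0 * n)
  have p1 : ε * n ≤ j0 * n := mul_le_mul_of_nonneg_right h1 hn0
  have p2 : ε * n ≤ (i0 - j0) * n := mul_le_mul_of_nonneg_right h2 hn0
  have p3 : ε * n ≤ (1 - i0) * n := mul_le_mul_of_nonneg_right h3 hn0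
  have p4 : (2 : ℝ) * n ≤ K * (ε * n) := by
    rw [← mul_assoc]; exact mul_le_mul_of_nonneg_right hK hn0
  set zi : ℤ := ⌈i0 * n⌉ - m + a.val with hzi
  set zj : ℤ := ⌈j0 * n⌉ - m + b.val with hzj
  have ri : (zi : ℝ) = (⌈i0 * n⌉ : ℝ) - m + a.val := by rw [hzi]; push_cast; ring
  have rj : (zj : ℝ) = (⌈j0 * n⌉ : ℝ) - m + b.val := by rw [hzj]; push_cast; ring
  have zi0 : 0 ≤ zi := by
    have : (0 : ℝ) ≤ zi := by rw [ri]; nlinarith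
    exact_mod_cast this
  have zj0 : 0 ≤ zj := by
    have : (0 : ℝ) ≤ zj := by rw [rj]; nlinarith
    exact_mod_cast this
  obtain ⟨i, hi⟩ := Int.eq_ofNat_of_zero_le zi0
  obtain ⟨j, hj⟩ := Int.eq_ofNat_of_zero_le zj0
  have ei : (patchIdx i0 j0 n m (a, b)).1 = i := by
    simp only [patchIdx, ← hzi, hi, Int.toNat_natCast]
  have ej : (patchIdx i0 j0 n m (a, b)).2 = j := by
    simp only [patchIdx, ← hzj, hj, Int.toNat_natCast]
  rw [ei, ej]
  have ri' : (i : ℝ) = (⌈i0 * n⌉ : ℝ) - m + a.val := by rw [← ri, hi]; simp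
  have rj' : (j : ℝ) = (⌈j0 * n⌉ : ℝ) - m + b.val := by rw [← rj, hj]; simp
  have q1 : (i : ℝ) ≤ n := by rw [ri']; nlinarith
  have q2 : ε * n / 2 ≤ (j : ℝ) - 1 := by rw [rj']; nlinarith
  have q3 : ε * n / 2 ≤ (i : ℝ) - j := by rw [ri', rj']; nlinarith
  have q4 : ε * n / 2 ≤ (i : ℝ) := by rw [ri']; nlinarith
  have s1 : 1 ≤ j := by
    have : (1 : ℝ) ≤ j := by linarith
    exact_mod_cast this
  have s2 : j + 1 ≤ i := by
    have : ((j : ℝ) + 1) ≤ i := by linarith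
    exact_mod_cast this
  refine ⟨by exact_mod_cast q1, s1, s2, q4, ?_, ?_, hj.symm⟩
  · have : (i : ℝ) ≤ K * ((j - 1 : ℕ) : ℝ) := by
      rw [Nat.cast_sub s1, Nat.cast_one]
      have := mul_le_mul_of_nonneg_left q2 (Nat.cast_nonneg (α := ℝ) K)
      linarith
    exact_mod_cast this
  · have : (i : ℝ) ≤ K * ((i - j : ℕ) : ℝ) := by
      rw [Nat.cast_sub (by omega)]
      have := mul_le_mul_of_nonneg_left q3 (Nat.cast_nonneg (α := ℝ) K)
      linarith
    exact_mod_cast this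

/-- The covariance matrix of a small bulk patch has operator norm of order `m`. -/
lemma norm_covMatrix_le {σ i0 j0 ε : ℝ} (hε : 0 < ε) (h1 : ε ≤ j0) (h2 : ε ≤ i0 - j0)
    (h3 : ε ≤ 1 - i0) {K : ℕ} (hK : 2 ≤ K * ε) {n m : ℕ} (hm : (m : ℝ) ≤ ε * n / 8)
    (hn : 1 ≤ ε * n / 8) :
    ‖Matrix.toEuclideanCLM (𝕜 := ℝ) (covMatrix σ i0 j0 n m)‖ ≤
      (2 * m + 1) * (2 * σ ^ 2 * rowConst K / ε) := by
  have hn0 : (0 : ℝ) < n := by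
    rcases Nat.eq_zero_or_pos n with h | h
    · simp [h] at hn; linarith
    · exact_mod_cast h
  have hrc := rowConst_nonneg K
  have key : ∀ a : Fin (2 * m + 1), ∃ (N : ℕ) (hN : N + 1 ≤ n) (c : Fin (2 * m + 1) → Fin N),
      Function.Injective c ∧ (∀ b, N + 1 ≤ K * (c b) ∧ N + 1 ≤ K * (N - (c b))) ∧
      ε * n / 2 ≤ (N : ℝ) + 1 ∧ ∀ b x, patchGap σ i0 j0 m (a, b) (herm x) =
        Real.sqrt (σ ^ 2 * n) *
          (ev (topMnr hN x) (c b).castSucc - ev (mnr (topMnr hN x)) (c b)) := by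
    intro a
    have hb := fun b => patchIdx_bulk hε h1 h2 h3 hK hm hn a b
    set i := (patchIdx i0 j0 n m (a, a)).1 with hi
    have hi' : ∀ b, (patchIdx i0 j0 n m (a, b)).1 = i := fun b => rfl
    simp only [hi'] at hb
    obtain ⟨N, hN⟩ : ∃ N, i = N + 1 := ⟨i - 1, by have := hb a; omega⟩
    simp only [hN] at hb
    refine ⟨N, (hb a).1, fun b => ⟨(patchIdx i0 j0 n m (a, b)).2 - 1, by have := hb b; omega⟩,
      fun b b' h => ?_, fun b => ⟨(hb b).2.2.2.2.1, ?_⟩, ?_, fun b x => ?_⟩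
    · have e1 := (hb b).2.2.2.2.2.2
      have e2 := (hb b').2.2.2.2.2.2
      have e3 := (hb b).2.1
      have e4 := (hb b').2.1
      simp only [Fin.mk.injEq] at h
      ext
      omega
    · have e := (hb b).2.2.2.2.2.1
      have e3 := (hb b).2.1
      have e4 := (hb b).2.2.1
      rwa [show N + 1 - (patchIdx i0 j0 n m (a, b)).2 =
        N - ((patchIdx i0 j0 n m (a, b)).2 - 1) by omega] at e
    · exact_mod_cast (hb a).2.2.2.1
    · rw [patchGap, hi' b, hN, Nat.add_sub_cancel]
      exact minorEig_sub_herm σ (hb b).2.1 (by have := (hb b).2.2.1; omega) _ x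
  have hL : ∀ p, MemLp (fun A => patchGap σ i0 j0 m p A) 2 (gueMeasure n) := by
    rintro ⟨a, b⟩
    obtain ⟨N, hN, c, -, -, -, hg⟩ := key a
    exact memLp_gue (measurable_patchGap _ _ _ _ _) hN (hg b)
  have hB : 0 ≤ 2 * σ ^ 2 * rowConst K / ε := by positivity
  refine norm_toEuclideanCLM_cov_le hL (by positivity) fun w => ?_
  refine (integral_sum_prod_sq_le (fun p => (hL p).sub (memLp_const _))
    (B := 2 * σ ^ 2 * rowConst K / ε) (fun a w => ?_) w).trans (le_of_eq ?_)
  · obtain ⟨N, hN, c, hc, hcK, hNε, hg⟩ := key a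
    refine (integral_row_sq_le hN hc hcK (g := fun b A => patchGap σ i0 j0 m (a, b) A)
      (fun b => measurable_patchGap _ _ _ _ _) hg w).trans ?_
    refine mul_le_mul_of_nonneg_right ?_ (Finset.sum_nonneg fun _ _ => sq_nonneg _)
    rw [Real.sq_sqrt (by positivity)]
    have hN0 : (0 : ℝ) < (N : ℝ) + 1 := by positivity
    rw [mul_div_assoc', div_le_div_iff₀ hN0 hε]
    have : 0 ≤ σ ^ 2 * rowConst K := by positivity
    nlinarith [mul_le_mul_of_nonneg_left hNε this]
  · simp

end

/-- Fix `σ > 0`, `0 < j₀ < i₀ < 1`, `C > 0` and a sequence `m(n) → ∞` with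
`m(n)/n → 0`.  Then there are `C' > 0` and `n₀` such that for all `n > n₀` the operator norm
of the covariance matrix of the interlacing gaps over the patch `P_n` satisfies
`‖M_n‖_op ≤ C' m² / (log m)^C`. -/
theorem cov_matrix_opNorm (σ i0 j0 : ℝ) (hσ : 0 < σ)
    (hj0 : 0 < j0) (hij : j0 < i0) (hi0 : i0 < 1)
    (C : ℝ) (hC : 0 < C)
    (m : ℕ → ℕ) (hm : Filter.Tendsto m Filter.atTop Filter.atTop)
    (hmn : Filter.Tendsto (fun n => (m n : ℝ) / n) Filter.atTop (nhds 0)) :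
    ∃ (C' : ℝ) (n0 : ℕ), 0 < C' ∧ ∀ n : ℕ, n0 < n →
      ‖Matrix.toEuclideanCLM (𝕜 := ℝ) (covMatrix σ i0 j0 n (m n))‖ ≤
        C' * (m n : ℝ) ^ 2 / Real.log (m n) ^ C := by
  set ε := min j0 (min (i0 - j0) (1 - i0)) with hεd
  have hε : 0 < ε := lt_min hj0 (lt_min (by linarith) (by linarith))
  have h1 : ε ≤ j0 := min_le_left _ _
  have h2 : ε ≤ i0 - j0 := (min_le_right _ _).trans (min_le_left _ _)
  have h3 : ε ≤ 1 - i0 := (min_le_right _ _).trans (min_le_right _ _)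
  obtain ⟨K, hK⟩ := exists_nat_ge (2 / ε)
  rw [div_le_iff₀ hε] at hK
  set D := 2 * σ ^ 2 * rowConst K / ε with hD
  have hD0 : 0 ≤ D := by
    have := rowConst_nonneg K
    positivity
  have hmR : Filter.Tendsto (fun n => (m n : ℝ)) Filter.atTop Filter.atTop :=
    tendsto_natCast_atTop_atTop.comp hm
  have hlog : ∀ᶠ n in Filter.atTop, Real.log (m n) ^ C ≤ m n := by
    have := (isLittleO_log_rpow_rpow_atTop C (zero_lt_one' ℝ)).bound zero_lt_one
    filter_upwards [hmR.eventually this, hmR.eventually_ge_atTop 1] with n hn hn1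
    rw [Real.rpow_one, one_mul, Real.norm_of_nonneg (Real.rpow_nonneg (Real.log_nonneg hn1) _),
      Real.norm_of_nonneg (by linarith)] at hn
    exact hn
  have hsmall : ∀ᶠ n : ℕ in Filter.atTop, (m n : ℝ) ≤ ε * n / 8 := by
    filter_upwards [hmn.eventually_le_const (show (0 : ℝ) < ε / 8 by positivity),
      Filter.eventually_gt_atTop 0] with n hn hn0
    have hn0' : (0 : ℝ) < n := by exact_mod_cast hn0
    rw [div_le_iff₀ hn0'] at hn
    linarith
  have hbig : ∀ᶠ n : ℕ in Filter.atTop, 1 ≤ ε * n / 8 := by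
    filter_upwards [tendsto_natCast_atTop_atTop.eventually_ge_atTop (8 / ε)] with n hn
    rw [div_le_iff₀ hε] at hn
    linarith
  obtain ⟨n0, hn0⟩ := Filter.eventually_atTop.1 (hlog.and (hsmall.and (hbig.and
    (hmR.eventually_ge_atTop 2))))
  refine ⟨3 * D + 1, n0, by positivity, fun n hn => ?_⟩
  obtain ⟨l1, l2, l3, l4⟩ := hn0 n hn.le
  refine (norm_covMatrix_le hε h1 h2 h3 hK l2 l3).trans ?_
  have hlp : 0 < Real.log (m n) ^ C := Real.rpow_pos_of_pos (Real.log_pos (by linarith)) _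
  rw [le_div_iff₀ hlp]
  calc (2 * (m n : ℝ) + 1) * D * Real.log (m n) ^ C ≤ (2 * (m n : ℝ) + 1) * D * m n :=
        mul_le_mul_of_nonneg_left l1 (by positivity)
    _ ≤ (3 * m n) * D * m n := by
        have : 0 ≤ D * m n := by positivity
        nlinarith
    _ ≤ (3 * D + 1) * (m n : ℝ) ^ 2 := by nlinarith [sq_nonneg (m n : ℝ)]
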